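/- arXiv:2603.06137 — 2 statements merged into one kernel-verified Lean document; each statement's English description precedes it below -/
import Mathlib

section
/- (Bandi–De Saxcé) Let m ≥ 1 and τ = (τ1, …, τm) with τ1 = τ2 = ⋯ = τm > 1/m. Define the set of exact Ψ_τ-approximable vectors E_m(Ψ_τ) := A_m(Ψ_τ) \ ⋃_{0<c<1} A_m(cΨ_τ). Then dim_H E_m(Ψ_τ) = dim_H A_m(Ψ_τ) = (m + 1)/(1 + τ1). -/
open MeasureTheory Set

noncomputable section

/-- The set of Ψ-approximable vectors in `[0,1]^m`: points `x` such that for infinitely many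
positive integers `q` there exists `p ∈ ℤ^m` with `|q * x i - p i| < Ψ q i` for all `i`. -/
def approxSet (m : ℕ) (Ψ : ℕ → Fin m → ℝ) : Set (Fin m → ℝ) :=
  {x | (∀ i, x i ∈ Set.Icc (0:ℝ) 1) ∧
    {q : ℕ | 0 < q ∧ ∃ p : Fin m → ℤ,
      ∀ i, |(q : ℝ) * x i - (p i : ℝ)| < Ψ q i}.Infinite}

/-- The set of weighted Ψ-badly approximable vectors:
`B_m(Ψ) = A_m(Ψ) \ ⋂_{0<c<1} A_m(cΨ)`. -/
def badSet (m : ℕ) (Ψ : ℕ → Fin m → ℝ) : Set (Fin m → ℝ) :=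
  approxSet m Ψ \ ⋂ c ∈ Set.Ioo (0:ℝ) 1, approxSet m (fun q i => c * Ψ q i)

/-- The power-law approximation function `Ψ_τ`, with `ψ_i(q) = q^{-τ_i}`. -/
def psiTau (m : ℕ) (τ : Fin m → ℝ) : ℕ → Fin m → ℝ :=
  fun q i => (q : ℝ) ^ (-(τ i))

/-- The set of exact Ψ-approximable vectors: `E_m(Ψ) = A_m(Ψ) \ ⋃_{0<c<1} A_m(cΨ)`. -/
def exactSet (m : ℕ) (Ψ : ℕ → Fin m → ℝ) : Set (Fin m → ℝ) :=
  approxSet m Ψ \ ⋃ c ∈ Set.Ioo (0:ℝ) 1, approxSet m (fun q i => c * Ψ q i)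

/-- A finite set of nonzero integers of absolute value less than `t` has at most `2 t` elements. -/
lemma card_nonzero_abs_lt (s : Finset ℤ) (t : ℝ) (ht : 0 ≤ t)
    (h : ∀ w ∈ s, w ≠ 0 ∧ |(w : ℝ)| < t) : (s.card : ℝ) ≤ 2 * t := by
  have hsub : s ⊆ (Finset.Icc (-⌊t⌋) ⌊t⌋).erase 0 := by
    intro w hw
    obtain ⟨h0, h1⟩ := h w hw
    rw [abs_lt] at h1
    refine Finset.mem_erase.2 ⟨h0, Finset.mem_Icc.2 ⟨?_, Int.le_floor.2 h1.2.le⟩⟩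
    have : -w ≤ ⌊t⌋ := Int.le_floor.2 (by push_cast; linarith)
    linarith
  have h0 : (0 : ℤ) ≤ ⌊t⌋ := Int.floor_nonneg.2 ht
  have hc := Finset.card_le_card hsub
  rw [Finset.card_erase_of_mem (by simp [h0]), Int.card_Icc] at hc
  have h2 : (s.card : ℤ) ≤ 2 * ⌊t⌋ := by omega
  have h3 : (s.card : ℝ) ≤ 2 * (⌊t⌋ : ℝ) := by exact_mod_cast h2
  linarith [Int.floor_le t]

/-- A finite set of integers of diameter at most `L` has at most `L + 1` elements. -/
lemma card_le_of_abs_sub_le (s : Finset ℤ) (L : ℝ) (hL : 0 ≤ L)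
    (h : ∀ x ∈ s, ∀ y ∈ s, |(x : ℝ) - y| ≤ L) : (s.card : ℝ) ≤ L + 1 := by
  rcases s.eq_empty_or_nonempty with rfl | hs
  · simp; linarith
  have hsub : s ⊆ Finset.Icc (s.min' hs) (s.max' hs) := fun x hx =>
    Finset.mem_Icc.2 ⟨s.min'_le x hx, s.le_max' x hx⟩
  have hc := Finset.card_le_card hsub
  rw [Int.card_Icc] at hc
  have h1 := h _ (s.max'_mem hs) _ (s.min'_mem hs)
  have h2 : s.min' hs ≤ s.max' hs := s.min'_le _ (s.max'_mem hs)
  have h3 : (s.card : ℤ) ≤ s.max' hs + 1 - s.min' hs := by omega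
  have h4 : (s.card : ℝ) ≤ (s.max' hs : ℝ) + 1 - s.min' hs := by exact_mod_cast h3
  linarith [le_abs_self ((s.max' hs : ℝ) - s.min' hs)]

/-- Separated points in a cube are few. -/
lemma card_le_of_separated {α : Type*} {m : ℕ} (s : Finset α) (f : α → Fin m → ℝ)
    (z : Fin m → ℝ) (R η : ℝ) (hR : 0 ≤ R) (hη : 0 < η)
    (hf : ∀ x ∈ s, ∀ i, |f x i - z i| ≤ R)
    (hsep : ∀ x ∈ s, ∀ y ∈ s, x ≠ y → ∃ i, η ≤ |f x i - f y i|) :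
    (s.card : ℝ) ≤ (2 * R / η + 2) ^ m := by
  classical
  let g : α → Fin m → ℤ := fun x i => ⌊(f x i - z i) / η⌋
  have hmem : ∀ x ∈ s, g x ∈ Fintype.piFinset
      (fun _ : Fin m => Finset.Icc ⌊-R / η⌋ ⌊R / η⌋) := by
    intro x hx
    refine Fintype.mem_piFinset.2 fun i => ?_
    have := abs_le.1 (hf x hx i)
    refine Finset.mem_Icc.2 ⟨Int.floor_le_floor ?_, Int.floor_le_floor ?_⟩ <;> gcongr
    · exact this.1
    · exact this.2
  have hinj : Set.InjOn g s := by
    intro x hx y hy hxy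
    by_contra hne
    obtain ⟨i, hi⟩ := hsep x hx y hy hne
    have h1 : ⌊(f x i - z i) / η⌋ = ⌊(f y i - z i) / η⌋ := congrFun hxy i
    have h2 := Int.abs_sub_lt_one_of_floor_eq_floor h1
    rw [← sub_div, sub_sub_sub_cancel_right, abs_div, abs_of_pos hη, div_lt_one hη] at h2
    linarith
  have hc := Finset.card_le_card_of_injOn g hmem hinj
  rw [Fintype.card_piFinset_const, Int.card_Icc] at hc
  have h0 : ⌊-R / η⌋ ≤ ⌊R / η⌋ := Int.floor_le_floor (by gcongr; linarith)
  have h3 : (((⌊R / η⌋ + 1 - ⌊-R / η⌋).toNat : ℕ) : ℝ) ≤ 2 * R / η + 2 := by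
    have : (((⌊R / η⌋ + 1 - ⌊-R / η⌋).toNat : ℕ) : ℝ) =
        (⌊R / η⌋ : ℝ) + 1 - ⌊-R / η⌋ := by
      rw [← Int.cast_natCast, Int.toNat_of_nonneg (by omega)]; push_cast; ring
    rw [this]
    have h4 := Int.floor_le (R / η)
    have h5 := Int.lt_floor_add_one (-R / η)
    have h6 : -R / η = -(R / η) := neg_div _ _
    have h7 : 2 * R / η = 2 * (R / η) := mul_div_assoc _ _ _
    linarith
  calc (s.card : ℝ) ≤ (((⌊R / η⌋ + 1 - ⌊-R / η⌋).toNat ^ m : ℕ) : ℝ) := by exact_mod_cast hc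
    _ ≤ _ := by push_cast; gcongr

/-- For a prime `q` and `0 < k < q`, few `x ∈ (0, q)` are such that `k x / q` is close
to an integer. -/
lemma card_mul_div_near_int (q : ℕ) (hq : q.Prime) (k : ℕ) (hk : 0 < k) (hkq : k < q) (η : ℝ)
    (hη : 0 ≤ η) (s : Finset ℤ)
    (hs : ∀ x ∈ s, 0 < x ∧ x < q ∧ ∃ v : ℤ, |(k : ℝ) * ((x : ℝ) / q) - v| < η) :
    (s.card : ℝ) ≤ 2 * (η * q) := by
  classical
  have hq0 : (0 : ℝ) < q := by exact_mod_cast hq.pos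
  have hqk : ¬ (q : ℤ) ∣ k := by
    intro h
    have := Nat.le_of_dvd hk (Int.natCast_dvd_natCast.1 h)
    omega
  have hqp : Prime (q : ℤ) := Nat.prime_iff_prime_int.1 hq
  choose! v hv using fun x hx => (hs x hx).2.2
  let g : ℤ → ℤ := fun x => k * x - v x * q
  have hinj : Set.InjOn g s := by
    intro x hx y hy hxy
    have h1 : (q : ℤ) ∣ k * (x - y) := ⟨v x - v y, by
      have : (k : ℤ) * x - v x * q = k * y - v y * q := hxy
      linear_combination this⟩
    have h2 : (q : ℤ) ∣ x - y := (hqp.dvd_or_dvd h1).resolve_left hqk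
    have := hs x hx
    have := hs y hy
    have h3 := Int.eq_zero_of_abs_lt_dvd h2 (by rw [abs_lt]; constructor <;> linarith)
    linarith
  rw [← Finset.card_image_of_injOn hinj]
  refine card_nonzero_abs_lt _ _ (by positivity) fun w hw => ?_
  obtain ⟨x, hx, rfl⟩ := Finset.mem_image.1 hw
  obtain ⟨hx0, hxq, -⟩ := hs x hx
  refine ⟨fun h0 => ?_, ?_⟩
  · have h1 : (q : ℤ) ∣ k * x := ⟨v x, by
      have : (k : ℤ) * x - v x * q = 0 := h0
      linear_combination this⟩
    have h2 := Int.le_of_dvd hx0 ((hqp.dvd_or_dvd h1).resolve_left hqk)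
    linarith
  · have h1 : ((g x : ℤ) : ℝ) = ((k : ℝ) * ((x : ℝ) / q) - v x) * q := by
      simp only [g]; push_cast; field_simp
    rw [h1, abs_mul, abs_of_pos hq0]
    exact mul_lt_mul_of_pos_right (hv x hx) hq0

/-- `p / q` has prime denominator, lies in `(0,1)^m`, and is badly approximable (with exponent `β`)
by rationals of smaller denominator. -/
structure IsGood (m : ℕ) (β : ℝ) (q : ℕ) (p : Fin m → ℤ) : Prop where
  prime : q.Prime
  pos : ∀ i, 0 < p i
  lt : ∀ i, p i < q
  far : ∀ k : ℕ, 0 < k → k < q → ∀ v : Fin m → ℤ,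
    ∃ i, (q : ℝ) ^ (-β) ≤ |(k : ℝ) * ((p i : ℝ) / q) - v i|

lemma IsGood.eq_or_far {m : ℕ} {β : ℝ} {q : ℕ} {p : Fin m → ℤ} (h : IsGood m β q p) (hβ : 0 ≤ β)
    (k : ℕ) (v : Fin m → ℤ) :
    (∀ i, v i * q = k * p i) ∨ ∃ i, (q : ℝ) ^ (-β) ≤ |(k : ℝ) * ((p i : ℝ) / q) - v i| := by
  have hq0 : (0 : ℝ) < q := by exact_mod_cast h.prime.pos
  have hq1 : (1 : ℝ) ≤ q := by exact_mod_cast h.prime.one_lt.le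
  obtain ⟨n, s, hs, rfl⟩ : ∃ n s, s < q ∧ k = q * n + s :=
    ⟨k / q, k % q, Nat.mod_lt _ h.prime.pos, (Nat.div_add_mod k q).symm⟩
  have key : ∀ i, ((q * n + s : ℕ) : ℝ) * ((p i : ℝ) / q) - v i =
      (s : ℝ) * ((p i : ℝ) / q) - ((v i - n * p i : ℤ) : ℝ) := by
    intro i; push_cast; field_simp; ring
  simp only [key]
  rcases Nat.eq_zero_or_pos s with rfl | hs0
  · by_cases hv : ∀ i, v i = n * p i
    · left; intro i; rw [hv i]; push_cast; ring
    · right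
      push Not at hv
      obtain ⟨i, hi⟩ := hv
      refine ⟨i, ?_⟩
      have h1 : (1 : ℤ) ≤ |v i - n * p i| := Int.one_le_abs (sub_ne_zero.2 hi)
      have h2 : (1 : ℝ) ≤ |((v i - n * p i : ℤ) : ℝ)| := by exact_mod_cast h1
      have h3 : (q : ℝ) ^ (-β) ≤ 1 := Real.rpow_le_one_of_one_le_of_nonpos hq1 (by linarith)
      simp only [Nat.cast_zero, zero_mul, zero_sub, abs_neg]
      linarith
  · right
    exact h.far s hs0 hs _

lemma IsGood.far_of_ne {m : ℕ} {β : ℝ} {q : ℕ} {p : Fin m → ℤ} (h : IsGood m β q p) (hβ : 0 ≤ β)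
    {k l : ℕ} {v w : Fin m → ℤ} (hkl : k < l + q) (hlk : l < k + q) (hne : (k, v) ≠ (l, w)) :
    ∃ i, (q : ℝ) ^ (-β) ≤ |((k : ℝ) * ((p i : ℝ) / q) - v i) - ((l : ℝ) * ((p i : ℝ) / q) - w i)| := by
  wlog hle : l ≤ k generalizing k l v w
  · obtain ⟨i, hi⟩ := this hlk hkl hne.symm (by omega)
    exact ⟨i, by rwa [abs_sub_comm]⟩
  have hq0 : (0 : ℝ) < q := by exact_mod_cast h.prime.pos
  obtain ⟨s, rfl⟩ := Nat.exists_eq_add_of_le hle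
  have key : ∀ i, (((l + s : ℕ) : ℝ) * ((p i : ℝ) / q) - v i) - ((l : ℝ) * ((p i : ℝ) / q) - w i) =
      (s : ℝ) * ((p i : ℝ) / q) - ((v i - w i : ℤ) : ℝ) := by
    intro i; push_cast; ring
  simp only [key]
  rcases Nat.eq_zero_or_pos s with rfl | hs
  · refine (h.eq_or_far hβ 0 fun i => v i - w i).resolve_left fun h0 => hne ?_
    have : v = w := by
      funext i
      have := h0 i
      have hq : (q : ℤ) ≠ 0 := by exact_mod_cast h.prime.ne_zero
      simp only [Nat.cast_zero, zero_mul, mul_eq_zero, hq, or_false] at this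
      omega
    simp [this]
  · exact h.far s hs (by omega) fun i => v i - w i

lemma IsGood.separated {m : ℕ} {β : ℝ} {q q' : ℕ} {p p' : Fin m → ℤ} (h : IsGood m β q p)
    (h' : IsGood m β q' p') (hβ : 0 ≤ β) {Q : ℝ} (hq : q ≤ Q) (hq' : q' ≤ Q)
    (hne : (q, p) ≠ (q', p')) :
    ∃ i, Q ^ (-(1 + β)) ≤ |(p i : ℝ) / q - (p' i : ℝ) / q'| := by
  wlog hle : q' ≤ q generalizing q q' p p'
  · obtain ⟨i, hi⟩ := this h' h hq' hq hne.symm (by omega)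
    exact ⟨i, by rwa [abs_sub_comm]⟩
  have hq0 : (0 : ℝ) < q := by exact_mod_cast h.prime.pos
  have hq0' : (0 : ℝ) < q' := by exact_mod_cast h'.prime.pos
  have hQ : 0 < Q := by linarith
  have hdich := h.eq_or_far hβ q' p'
  have hfar : ∃ i, (q : ℝ) ^ (-β) ≤ |(q' : ℝ) * ((p i : ℝ) / q) - p' i| := by
    refine hdich.resolve_left fun h0 => ?_
    rcases hle.lt_or_eq with hlt | rfl
    · obtain ⟨i, hi⟩ := h.far q' h'.prime.pos hlt p'
      have h1 : (p' i : ℝ) * q = q' * p i := by exact_mod_cast h0 i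
      have h2 : (q' : ℝ) * ((p i : ℝ) / q) - p' i = 0 := by field_simp; linarith
      rw [h2, abs_zero] at hi
      linarith [Real.rpow_pos_of_pos hq0 (-β)]
    · refine hne ?_
      have : p = p' := by
        funext i
        have := h0 i
        have hq : (q' : ℤ) ≠ 0 := by exact_mod_cast h.prime.ne_zero
        rw [mul_comm] at this
        exact (mul_left_cancel₀ hq this).symm
      rw [this]
  obtain ⟨i, hi⟩ := hfar
  refine ⟨i, ?_⟩
  have h1 : (q' : ℝ) * ((p i : ℝ) / q) - p' i = q' * ((p i : ℝ) / q - (p' i : ℝ) / q') := by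
    field_simp
  rw [h1, abs_mul, abs_of_pos hq0'] at hi
  have h2 : Q ^ (-β) ≤ (q : ℝ) ^ (-β) :=
    Real.rpow_le_rpow_of_nonpos hq0 hq (by linarith)
  have h3 : Q ^ (-(1 + β)) * Q = Q ^ (-β) := by
    rw [← Real.rpow_add_one hQ.ne']; ring_nf
  have h4 := abs_nonneg ((p i : ℝ) / q - (p' i : ℝ) / q')
  have h5 : Q ^ (-(1 + β)) * Q ≤ |(p i : ℝ) / q - (p' i : ℝ) / q'| * Q := by
    nlinarith
  exact le_of_mul_le_mul_right h5 hQ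

/-- Rationals `v / k` close to a good rational `p / q` are not more frequent than expected. -/
lemma exists_sum_near_good_le (m : ℕ) (τ β : ℝ) (hβ : 0 ≤ β) (hβτ : β < τ)
    (hτ : 1 < τ * m) : ∃ C : ℝ, 0 < C ∧ ∀ (q : ℕ) (p : Fin m → ℤ), IsGood m β q p →
      ∀ W : Finset (ℕ × (Fin m → ℤ)), (∀ w ∈ W, (q : ℝ) ^ (1 + τ - β) / 2 ≤ w.1 ∧ q ≤ w.1 ∧
        ∀ i, |(w.1 : ℝ) * ((p i : ℝ) / q) - w.2 i| ≤ 2 * (w.1 * (q : ℝ) ^ (-(1 + τ)))) →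
      ∑ w ∈ W, ((w.1 : ℝ) ^ (-(1 + τ))) ^ m ≤ C * ((q : ℝ) ^ (-(1 + τ)) * (q : ℝ) ^ (β - τ)) ^ m := by
  classical
  have hτ0 : 0 < τ := by linarith
  have hsum : Summable fun j : ℕ => (((j + 1 : ℕ) : ℝ) ^ (-τ)) ^ m := by
    have h1 : Summable fun j : ℕ => ((j : ℝ)) ^ (-τ * m) :=
      Real.summable_nat_rpow.2 (by linarith)
    have h2 := (summable_nat_add_iff 1).2 h1
    refine h2.congr fun j => ?_
    rw [Real.rpow_mul_natCast (by positivity)]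
  refine ⟨(8 * 2 ^ (1 + τ)) ^ m * (1 + ∑' j : ℕ, (((j + 1 : ℕ) : ℝ) ^ (-τ)) ^ m),
    mul_pos (by positivity)
      (add_pos_of_pos_of_nonneg one_pos (tsum_nonneg fun j => by positivity)), ?_⟩
  intro q p hg W hW
  have hq0 : (0 : ℝ) < q := by exact_mod_cast hg.prime.pos
  set X := (q : ℝ) ^ (-(1 + τ)) * (q : ℝ) ^ (β - τ) with hX
  have hX0 : 0 < X := by positivity
  have hblock : ∀ j : ℕ, ∑ w ∈ W with w.1 / q = j, ((w.1 : ℝ) ^ (-(1 + τ))) ^ m ≤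
      (8 * 2 ^ (1 + τ)) ^ m * (((j + 1 : ℕ) : ℝ) ^ (-τ)) ^ m * X ^ m := by
    intro j
    rcases (W.filter fun w => w.1 / q = j).eq_empty_or_nonempty with he | ⟨w0, hw0⟩
    · rw [he, Finset.sum_empty]; positivity
    have hlt : ∀ w ∈ W.filter (fun w => w.1 / q = j), q * j ≤ w.1 ∧ w.1 < q * (j + 1) := by
      intro w hw
      have h1 := (Finset.mem_filter.1 hw).2
      have h2 := Nat.div_add_mod w.1 q
      have h3 := Nat.mod_lt w.1 hg.prime.pos
      rw [h1] at h2
      constructor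
      · omega
      · rw [mul_add, mul_one]; omega
    set J : ℝ := ((j + 1 : ℕ) : ℝ) with hJ
    have hJ0 : 0 < J := by positivity
    have hltR : ∀ w ∈ W.filter (fun w => w.1 / q = j), (w.1 : ℝ) ≤ q * J ∧ q * J / 2 ≤ w.1 := by
      intro w hw
      obtain ⟨h1, h2⟩ := hlt w hw
      have h3 : (w.1 : ℝ) ≤ q * J := by rw [hJ]; exact_mod_cast h2.le
      have h4 : (q : ℝ) * j ≤ w.1 := by exact_mod_cast h1
      have h5 : (q : ℝ) ≤ w.1 := by exact_mod_cast (hW w (Finset.mem_filter.1 hw).1).2.1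
      have h6 : (q : ℝ) * J = q * j + q := by rw [hJ]; push_cast; ring
      exact ⟨h3, by linarith⟩
    have hcard : ((W.filter fun w => w.1 / q = j).card : ℝ) ≤
        (8 * (J * (q : ℝ) ^ (β - τ))) ^ m := by
      have h1 := card_le_of_separated (W.filter fun w => w.1 / q = j)
        (fun w i => (w.1 : ℝ) * ((p i : ℝ) / q) - w.2 i) 0 (2 * (q * J * (q : ℝ) ^ (-(1 + τ))))
        ((q : ℝ) ^ (-β)) (by positivity) (by positivity)
        (fun w hw i => by
          rw [Pi.zero_apply, sub_zero]
          refine ((hW w (Finset.mem_filter.1 hw).1).2.2 i).trans ?_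
          have := (hltR w hw).1
          gcongr)
        (fun x hx y hy hne => by
          have hx' := hlt x hx
          have hy' := hlt y hy
          rw [mul_add, mul_one] at hx' hy'
          exact hg.far_of_ne hβ (by omega) (by omega) hne)
      refine h1.trans ?_
      have h2 : 2 * (2 * (q * J * (q : ℝ) ^ (-(1 + τ)))) / (q : ℝ) ^ (-β) =
          4 * (J * (q : ℝ) ^ (β - τ)) := by
        have e1 : (q : ℝ) * (q : ℝ) ^ (-(1 + τ)) = (q : ℝ) ^ (-τ) := by
          rw [mul_comm, ← Real.rpow_add_one hq0.ne']; ring_nf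
        have e2 : (q : ℝ) ^ (-τ) / (q : ℝ) ^ (-β) = (q : ℝ) ^ (β - τ) := by
          rw [← Real.rpow_sub hq0]; ring_nf
        rw [← e2, ← e1]; ring
      rw [h2]
      have h3 : 1 / 2 ≤ J * (q : ℝ) ^ (β - τ) := by
        have a1 := (hW w0 (Finset.mem_filter.1 hw0).1).1
        have a2 := (hltR w0 hw0).1
        have e3 : (q : ℝ) ^ (1 + τ - β) * (q : ℝ) ^ (β - τ) = q := by
          rw [← Real.rpow_add hq0]
          ring_nf; simp
        have a3 : (q : ℝ) ^ (1 + τ - β) / 2 * (q : ℝ) ^ (β - τ) ≤ q * J * (q : ℝ) ^ (β - τ) := by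
          gcongr; linarith
        have a4 : (q : ℝ) * (1 / 2) ≤ q * (J * (q : ℝ) ^ (β - τ)) := by linarith
        exact le_of_mul_le_mul_left a4 hq0
      gcongr
      linarith
    have hterm : ∀ w ∈ W.filter (fun w => w.1 / q = j), ((w.1 : ℝ) ^ (-(1 + τ))) ^ m ≤
        (2 ^ (1 + τ) * J ^ (-(1 + τ)) * (q : ℝ) ^ (-(1 + τ))) ^ m := by
      intro w hw
      have h1 := (hltR w hw).2
      have h2 : (w.1 : ℝ) ^ (-(1 + τ)) ≤ (q * J / 2) ^ (-(1 + τ)) :=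
        Real.rpow_le_rpow_of_nonpos (by positivity) h1 (by linarith)
      have h3 : ((q : ℝ) * J / 2) ^ (-(1 + τ)) =
          2 ^ (1 + τ) * J ^ (-(1 + τ)) * (q : ℝ) ^ (-(1 + τ)) := by
        rw [Real.div_rpow (by positivity) (by norm_num), Real.mul_rpow hq0.le hJ0.le,
          Real.rpow_neg (by norm_num : (0 : ℝ) ≤ 2), div_inv_eq_mul]
        ring
      rw [← h3]
      gcongr
    calc _ ≤ ∑ w ∈ W with w.1 / q = j,
          (2 ^ (1 + τ) * J ^ (-(1 + τ)) * (q : ℝ) ^ (-(1 + τ))) ^ m := Finset.sum_le_sum hterm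
      _ = ((W.filter fun w => w.1 / q = j).card : ℝ) *
          (2 ^ (1 + τ) * J ^ (-(1 + τ)) * (q : ℝ) ^ (-(1 + τ))) ^ m := by
        rw [Finset.sum_const, nsmul_eq_mul]
      _ ≤ (8 * (J * (q : ℝ) ^ (β - τ))) ^ m *
          (2 ^ (1 + τ) * J ^ (-(1 + τ)) * (q : ℝ) ^ (-(1 + τ))) ^ m := by gcongr
      _ = (8 * 2 ^ (1 + τ)) ^ m * (J ^ (-τ)) ^ m * X ^ m := by
        have e1 : J ^ (-τ) = J ^ (-(1 + τ)) * J := by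
          rw [← Real.rpow_add_one hJ0.ne']; ring_nf
        rw [hX, e1, ← mul_pow, ← mul_pow, ← mul_pow]
        ring
  calc _ = ∑ j ∈ W.image (fun w => w.1 / q), ∑ w ∈ W with w.1 / q = j,
        ((w.1 : ℝ) ^ (-(1 + τ))) ^ m :=
        (Finset.sum_fiberwise_of_maps_to (fun w hw => Finset.mem_image_of_mem _ hw) _).symm
    _ ≤ ∑ j ∈ W.image (fun w => w.1 / q),
        (8 * 2 ^ (1 + τ)) ^ m * (((j + 1 : ℕ) : ℝ) ^ (-τ)) ^ m * X ^ m :=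
        Finset.sum_le_sum fun j _ => hblock j
    _ = (8 * 2 ^ (1 + τ)) ^ m * (∑ j ∈ W.image (fun w => w.1 / q),
        (((j + 1 : ℕ) : ℝ) ^ (-τ)) ^ m) * X ^ m := by
        rw [Finset.mul_sum, Finset.sum_mul]
    _ ≤ _ := by
        gcongr
        have := hsum.sum_le_tsum (W.image (fun w => w.1 / q)) (fun j _ => by positivity)
        linarith

/-- `p' / q'` lies in the shell of relative width `q ^ (-γ)` around `p / q`, and stays far from
rationals whose denominators lie between `q ^ (1 + τ - β) / 2` and `q'`. -/
structure IsChild (m : ℕ) (τ β γ : ℝ) (q : ℕ) (p : Fin m → ℤ) (q' : ℕ) (p' : Fin m → ℤ) :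
    Prop where
  good : IsGood m β q' p'
  left : ∀ i, (p i : ℝ) / q + (1 - (q : ℝ) ^ (-γ)) * (q : ℝ) ^ (-(1 + τ)) ≤ (p' i : ℝ) / q'
  right : ∀ i, (p' i : ℝ) / q' + (q' : ℝ) ^ (-(1 + τ)) < (p i : ℝ) / q + (q : ℝ) ^ (-(1 + τ))
  far : ∀ k : ℕ, (q : ℝ) ^ (1 + τ - β) / 2 ≤ k → k < q' → ∀ v : Fin m → ℤ,
    ∃ i, 2 * (k : ℝ) ^ (-τ) ≤ |(k : ℝ) * ((p' i : ℝ) / q') - v i|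

open Classical in
lemma card_near_int_vector (m q : ℕ) (hq : q.Prime) (k : ℕ) (hk : 0 < k) (hkq : k < q) (η : ℝ)
    (hη : 0 ≤ η) (I : Fin m → Finset ℤ) (hI : ∀ i, ∀ x ∈ I i, 0 < x ∧ x < q) :
    (((Fintype.piFinset I).filter fun p => ∃ v : Fin m → ℤ,
      ∀ i, |(k : ℝ) * ((p i : ℝ) / q) - v i| < η).card : ℝ) ≤ (2 * (η * q)) ^ m := by
  have hsub : ((Fintype.piFinset I).filter fun p => ∃ v : Fin m → ℤ,
      ∀ i, |(k : ℝ) * ((p i : ℝ) / q) - v i| < η) ⊆ Fintype.piFinset fun i =>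
        (I i).filter fun x => ∃ v : ℤ, |(k : ℝ) * ((x : ℝ) / q) - v| < η := by
    intro p hp
    obtain ⟨h1, v, hv⟩ := Finset.mem_filter.1 hp
    exact Fintype.mem_piFinset.2 fun i =>
      Finset.mem_filter.2 ⟨Fintype.mem_piFinset.1 h1 i, v i, hv i⟩
  have h1 := Finset.card_le_card hsub
  rw [Fintype.card_piFinset] at h1
  calc _ ≤ ∏ i : Fin m, (((I i).filter fun x : ℤ => ∃ v : ℤ,
        |(k : ℝ) * ((x : ℝ) / q) - v| < η).card : ℝ) := by exact_mod_cast h1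
    _ ≤ ∏ _i : Fin m, 2 * (η * q) := by
        refine Finset.prod_le_prod (fun i _ => by positivity) fun i _ => ?_
        refine card_mul_div_near_int q hq k hk hkq η hη _ fun x hx => ?_
        obtain ⟨h2, h3⟩ := Finset.mem_filter.1 hx
        exact ⟨(hI i x h2).1, (hI i x h2).2, h3⟩
    _ = _ := by simp

/-- A finite set of integer vectors of diameter at most `L` has at most `(L + 1) ^ m` elements. -/
lemma card_le_of_forall_abs_sub_le (m : ℕ) (s : Finset (Fin m → ℤ)) (L : ℝ) (hL : 0 ≤ L)
    (h : ∀ x ∈ s, ∀ y ∈ s, ∀ i, |(x i : ℝ) - y i| ≤ L) : (s.card : ℝ) ≤ (L + 1) ^ m := by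
  classical
  have hsub : s ⊆ Fintype.piFinset fun i => s.image fun x => x i := fun x hx =>
    Fintype.mem_piFinset.2 fun i => Finset.mem_image_of_mem _ hx
  have h1 := Finset.card_le_card hsub
  rw [Fintype.card_piFinset] at h1
  calc (s.card : ℝ) ≤ ∏ i : Fin m, ((s.image fun x => x i).card : ℝ) := by exact_mod_cast h1
    _ ≤ ∏ _i : Fin m, (L + 1) := by
        refine Finset.prod_le_prod (fun i _ => by positivity) fun i _ => ?_
        refine card_le_of_abs_sub_le _ L hL fun a ha b hb => ?_
        obtain ⟨x, hx, rfl⟩ := Finset.mem_image.1 ha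
        obtain ⟨y, hy, rfl⟩ := Finset.mem_image.1 hb
        exact h x hx y hy i
    _ = _ := by simp

lemma le_card_box (m : ℕ) (A B : Fin m → ℝ) (L : ℝ) (hL : 2 ≤ L) (h : ∀ i, L ≤ B i - A i) :
    (L / 2) ^ m ≤ ((Fintype.piFinset fun i => Finset.Icc ⌈A i⌉ ⌊B i⌋).card : ℝ) := by
  rw [Fintype.card_piFinset]
  push_cast
  calc (L / 2) ^ m = ∏ _i : Fin m, L / 2 := by simp [div_pow]
    _ ≤ _ := by
        refine Finset.prod_le_prod (fun i _ => by linarith) fun i _ => ?_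
        rw [Int.card_Icc]
        have h1 : ((⌊B i⌋ + 1 - ⌈A i⌉ : ℤ) : ℝ) ≤ ((⌊B i⌋ + 1 - ⌈A i⌉).toNat : ℝ) := by
          exact_mod_cast Int.self_le_toNat _
        push_cast at h1
        linarith [Int.lt_floor_add_one (B i), Int.ceil_lt_add_one (A i), h i]

lemma exists_tail_sum_le (f : ℕ → ℝ) (hf : ∀ n, 0 ≤ f n) (hs : Summable f) (e : ℝ) (he : 0 < e) :
    ∃ K : ℕ, 0 < K ∧ ∀ n, ∑ k ∈ Finset.Ico K n, f k ≤ e := by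
  have h1 := (tendsto_sum_nat_add f).eventually (gt_mem_nhds he)
  obtain ⟨K, hK, hK0⟩ := (h1.and (Filter.eventually_gt_atTop 0)).exists
  refine ⟨K, hK0, fun n => ?_⟩
  rw [Finset.sum_Ico_eq_sum_range]
  have h2 := ((summable_nat_add_iff K).2 hs).sum_le_tsum (Finset.range (n - K))
    (fun j _ => hf (j + K))
  simp only [add_comm K]
  linarith

lemma tendsto_natCast_rpow_pow_zero (m : ℕ) (hm : 1 ≤ m) (a : ℝ) (ha : a < 0) :
    Filter.Tendsto (fun q : ℕ => ((q : ℝ) ^ a) ^ m) Filter.atTop (nhds 0) := by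
  have h1 := (tendsto_rpow_neg_atTop (y := -a) (by linarith)).comp
    (tendsto_natCast_atTop_atTop (R := ℝ))
  have h2 := h1.pow m
  simp only [neg_neg, Function.comp_def] at h2
  rwa [zero_pow (by omega)] at h2

lemma eventually_card_bad_small (m : ℕ) (β e : ℝ) (hβ : 1 < β * m) (he : 0 < e) :
    ∀ᶠ q : ℕ in Filter.atTop, (q : ℝ) * (2 * ((q : ℝ) ^ (-β) * q)) ^ m ≤ e * (q : ℝ) ^ m := by
  have h1 := (tendsto_rpow_neg_atTop (y := β * m - 1) (by linarith)).comp
    (tendsto_natCast_atTop_atTop (R := ℝ))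
  have h2 := (h1.const_mul ((2 : ℝ) ^ m)).eventually (gt_mem_nhds (by simpa using he))
  filter_upwards [h2, Filter.eventually_gt_atTop 0] with q hq hq0
  have hq0 : (0 : ℝ) < q := by exact_mod_cast hq0
  have e1 : (q : ℝ) ^ (-(β * m - 1)) = q * ((q : ℝ) ^ (-β)) ^ m := by
    rw [← Real.rpow_mul_natCast hq0.le, mul_comm (q : ℝ), ← Real.rpow_add_one hq0.ne']
    ring_nf
  simp only [Function.comp_def, e1] at hq
  calc _ = ((2 : ℝ) ^ m * (q * ((q : ℝ) ^ (-β)) ^ m)) * (q : ℝ) ^ m := by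
        rw [mul_pow, mul_pow]; ring
    _ ≤ _ := by gcongr

set_option maxHeartbeats 1000000 in
open Classical in
lemma exists_children_of_bounds (m : ℕ) (hm : 1 ≤ m) (τ β γ : ℝ) (hτ : 0 < τ)
    (hγ : 0 < γ) (q : ℕ) (p : Fin m → ℤ) (hg : IsGood m β q p)
    (S ℓ e : ℝ) (hℓ : ℓ = (q : ℝ) ^ (-(1 + τ)) * (q : ℝ) ^ (-γ) / 2) (he : e = (ℓ / 2) ^ m / 6)
    (hS : ∀ W : Finset (ℕ × (Fin m → ℤ)), (∀ w ∈ W, (q : ℝ) ^ (1 + τ - β) / 2 ≤ w.1 ∧ q ≤ w.1 ∧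
        ∀ i, |(w.1 : ℝ) * ((p i : ℝ) / q) - w.2 i| ≤ 2 * (w.1 * (q : ℝ) ^ (-(1 + τ)))) →
      ∑ w ∈ W, ((w.1 : ℝ) ^ (-(1 + τ))) ^ m ≤ S)
    (hq2 : 2 * (q : ℝ) ≤ (q : ℝ) ^ (1 + τ - β) / 2) (hSe : 5 ^ m * S ≤ e)
    (K : ℕ) (hK0 : 0 < K) (hK : ∀ n, ∑ k ∈ Finset.Ico K n, (4 * (k : ℝ) ^ (-τ)) ^ m ≤ e)
    (q' : ℕ) (hq' : q'.Prime) (h1 : 2 ≤ ℓ * q') (h2 : (q' : ℝ) ^ (-(1 + τ)) < ℓ)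
    (h3 : (K : ℝ) ^ (1 + τ) ≤ q')
    (h4 : (q' : ℝ) * (2 * ((q' : ℝ) ^ (-β) * q')) ^ m ≤ e * (q' : ℝ) ^ m) :
    ∃ s : Finset (Fin m → ℤ), (∀ p' ∈ s, IsChild m τ β γ q p q' p') ∧
      (ℓ * q' / 4) ^ m ≤ s.card := by
  have hq0 : (0 : ℝ) < q := by exact_mod_cast hg.prime.pos
  have hq1 : (1 : ℝ) ≤ q := by exact_mod_cast hg.prime.one_lt.le
  have hq0' : (0 : ℝ) < q' := by exact_mod_cast hq'.pos
  set h : ℝ := (q : ℝ) ^ (-(1 + τ)) with hh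
  set ε : ℝ := (q : ℝ) ^ (-γ) with hε
  have hh0 : 0 < h := by positivity
  have hε0 : 0 < ε := by positivity
  have hε1 : ε ≤ 1 := Real.rpow_le_one_of_one_le_of_nonpos hq1 (by linarith)
  have hhq : h ≤ 1 / q := by
    rw [hh, one_div, ← Real.rpow_neg_one]
    exact Real.rpow_le_rpow_of_exponent_le hq1 (by linarith)
  have hℓ0 : 0 < ℓ := by rw [hℓ]; positivity
  have he0 : 0 < e := by rw [he]; positivity
  let A : Fin m → ℝ := fun i => (p i : ℝ) / q + (1 - ε) * h
  let B : Fin m → ℝ := fun i => A i + ℓ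
  have hBle : ∀ i, B i ≤ (p i : ℝ) / q + h - ℓ := by
    intro i
    have : (1 - ε) * h + ℓ = h - ℓ := by rw [hℓ]; ring
    simp only [B, A]; linarith
  let I : Fin m → Finset ℤ := fun i => Finset.Icc ⌈q' * A i⌉ ⌊q' * B i⌋
  have hI : ∀ i, ∀ x ∈ I i, A i ≤ (x : ℝ) / q' ∧ (x : ℝ) / q' ≤ B i := by
    intro i x hx
    obtain ⟨hx1, hx2⟩ := Finset.mem_Icc.1 hx
    rw [Int.ceil_le] at hx1
    rw [Int.le_floor] at hx2
    rw [le_div_iff₀ hq0', div_le_iff₀ hq0']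
    constructor <;> linarith
  have hp0 : ∀ i, 0 < (p i : ℝ) / q := fun i => by
    have : (0 : ℝ) < p i := by exact_mod_cast hg.pos i
    positivity
  have hI0 : ∀ i, ∀ x ∈ I i, 0 < x ∧ x < q' := by
    intro i x hx
    obtain ⟨hx1, hx2⟩ := hI i x hx
    constructor
    · have a1 : 0 < (x : ℝ) / q' := by
        have a2 : 0 ≤ (1 - ε) * h := mul_nonneg (by linarith) hh0.le
        have := hp0 i
        simp only [A] at hx1
        linarith
      have : 0 < (x : ℝ) := by
        have := mul_pos a1 hq0'
        rwa [div_mul_cancel₀ _ hq0'.ne'] at this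
      exact_mod_cast this
    · have a1 : (p i : ℝ) / q + 1 / q ≤ 1 := by
        rw [← add_div, div_le_one hq0]
        exact_mod_cast hg.lt i
      have a2 : (x : ℝ) / q' < 1 := by linarith [hBle i]
      rw [div_lt_one hq0'] at a2
      exact_mod_cast a2
  let Bx := Fintype.piFinset I
  have hBx : (ℓ * q' / 2) ^ m ≤ (Bx.card : ℝ) :=
    le_card_box m (fun i => q' * A i) (fun i => q' * B i) (ℓ * q') h1
      (fun i => le_of_eq (by simp only [B]; ring))
  let N : ℕ → ℝ → Finset (Fin m → ℤ) := fun k η => Bx.filter fun p' => ∃ v : Fin m → ℤ,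
      ∀ i, |(k : ℝ) * ((p' i : ℝ) / q') - v i| < η
  let M : ℕ × (Fin m → ℤ) → Finset (Fin m → ℤ) := fun w => Bx.filter fun p' =>
      ∀ i, |(w.1 : ℝ) * ((p' i : ℝ) / q') - w.2 i| < 2 * (w.1 : ℝ) ^ (-τ)
  let W : Finset (ℕ × (Fin m → ℤ)) :=
    (Finset.range K ×ˢ Fintype.piFinset fun _ => Finset.Icc (-(3 * K : ℤ)) (3 * K)).filter
    fun w => (q : ℝ) ^ (1 + τ - β) / 2 ≤ w.1 ∧ q ≤ w.1 ∧
        ∀ i, |(w.1 : ℝ) * ((p i : ℝ) / q) - w.2 i| ≤ 2 * (w.1 * h)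
  let s := Bx.filter fun p' => IsChild m τ β γ q p q' p'
  let U1 := (Finset.Ioo 0 q').biUnion fun k => N k ((q' : ℝ) ^ (-β))
  let U2 := (Finset.Ico K q').biUnion fun k => N k (2 * (k : ℝ) ^ (-τ))
  let U3 := W.biUnion M
  have hcover : Bx ⊆ s ∪ (U1 ∪ (U2 ∪ U3)) := by
    intro p' hp'
    by_contra hnot
    simp only [Finset.mem_union, not_or] at hnot
    obtain ⟨n0, n1, n2, n3⟩ := hnot
    have hp'I := Fintype.mem_piFinset.1 hp'
    refine n0 (Finset.mem_filter.2 ⟨hp', ⟨⟨hq', fun i => (hI0 i _ (hp'I i)).1,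
      fun i => (hI0 i _ (hp'I i)).2, ?_⟩, fun i => (hI i _ (hp'I i)).1, fun i => ?_, ?_⟩⟩)
    · intro k hk hkq v
      by_contra hcon
      push Not at hcon
      exact n1 (Finset.mem_biUnion.2 ⟨k, Finset.mem_Ioo.2 ⟨hk, hkq⟩,
        Finset.mem_filter.2 ⟨hp', v, hcon⟩⟩)
    · have := (hI i _ (hp'I i)).2
      linarith [hBle i]
    · intro k hk hkq v
      by_contra hcon
      push Not at hcon
      rcases le_or_gt K k with hKk | hKk
      · exact n2 (Finset.mem_biUnion.2 ⟨k, Finset.mem_Ico.2 ⟨hKk, hkq⟩,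
          Finset.mem_filter.2 ⟨hp', v, hcon⟩⟩)
      · have hkq2 : 2 * (q : ℝ) ≤ k := hq2.trans hk
        have hk0 : (0 : ℝ) < k := by linarith
        have hkh : 2 * (k : ℝ) ^ (-τ) ≤ k * h := by
          have a1 : (k : ℝ) ^ (-(1 + τ)) ≤ (2 * (q : ℝ)) ^ (-(1 + τ)) :=
            Real.rpow_le_rpow_of_nonpos (by positivity) hkq2 (by linarith)
          rw [Real.mul_rpow (by norm_num) hq0.le] at a1
          have a2 : (2 : ℝ) ^ (-(1 + τ)) ≤ 2 ^ (-1 : ℝ) :=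
            Real.rpow_le_rpow_of_exponent_le (by norm_num) (by linarith)
          rw [Real.rpow_neg_one] at a2
          have a3 : (k : ℝ) ^ (-τ) = k * (k : ℝ) ^ (-(1 + τ)) := by
            rw [mul_comm, ← Real.rpow_add_one hk0.ne']; ring_nf
          have a4 : (k : ℝ) ^ (-(1 + τ)) ≤ 2⁻¹ * h := a1.trans (by gcongr)
          rw [a3]
          have := mul_le_mul_of_nonneg_left a4 hk0.le
          linarith
        have hclose : ∀ i, |(k : ℝ) * ((p i : ℝ) / q) - v i| ≤ 2 * (k * h) := by
          intro i
          have a1 := hcon i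
          have a2 := hI i _ (hp'I i)
          have a3 := hBle i
          have a4 : 0 ≤ (1 - ε) * h := mul_nonneg (by linarith) hh0.le
          have a5 : (k : ℝ) * ((p i : ℝ) / q) ≤ k * ((p' i : ℝ) / q') := by
            have a2' := a2.1
            simp only [A] at a2'
            exact mul_le_mul_of_nonneg_left (by linarith) hk0.le
          have a6 : (k : ℝ) * ((p' i : ℝ) / q') ≤ k * ((p i : ℝ) / q + h) :=
            mul_le_mul_of_nonneg_left (by linarith [a2.2]) hk0.le
          rw [mul_add] at a6
          rw [abs_lt] at a1
          rw [abs_le]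
          constructor <;> linarith [a1.1, a1.2]
        refine n3 (Finset.mem_biUnion.2 ⟨(k, v), Finset.mem_filter.2
          ⟨Finset.mem_product.2 ⟨Finset.mem_range.2 hKk, Fintype.mem_piFinset.2 fun i => ?_⟩, hk,
          ?_, hclose⟩, Finset.mem_filter.2 ⟨hp', hcon⟩⟩)
        · have a1 := abs_le.1 (hclose i)
          have a2 : (k : ℝ) ≤ K := by exact_mod_cast hKk.le
          have a3 : (k : ℝ) * h ≤ k := by
            have : h ≤ 1 := hhq.trans (by rw [div_le_one hq0]; exact hq1)
            exact mul_le_of_le_one_right hk0.le this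
          have a4 : (p i : ℝ) / q ≤ 1 := by
            rw [div_le_one hq0]; exact_mod_cast (hg.lt i).le
          have a5 : (k : ℝ) * ((p i : ℝ) / q) ≤ k := mul_le_of_le_one_right hk0.le a4
          have a6 : 0 ≤ (k : ℝ) * ((p i : ℝ) / q) := mul_nonneg hk0.le (hp0 i).le
          have a7 : (-(3 * K) : ℝ) ≤ v i := by linarith [a1.2]
          have a8 : (v i : ℝ) ≤ 3 * K := by linarith [a1.1]
          exact Finset.mem_Icc.2 ⟨by exact_mod_cast a7, by exact_mod_cast a8⟩
        · have : (q : ℝ) ≤ k := by linarith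
          exact_mod_cast this
  have hU1 : (U1.card : ℝ) ≤ e * (q' : ℝ) ^ m := by
    refine le_trans ?_ h4
    have a1 : (U1.card : ℝ) ≤ ∑ k ∈ Finset.Ioo 0 q', ((N k ((q' : ℝ) ^ (-β))).card : ℝ) := by
      exact_mod_cast Finset.card_biUnion_le
    refine a1.trans ?_
    calc _ ≤ ∑ k ∈ Finset.Ioo 0 q', (2 * ((q' : ℝ) ^ (-β) * q')) ^ m := by
          refine Finset.sum_le_sum fun k hk => ?_
          obtain ⟨b1, b2⟩ := Finset.mem_Ioo.1 hk
          exact card_near_int_vector m q' hq' k b1 b2 _ (by positivity) I hI0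
      _ ≤ _ := by
          rw [Finset.sum_const, nsmul_eq_mul, Nat.card_Ioo]
          gcongr
          omega
  have hU2 : (U2.card : ℝ) ≤ e * (q' : ℝ) ^ m := by
    have a1 : (U2.card : ℝ) ≤ ∑ k ∈ Finset.Ico K q', ((N k (2 * (k : ℝ) ^ (-τ))).card : ℝ) := by
      exact_mod_cast Finset.card_biUnion_le
    refine a1.trans ?_
    calc _ ≤ ∑ k ∈ Finset.Ico K q', (4 * (k : ℝ) ^ (-τ)) ^ m * (q' : ℝ) ^ m := by
          refine Finset.sum_le_sum fun k hk => ?_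
          obtain ⟨b1, b2⟩ := Finset.mem_Ico.1 hk
          refine (card_near_int_vector m q' hq' k (by omega) b2 _ (by positivity) I hI0).trans ?_
          rw [← mul_pow]
          apply le_of_eq
          ring
      _ ≤ _ := by
          rw [← Finset.sum_mul]
          gcongr
          exact hK q'
  have hU3 : (U3.card : ℝ) ≤ e * (q' : ℝ) ^ m := by
    have a1 : (U3.card : ℝ) ≤ ∑ w ∈ W, ((M w).card : ℝ) := by
      exact_mod_cast Finset.card_biUnion_le
    refine a1.trans ?_
    calc _ ≤ ∑ w ∈ W, 5 ^ m * ((w.1 : ℝ) ^ (-(1 + τ))) ^ m * (q' : ℝ) ^ m := by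
          refine Finset.sum_le_sum fun w hw => ?_
          obtain ⟨b0, b1, b2, b3⟩ := Finset.mem_filter.1 hw
          have hwK : w.1 < K := Finset.mem_range.1 (Finset.mem_product.1 b0).1
          have hk0 : (0 : ℝ) < w.1 := lt_of_lt_of_le hq0 (by exact_mod_cast b2)
          have c0 : (0 : ℝ) < (w.1 : ℝ) ^ (-(1 + τ)) * q' := by positivity
          refine (card_le_of_forall_abs_sub_le m (M w) (4 * ((w.1 : ℝ) ^ (-(1 + τ)) * q'))
            (by positivity) fun x hx y hy i => ?_).trans ?_
          · have d1 := abs_lt.1 ((Finset.mem_filter.1 hx).2 i)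
            have d2 := abs_lt.1 ((Finset.mem_filter.1 hy).2 i)
            have d3 : (w.1 : ℝ) ^ (-τ) = w.1 * (w.1 : ℝ) ^ (-(1 + τ)) := by
              rw [mul_comm, ← Real.rpow_add_one hk0.ne']; ring_nf
            have d4 : ((x i : ℝ) - y i) * (w.1 / q') =
                w.1 * ((x i : ℝ) / q') - w.1 * ((y i : ℝ) / q') := by ring
            have d5 : |((x i : ℝ) - y i) * (w.1 / q')| ≤
                4 * ((w.1 : ℝ) ^ (-(1 + τ)) * q') * (w.1 / q') := by
              have : 4 * ((w.1 : ℝ) ^ (-(1 + τ)) * q') * (w.1 / q') = 4 * (w.1 : ℝ) ^ (-τ) := by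
                rw [d3]; field_simp
              rw [this, d4, abs_le]
              constructor <;> linarith
            rw [abs_mul, abs_of_pos (div_pos hk0 hq0')] at d5
            exact le_of_mul_le_mul_right d5 (div_pos hk0 hq0')
          · rw [← mul_pow, ← mul_pow]
            have d1 : 1 ≤ (w.1 : ℝ) ^ (-(1 + τ)) * q' := by
              have d2 : (w.1 : ℝ) ^ (1 + τ) ≤ q' := by
                refine le_trans ?_ h3
                have : (w.1 : ℝ) ≤ K := by exact_mod_cast hwK.le
                gcongr
              rw [Real.rpow_neg hk0.le, ← div_eq_inv_mul, one_le_div (by positivity)]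
              exact d2
            gcongr
            linarith
      _ = 5 ^ m * (∑ w ∈ W, ((w.1 : ℝ) ^ (-(1 + τ))) ^ m) * (q' : ℝ) ^ m := by
          rw [Finset.mul_sum, Finset.sum_mul]
      _ ≤ 5 ^ m * S * (q' : ℝ) ^ m := by
          gcongr
          exact hS W fun w hw => (Finset.mem_filter.1 hw).2
      _ ≤ _ := by gcongr
  refine ⟨s, fun p' hp' => (Finset.mem_filter.1 hp').2, ?_⟩
  have hc : (Bx.card : ℝ) ≤ s.card + (U1.card + (U2.card + U3.card)) := by
    have b1 := Finset.card_le_card hcover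
    have b2 := Finset.card_union_le s (U1 ∪ (U2 ∪ U3))
    have b3 := Finset.card_union_le U1 (U2 ∪ U3)
    have b4 := Finset.card_union_le U2 U3
    exact_mod_cast (by omega : Bx.card ≤ s.card + (U1.card + (U2.card + U3.card)))
  have e1 : 3 * (e * (q' : ℝ) ^ m) = (ℓ * q' / 2) ^ m / 2 := by
    rw [he, show ℓ * q' / 2 = ℓ / 2 * q' by ring, mul_pow (ℓ / 2)]; ring
  have e2 : (ℓ * q' / 4) ^ m ≤ (ℓ * q' / 2) ^ m / 2 := by
    rw [show ℓ * q' / 4 = ℓ * q' / 2 * (1 / 2) by ring, mul_pow (ℓ * q' / 2)]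
    have : (1 / 2 : ℝ) ^ m ≤ 1 / 2 := pow_le_of_le_one (by norm_num) (by norm_num) (by omega)
    calc _ ≤ (ℓ * q' / 2) ^ m * (1 / 2) := by gcongr
      _ = _ := by ring
  linarith

/-- Every good rational with large denominator has many children of any large prime denominator. -/
lemma exists_children (m : ℕ) (hm : 1 ≤ m) (τ β γ : ℝ) (hβ : 1 < β * m) (hγ : 0 < γ)
    (hβγ : β + γ < τ) : ∀ᶠ q : ℕ in Filter.atTop, ∀ p : Fin m → ℤ, IsGood m β q p →
      ∀ᶠ q' : ℕ in Filter.atTop, q'.Prime →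
      ∃ s : Finset (Fin m → ℤ), (∀ p' ∈ s, IsChild m τ β γ q p q' p') ∧
        ((q : ℝ) ^ (-(1 + τ + γ)) * q' / 8) ^ m ≤ s.card := by
  have hm0 : (0 : ℝ) < m := by exact_mod_cast hm
  have hβ0 : 0 < β := by
    by_contra h
    nlinarith
  have hτm : 1 < τ * m := by nlinarith
  have hτ0 : 0 < τ := by linarith
  obtain ⟨C, hC0, hC⟩ := exists_sum_near_good_le m τ β hβ0.le (by linarith) hτm
  have t1 := (tendsto_natCast_rpow_pow_zero m hm (β - τ + γ) (by linarith)).const_mul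
    (6 * 20 ^ m * C)
  rw [mul_zero] at t1
  replace t1 := t1.eventually (gt_mem_nhds one_pos)
  have t2 := ((tendsto_rpow_atTop (y := τ - β) (by linarith)).comp
    (tendsto_natCast_atTop_atTop (R := ℝ))).eventually_ge_atTop 4
  filter_upwards [t1, t2, Filter.eventually_gt_atTop 0] with q hq1 hq2 hq0 p hg
  have hq0 : (0 : ℝ) < q := by exact_mod_cast hq0
  set ℓ : ℝ := (q : ℝ) ^ (-(1 + τ)) * (q : ℝ) ^ (-γ) / 2 with hℓ
  have hℓ0 : 0 < ℓ := by positivity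
  set e : ℝ := (ℓ / 2) ^ m / 6 with he
  have he0 : 0 < e := by positivity
  have hsum : Summable fun k : ℕ => (4 * (k : ℝ) ^ (-τ)) ^ m := by
    have := (Real.summable_nat_rpow (p := -τ * m)).2 (by linarith)
    refine (this.mul_left ((4 : ℝ) ^ m)).congr fun k => ?_
    rw [mul_pow, Real.rpow_mul_natCast (by positivity)]
  obtain ⟨K, hK0, hK⟩ := exists_tail_sum_le _ (fun k => by positivity) hsum e he0
  have u1 := ((tendsto_natCast_atTop_atTop (R := ℝ)).const_mul_atTop hℓ0).eventually_ge_atTop 2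
  have u2 := ((tendsto_rpow_neg_atTop (y := 1 + τ) (by linarith)).comp
    (tendsto_natCast_atTop_atTop (R := ℝ))).eventually (gt_mem_nhds hℓ0)
  have u3 := (tendsto_natCast_atTop_atTop (R := ℝ)).eventually_ge_atTop ((K : ℝ) ^ (1 + τ))
  have u4 := eventually_card_bad_small m β e hβ he0
  filter_upwards [u1, u2, u3, u4] with q' v1 v2 v3 v4 hq'
  suffices hq : 2 * (q : ℝ) ≤ (q : ℝ) ^ (1 + τ - β) / 2 ∧
      5 ^ m * (C * ((q : ℝ) ^ (-(1 + τ)) * (q : ℝ) ^ (β - τ)) ^ m) ≤ e by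
    obtain ⟨s, hs, hcard⟩ := exists_children_of_bounds m hm τ β γ hτ0 hγ q p hg _ ℓ e hℓ he
      (hC q p hg) hq.1 hq.2 K hK0 hK q' hq' v1 v2 v3 v4
    refine ⟨s, hs, le_of_eq_of_le ?_ hcard⟩
    rw [hℓ, ← Real.rpow_add hq0]
    ring_nf
  constructor
  · have : (q : ℝ) ^ (1 + τ - β) = q * (q : ℝ) ^ (τ - β) := by
      rw [mul_comm, ← Real.rpow_add_one hq0.ne']; ring_nf
    rw [this]
    simp only [Function.comp_def] at hq2
    nlinarith
  · have e1 : (q : ℝ) ^ (β - τ) = (q : ℝ) ^ (β - τ + γ) * (q : ℝ) ^ (-γ) := by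
      rw [← Real.rpow_add hq0]; ring_nf
    set Y := (q : ℝ) ^ (-(1 + τ)) * (q : ℝ) ^ (-γ) with hY
    have e2 : (q : ℝ) ^ (-(1 + τ)) * (q : ℝ) ^ (β - τ) = (q : ℝ) ^ (β - τ + γ) * Y := by
      rw [e1, hY]; ring
    have e3 : e = (1 / 4) ^ m * Y ^ m / 6 := by
      rw [he, hℓ, ← mul_pow]; ring
    rw [e2, e3, mul_pow]
    have e4 : (5 : ℝ) ^ m = (1 / 4) ^ m * 20 ^ m := by rw [← mul_pow]; norm_num
    rw [e4]
    have e5 : 0 ≤ (1 / 4 : ℝ) ^ m * Y ^ m / 6 := by positivity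
    calc _ = (1 / 4 : ℝ) ^ m * Y ^ m / 6 *
          (6 * 20 ^ m * C * ((q : ℝ) ^ (β - τ + γ)) ^ m) := by ring
      _ ≤ (1 / 4 : ℝ) ^ m * Y ^ m / 6 * 1 := by gcongr
      _ = _ := mul_one _

/-- The primes in the interval `(Q, 4 Q]`. -/
def primesBetween (Q : ℕ) : Finset ℕ := (Finset.Ioc Q (4 * Q)).filter Nat.Prime

lemma mem_primesBetween {Q q : ℕ} : q ∈ primesBetween Q ↔ (Q < q ∧ q ≤ 4 * Q) ∧ q.Prime := by
  simp [primesBetween]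

lemma eventually_le_card_primesBetween (t : ℝ) (ht : 0 < t) :
    ∀ᶠ Q : ℕ in Filter.atTop, (Q : ℝ) ^ (1 - t) ≤ (primesBetween Q).card := by
  have h4 : Filter.Tendsto (fun Q : ℕ => 4 * (Q : ℝ)) Filter.atTop Filter.atTop :=
    tendsto_natCast_atTop_atTop.const_mul_atTop (by norm_num)
  have h1 := h4.eventually ((isLittleO_log_rpow_atTop (r := 1 / 2) (by norm_num)).bound
    (c := 1 / 100) (by norm_num))
  have h2 := h4.eventually ((isLittleO_log_rpow_atTop ht).bound
    (c := (4 : ℝ) ^ (-t)) (by positivity))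
  filter_upwards [h1, h2, Filter.eventually_ge_atTop 2] with Q hQ1 hQ2 hQ
  have hQ' : (2 : ℝ) ≤ Q := by exact_mod_cast hQ
  set x : ℝ := 4 * (Q : ℝ) with hx
  have hx0 : 8 ≤ x := by linarith
  have hlog0 : 0 < Real.log x := Real.log_pos (by linarith)
  have hpow : ∀ s : ℝ, 0 ≤ x ^ s := fun s => by positivity
  rw [Real.norm_of_nonneg hlog0.le, Real.norm_of_nonneg (hpow _)] at hQ1 hQ2
  rw [← Real.sqrt_eq_rpow] at hQ1
  have a1 : Chebyshev.theta x - Chebyshev.theta Q ≤ (primesBetween Q).card * Real.log x := by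
    have b1 : Chebyshev.theta x = ∑ p ∈ Finset.Ioc 0 (4 * Q) with p.Prime, Real.log p := by
      rw [Chebyshev.theta, show x = ((4 * Q : ℕ) : ℝ) by rw [hx]; push_cast; ring,
        Nat.floor_natCast]
    have b2 : Chebyshev.theta Q = ∑ p ∈ Finset.Ioc 0 Q with p.Prime, Real.log p := by
      rw [Chebyshev.theta, Nat.floor_natCast]
    have b3 : (Finset.Ioc 0 (4 * Q)).filter Nat.Prime =
        (Finset.Ioc 0 Q).filter Nat.Prime ∪ primesBetween Q := by
      ext p
      simp only [Finset.mem_union, mem_primesBetween, Finset.mem_filter, Finset.mem_Ioc]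
      constructor
      · rintro ⟨⟨h1, h2⟩, h3⟩
        by_cases h : p ≤ Q
        · exact Or.inl ⟨⟨h1, h⟩, h3⟩
        · exact Or.inr ⟨⟨by omega, h2⟩, h3⟩
      · rintro (⟨⟨h1, h2⟩, h3⟩ | ⟨⟨h1, h2⟩, h3⟩)
        · exact ⟨⟨h1, by omega⟩, h3⟩
        · exact ⟨⟨by omega, h2⟩, h3⟩
    have b4 : Disjoint ((Finset.Ioc 0 Q).filter Nat.Prime) (primesBetween Q) := by
      rw [Finset.disjoint_left]
      intro p hp hp'
      have := (mem_primesBetween.1 hp').1.1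
      simp only [Finset.mem_filter, Finset.mem_Ioc] at hp
      omega
    rw [b1, b2, b3, Finset.sum_union b4, add_sub_cancel_left, ← nsmul_eq_mul]
    refine Finset.sum_le_card_nsmul _ _ _ fun p hp => ?_
    obtain ⟨⟨h1, h2⟩, h3⟩ := mem_primesBetween.1 hp
    have : (p : ℝ) ≤ x := by rw [hx]; exact_mod_cast h2
    exact Real.log_le_log (by exact_mod_cast h3.pos) this
  have a2 := Chebyshev.theta_le_log4_mul_x (x := (Q : ℝ)) (by linarith)
  have a3 := Chebyshev.theta_ge (4 * Q)
  rw [show ((4 * Q : ℕ) : ℝ) = x by rw [hx]; push_cast; ring] at a3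
  have a4 : Real.log (x + 1) ≤ 2 * Real.log x := by
    rw [← Real.log_rpow (by linarith), Real.rpow_two]
    exact Real.log_le_log (by linarith) (by nlinarith)
  have a5 : (1 : ℝ) ≤ √x := by
    rw [Real.one_le_sqrt]; linarith
  have a6 : √x * √x = x := Real.mul_self_sqrt (by linarith)
  have a7 : √x * Real.log x ≤ x / 100 := by nlinarith
  have a8 : Real.log 4 = 2 * Real.log 2 := by
    rw [show (4 : ℝ) = 2 ^ (2 : ℝ) by norm_num, Real.log_rpow (by norm_num)]
  rw [a8] at a2
  have a9 : Real.log x ≤ √x * Real.log x := by nlinarith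
  have a10 := Real.log_two_gt_d9
  have a11 : x / 4 ≤ (primesBetween Q).card * Real.log x := by
    have : x / 4 ≤ x / 2 * Real.log 2 - 4 * (x / 100) := by nlinarith
    have e : 2 * Real.log 2 * (Q : ℝ) = x / 2 * Real.log 2 := by rw [hx]; ring
    nlinarith
  have hQ0 : (0 : ℝ) < Q := by linarith
  have a12 : Real.log x ≤ (Q : ℝ) ^ t := by
    refine hQ2.trans_eq ?_
    rw [hx, Real.mul_rpow (by norm_num) hQ0.le, ← mul_assoc, ← Real.rpow_add (by norm_num)]
    simp
  have a13 : (Q : ℝ) ≤ (primesBetween Q).card * (Q : ℝ) ^ t := by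
    calc (Q : ℝ) = x / 4 := by rw [hx]; ring
      _ ≤ _ := a11
      _ ≤ _ := by gcongr
  rw [Real.rpow_sub hQ0, Real.rpow_one, div_le_iff₀ (by positivity)]
  exact a13

/-- Transition data between generations: every good rational with denominator in `(Q, 4 Q]` has at
least `N` children with denominator in `(Q', 4 Q']`, and `N` is large. -/
structure IsStep (m : ℕ) (τ β γ t : ℝ) (Q Q' N : ℕ) : Prop where
  rpow_le : (Q' : ℝ) ^ ((m : ℝ) + 1 - t) ≤ N
  card_le : (primesBetween Q').card * ((4 * (Q : ℝ)) ^ (-(1 + τ + γ)) * Q' / 8) ^ m ≤ N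
  exists_children : ∀ w : ℕ × (Fin m → ℤ), Q < w.1 → w.1 ≤ 4 * Q → IsGood m β w.1 w.2 →
    ∃ f : Fin N → ℕ × (Fin m → ℤ), Function.Injective f ∧
      ∀ j, Q' < (f j).1 ∧ (f j).1 ≤ 4 * Q' ∧ IsChild m τ β γ w.1 w.2 (f j).1 (f j).2

lemma eventually_isStep (m : ℕ) (hm : 1 ≤ m) (τ β γ t : ℝ) (hβ : 1 < β * m) (hγ : 0 < γ)
    (hβγ : β + γ < τ) (ht : 0 < t) :
    ∀ᶠ Q : ℕ in Filter.atTop, ∀ᶠ Q' : ℕ in Filter.atTop, ∃ N, IsStep m τ β γ t Q Q' N := by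
  classical
  have hm0 : (0 : ℝ) < m := by exact_mod_cast hm
  have hβ0 : 0 < β := by
    by_contra h
    nlinarith
  obtain ⟨Q₀, hQ₀⟩ := Filter.eventually_atTop.1 (exists_children m hm τ β γ hβ hγ hβγ)
  filter_upwards [Filter.eventually_ge_atTop Q₀, Filter.eventually_gt_atTop 0] with Q hQ hQpos
  have hQpos' : (0 : ℝ) < Q := by exact_mod_cast hQpos
  let W : Finset (ℕ × (Fin m → ℤ)) := (Finset.Ioc Q (4 * Q) ×ˢ
    Fintype.piFinset fun _ => Finset.Ioo (0 : ℤ) (4 * Q)).filter fun w => IsGood m β w.1 w.2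
  have hW : ∀ᶠ Q' : ℕ in Filter.atTop, ∀ w ∈ W, ∀ q' > Q', q'.Prime →
      ∃ s : Finset (Fin m → ℤ), (∀ p' ∈ s, IsChild m τ β γ w.1 w.2 q' p') ∧
        ((w.1 : ℝ) ^ (-(1 + τ + γ)) * q' / 8) ^ m ≤ s.card := by
    rw [Filter.eventually_all_finset]
    intro w hw
    obtain ⟨hw1, hw2⟩ := Finset.mem_filter.1 hw
    have hw3 := Finset.mem_Ioc.1 (Finset.mem_product.1 hw1).1
    obtain ⟨K, hK⟩ := Filter.eventually_atTop.1 (hQ₀ w.1 (by omega) w.2 hw2)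
    filter_upwards [Filter.eventually_ge_atTop K] with Q' hQ' q' hq'
    exact hK q' (by omega)
  set a : ℝ := (4 * (Q : ℝ)) ^ (-(1 + τ + γ)) / 8 with ha
  have ha0 : 0 < a := by positivity
  have h1 := ((tendsto_rpow_atTop (y := t / 2) (by linarith)).comp
    (tendsto_natCast_atTop_atTop (R := ℝ))).eventually_ge_atTop ((a ^ m)⁻¹)
  have h2 := eventually_le_card_primesBetween (t / 2) (by linarith)
  filter_upwards [hW, h1, h2, Filter.eventually_gt_atTop 0] with Q' hQ' h1 h2 hQ'pos
  have hQ'pos' : (0 : ℝ) < Q' := by exact_mod_cast hQ'pos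
  simp only [Function.comp_def] at h1
  set X : ℝ := (primesBetween Q').card * ((4 * (Q : ℝ)) ^ (-(1 + τ + γ)) * Q' / 8) ^ m with hX
  refine ⟨⌈X⌉₊, ?_, Nat.le_ceil _, ?_⟩
  · refine le_trans ?_ (Nat.le_ceil _)
    have e1 : (4 * (Q : ℝ)) ^ (-(1 + τ + γ)) * Q' / 8 = a * Q' := by rw [ha]; ring
    have e2 : (Q' : ℝ) ^ ((m : ℝ) + 1 - t) * (Q' : ℝ) ^ (t / 2) =
        (Q' : ℝ) ^ (1 - t / 2) * (Q' : ℝ) ^ m := by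
      rw [← Real.rpow_natCast, ← Real.rpow_add hQ'pos', ← Real.rpow_add hQ'pos']; ring_nf
    rw [hX, e1, mul_pow]
    have e3 : 1 ≤ a ^ m * (Q' : ℝ) ^ (t / 2) := by
      rw [inv_le_iff_one_le_mul₀ (by positivity)] at h1
      linarith
    calc (Q' : ℝ) ^ ((m : ℝ) + 1 - t)
        ≤ (Q' : ℝ) ^ ((m : ℝ) + 1 - t) * (a ^ m * (Q' : ℝ) ^ (t / 2)) :=
          le_mul_of_one_le_right (by positivity) e3
      _ = (Q' : ℝ) ^ (1 - t / 2) * (a ^ m * (Q' : ℝ) ^ m) := by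
          rw [mul_left_comm, e2]; ring
      _ ≤ _ := by gcongr
  · intro w hw1 hw2 hg
    have hwW : w ∈ W := by
      refine Finset.mem_filter.2 ⟨Finset.mem_product.2 ⟨Finset.mem_Ioc.2 ⟨hw1, hw2⟩,
        Fintype.mem_piFinset.2 fun i => Finset.mem_Ioo.2 ⟨hg.pos i, ?_⟩⟩, hg⟩
      have := hg.lt i
      omega
    have hw0 : (0 : ℝ) < w.1 := by exact_mod_cast hg.prime.pos
    have key : ∀ q', ∃ s : Finset (Fin m → ℤ), q' ∈ primesBetween Q' →
        (∀ p' ∈ s, IsChild m τ β γ w.1 w.2 q' p') ∧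
        ((w.1 : ℝ) ^ (-(1 + τ + γ)) * q' / 8) ^ m ≤ s.card := by
      intro q'
      by_cases h : q' ∈ primesBetween Q'
      · obtain ⟨⟨h1, _⟩, h3⟩ := mem_primesBetween.1 h
        obtain ⟨s, hs⟩ := hQ' w hwW q' h1 h3
        exact ⟨s, fun _ => hs⟩
      · exact ⟨∅, fun h' => absurd h' h⟩
    choose s hs using key
    let T : Finset (ℕ × (Fin m → ℤ)) :=
      (primesBetween Q').biUnion fun q' => (s q').map ⟨fun p => (q', p), fun _ _ h => by simpa using h⟩
    have hT : ⌈X⌉₊ ≤ T.card := by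
      rw [Nat.ceil_le, Finset.card_biUnion]
      · push_cast
        rw [hX, ← nsmul_eq_mul]
        refine Finset.card_nsmul_le_sum _ _ _ fun q' hq' => ?_
        rw [Finset.card_map]
        refine le_trans ?_ (hs q' hq').2
        have b1 : (Q' : ℝ) ≤ q' := by exact_mod_cast (mem_primesBetween.1 hq').1.1.le
        have b2 : (4 * (Q : ℝ)) ^ (-(1 + τ + γ)) ≤ (w.1 : ℝ) ^ (-(1 + τ + γ)) :=
          Real.rpow_le_rpow_of_nonpos hw0 (by exact_mod_cast hw2) (by linarith)
        gcongr
      · intro x _ y _ hxy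
        rw [Function.onFun, Finset.disjoint_left]
        intro z hz hz'
        obtain ⟨a, _, rfl⟩ := Finset.mem_map.1 hz
        obtain ⟨b, _, hb⟩ := Finset.mem_map.1 hz'
        exact hxy (congrArg Prod.fst hb).symm
    obtain ⟨U, hU, hUc⟩ := Finset.exists_subset_card_eq hT
    let g := (Finset.equivFinOfCardEq hUc).symm
    refine ⟨fun j => g j, fun x y h => g.injective (Subtype.ext h), fun j => ?_⟩
    obtain ⟨q', hq', hj⟩ := Finset.mem_biUnion.1 (hU (g j).2)
    obtain ⟨p', hp', hj⟩ := Finset.mem_map.1 hj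
    change (q', p') = (g j : ℕ × (Fin m → ℤ)) at hj
    beta_reduce
    rw [← hj]
    obtain ⟨⟨h1, h2⟩, _⟩ := mem_primesBetween.1 hq'
    exact ⟨h1, h2, (hs q' hq').1 p' hp'⟩

lemma eventually_exists_isGood (m : ℕ) (hm : 1 ≤ m) (β : ℝ) (hβ : 1 < β * m) :
    ∀ᶠ q : ℕ in Filter.atTop, q.Prime → ∃ p, IsGood m β q p := by
  classical
  filter_upwards [eventually_card_bad_small m β ((1 / 4) ^ m) hβ (by positivity)] with q h1 hq
  have hq0 : (0 : ℝ) < q := by exact_mod_cast hq.pos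
  have hq2 : (2 : ℝ) ≤ q := by exact_mod_cast hq.two_le
  let I : Fin m → Finset ℤ := fun _ => Finset.Ioo 0 (q : ℤ)
  have hI : ∀ i, ∀ x ∈ I i, 0 < x ∧ x < q := fun i x hx => Finset.mem_Ioo.1 hx
  let N : ℕ → Finset (Fin m → ℤ) := fun k => (Fintype.piFinset I).filter fun p =>
    ∃ v : Fin m → ℤ, ∀ i, |(k : ℝ) * ((p i : ℝ) / q) - v i| < (q : ℝ) ^ (-β)
  let U := (Finset.Ioo 0 q).biUnion N
  have hU : (U.card : ℝ) ≤ (1 / 4) ^ m * (q : ℝ) ^ m := by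
    refine le_trans ?_ h1
    have a1 : (U.card : ℝ) ≤ ∑ k ∈ Finset.Ioo 0 q, ((N k).card : ℝ) := by
      exact_mod_cast Finset.card_biUnion_le
    refine a1.trans ?_
    calc _ ≤ ∑ k ∈ Finset.Ioo 0 q, (2 * ((q : ℝ) ^ (-β) * q)) ^ m := by
          refine Finset.sum_le_sum fun k hk => ?_
          obtain ⟨b1, b2⟩ := Finset.mem_Ioo.1 hk
          exact card_near_int_vector m q hq k b1 b2 _ (by positivity) I hI
      _ ≤ _ := by
          rw [Finset.sum_const, nsmul_eq_mul, Nat.card_Ioo]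
          gcongr
          omega
  have hlt : U.card < (Fintype.piFinset I).card := by
    have : ((Fintype.piFinset I).card : ℝ) = ((q : ℝ) - 1) ^ m := by
      rw [Fintype.card_piFinset]
      simp only [I, Int.card_Ioo, Finset.prod_const, Finset.card_univ, Fintype.card_fin]
      rw [show ((q : ℤ) - 0 - 1).toNat = q - 1 by omega]
      push_cast [hq.one_le]
      rfl
    have h2 : (U.card : ℝ) < (Fintype.piFinset I).card := by
      rw [this]
      refine hU.trans_lt ?_
      rw [← mul_pow]
      exact pow_lt_pow_left₀ (by linarith) (by positivity) (by omega)
    exact_mod_cast h2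
  obtain ⟨p, hp, hpU⟩ := Finset.exists_mem_notMem_of_card_lt_card hlt
  have hpI := Fintype.mem_piFinset.1 hp
  refine ⟨p, hq, fun i => (hI i _ (hpI i)).1, fun i => (hI i _ (hpI i)).2, ?_⟩
  intro k hk hkq v
  by_contra hcon
  push Not at hcon
  exact hpU (Finset.mem_biUnion.2 ⟨k, Finset.mem_Ioo.2 ⟨hk, hkq⟩, Finset.mem_filter.2 ⟨hp, v, hcon⟩⟩)

/-- A Cantor tree of good rationals. -/
structure ChildTree (m : ℕ) (τ β γ t : ℝ) where
  Q : ℕ → ℕ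
  N : ℕ → ℕ
  root : ℕ × (Fin m → ℤ)
  next : ∀ k, ℕ × (Fin m → ℤ) → Fin (N k) → ℕ × (Fin m → ℤ)
  root_good : IsGood m β root.1 root.2
  lt_root : Q 0 < root.1
  root_le : root.1 ≤ 4 * Q 0
  Q_pos : ∀ k, 0 < Q k
  Q_large : ∀ k, 4 * 4 ^ (1 + β) ≤ (Q k : ℝ) ^ (τ - β)
  four_mul_Q_le : ∀ k, 4 * Q k ≤ Q (k + 1)
  N_ge : ∀ k, (Q (k + 1) : ℝ) ^ ((m : ℝ) + 1 - t) ≤ N k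
  N_ge_card : ∀ k, (primesBetween (Q (k + 1))).card *
    ((4 * (Q k : ℝ)) ^ (-(1 + τ + γ)) * Q (k + 1) / 8) ^ m ≤ N k
  next_injective : ∀ k w, Q k < w.1 → w.1 ≤ 4 * Q k → IsGood m β w.1 w.2 →
    Function.Injective (next k w)
  next_child : ∀ k w, Q k < w.1 → w.1 ≤ 4 * Q k → IsGood m β w.1 w.2 → ∀ j,
    Q (k + 1) < (next k w j).1 ∧ (next k w j).1 ≤ 4 * Q (k + 1) ∧
      IsChild m τ β γ w.1 w.2 (next k w j).1 (next k w j).2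

lemma nonempty_childTree (m : ℕ) (hm : 1 ≤ m) (τ β γ t : ℝ) (hβ : 1 < β * m) (hγ : 0 < γ)
    (hβγ : β + γ < τ) (ht : 0 < t) : Nonempty (ChildTree m τ β γ t) := by
  classical
  have h1 := ((tendsto_rpow_atTop (y := τ - β) (by linarith)).comp
    (tendsto_natCast_atTop_atTop (R := ℝ))).eventually_ge_atTop (4 * 4 ^ (1 + β))
  obtain ⟨K, hK⟩ := Filter.eventually_atTop.1 ((eventually_isStep m hm τ β γ t hβ hγ hβγ ht).and
    (h1.and ((Filter.eventually_gt_atTop 0).and (eventually_exists_isGood m hm β hβ))))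
  have hnext : ∀ Q : ℕ, ∃ Q', K ≤ Q → K ≤ Q' ∧ 4 * Q ≤ Q' ∧ ∃ N, IsStep m τ β γ t Q Q' N := by
    intro Q
    by_cases hQ : K ≤ Q
    · obtain ⟨Q', h⟩ := ((hK Q hQ).1.and ((Filter.eventually_ge_atTop K).and
        (Filter.eventually_ge_atTop (4 * Q)))).exists
      exact ⟨Q', fun _ => ⟨h.2.1, h.2.2, h.1⟩⟩
    · exact ⟨0, fun h => absurd h hQ⟩
  choose nxt hnxt using hnext
  obtain ⟨q₀, hq₀, hprime⟩ := Nat.exists_infinite_primes (K + 1)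
  obtain ⟨p₀, hp₀⟩ := (hK q₀ (by omega)).2.2.2 hprime
  let Q : ℕ → ℕ := fun k => nxt^[k] (q₀ - 1)
  have hQs : ∀ k, Q (k + 1) = nxt (Q k) := fun k => Function.iterate_succ_apply' _ _ _
  have hQK : ∀ k, K ≤ Q k := by
    intro k
    induction k with
    | zero => change K ≤ q₀ - 1; omega
    | succ k ih => rw [hQs]; exact (hnxt _ ih).1
  have hN : ∀ k, ∃ N, IsStep m τ β γ t (Q k) (Q (k + 1)) N := fun k => by
    rw [hQs]; exact (hnxt _ (hQK k)).2.2
  choose N hN using hN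
  have hf : ∀ k (w : ℕ × (Fin m → ℤ)), ∃ f : Fin (N k) → ℕ × (Fin m → ℤ),
      Q k < w.1 → w.1 ≤ 4 * Q k → IsGood m β w.1 w.2 → Function.Injective f ∧
      ∀ j, Q (k + 1) < (f j).1 ∧ (f j).1 ≤ 4 * Q (k + 1) ∧
        IsChild m τ β γ w.1 w.2 (f j).1 (f j).2 := by
    intro k w
    by_cases h : Q k < w.1 ∧ w.1 ≤ 4 * Q k ∧ IsGood m β w.1 w.2
    · obtain ⟨f, hf⟩ := (hN k).exists_children w h.1 h.2.1 h.2.2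
      exact ⟨f, fun _ _ _ => hf⟩
    · exact ⟨fun _ => w, fun h1 h2 h3 => absurd ⟨h1, h2, h3⟩ h⟩
  choose f hf using hf
  have h2 := hprime.two_le
  exact ⟨{
    Q := Q
    N := N
    root := (q₀, p₀)
    next := f
    root_good := hp₀
    lt_root := by change q₀ - 1 < q₀; omega
    root_le := by change q₀ ≤ 4 * (q₀ - 1); omega
    Q_pos := fun k => (hK _ (hQK k)).2.2.1
    Q_large := fun k => (hK _ (hQK k)).2.1
    four_mul_Q_le := fun k => by rw [hQs]; exact (hnxt _ (hQK k)).2.1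
    N_ge := fun k => (hN k).rpow_le
    N_ge_card := fun k => (hN k).card_le
    next_injective := fun k w h1 h2 h3 => (hf k w h1 h2 h3).1
    next_child := fun k w h1 h2 h3 => (hf k w h1 h2 h3).2 }⟩

namespace ChildTree

variable {m : ℕ} {τ β γ t : ℝ}

/-- The vertex at generation `k` on the branch `ω`. -/
def state (T : ChildTree m τ β γ t) (ω : ∀ k, Fin (T.N k)) : ℕ → ℕ × (Fin m → ℤ)
  | 0 => T.root
  | k + 1 => T.next k (state T ω k) (ω k)

/-- The limit point of the branch `ω`. -/
def point (T : ChildTree m τ β γ t) (ω : ∀ k, Fin (T.N k)) : Fin m → ℝ :=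
  fun i => ⨆ k, ((T.state ω k).2 i : ℝ) / (T.state ω k).1

lemma state_spec (T : ChildTree m τ β γ t) (ω : ∀ k, Fin (T.N k)) (k : ℕ) :
    T.Q k < (T.state ω k).1 ∧ (T.state ω k).1 ≤ 4 * T.Q k ∧
      IsGood m β (T.state ω k).1 (T.state ω k).2 := by
  induction k with
  | zero => exact ⟨T.lt_root, T.root_le, T.root_good⟩
  | succ k ih =>
    obtain ⟨h1, h2, h3⟩ := T.next_child k _ ih.1 ih.2.1 ih.2.2 (ω k)
    exact ⟨h1, h2, h3.good⟩

lemma state_isChild (T : ChildTree m τ β γ t) (ω : ∀ k, Fin (T.N k)) (k : ℕ) :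
    IsChild m τ β γ (T.state ω k).1 (T.state ω k).2 (T.state ω (k + 1)).1
      (T.state ω (k + 1)).2 :=
  have h := T.state_spec ω k
  (T.next_child k _ h.1 h.2.1 h.2.2 (ω k)).2.2

lemma state_pos (T : ChildTree m τ β γ t) (ω : ∀ k, Fin (T.N k)) (k : ℕ) :
    (1 : ℝ) ≤ (T.state ω k).1 := by
  exact_mod_cast (T.state_spec ω k).2.2.prime.one_lt.le

lemma strictMono_state (T : ChildTree m τ β γ t) (ω : ∀ k, Fin (T.N k)) :
    StrictMono fun k => (T.state ω k).1 :=
  strictMono_nat_of_lt_succ fun k => (T.state_spec ω k).2.1.trans_lt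
    ((T.four_mul_Q_le k).trans_lt (T.state_spec ω (k + 1)).1)

lemma strictMono_Q (T : ChildTree m τ β γ t) : StrictMono T.Q :=
  strictMono_nat_of_lt_succ fun k => by
    have := T.four_mul_Q_le k
    have := T.Q_pos k
    omega

lemma point_bounds (T : ChildTree m τ β γ t) (hγ : 0 < γ) (ω : ∀ k, Fin (T.N k)) (k : ℕ)
    (i : Fin m) :
    ((T.state ω k).2 i : ℝ) / (T.state ω k).1 +
        (1 - ((T.state ω k).1 : ℝ) ^ (-γ)) * ((T.state ω k).1 : ℝ) ^ (-(1 + τ)) ≤ T.point ω i ∧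
      T.point ω i < ((T.state ω k).2 i : ℝ) / (T.state ω k).1 +
        ((T.state ω k).1 : ℝ) ^ (-(1 + τ)) := by
  let a : ℕ → ℝ := fun k => ((T.state ω k).2 i : ℝ) / (T.state ω k).1
  let b : ℕ → ℝ := fun k => a k + ((T.state ω k).1 : ℝ) ^ (-(1 + τ))
  have ha : Monotone a := monotone_nat_of_le_succ fun k => by
    have h1 := (T.state_isChild ω k).left i
    have h2 : ((T.state ω k).1 : ℝ) ^ (-γ) ≤ 1 :=
      Real.rpow_le_one_of_one_le_of_nonpos (T.state_pos ω k) (by linarith)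
    have h3 : 0 ≤ (1 - ((T.state ω k).1 : ℝ) ^ (-γ)) * ((T.state ω k).1 : ℝ) ^ (-(1 + τ)) :=
      mul_nonneg (by linarith) (by positivity)
    simp only [a]
    linarith
  have hb : ∀ k, b (k + 1) < b k := fun k => (T.state_isChild ω k).right i
  have hb' : Antitone b := antitone_nat_of_succ_le fun k => (hb k).le
  have hab : ∀ j k, a j ≤ b k := fun j k => by
    have h1 := ha (le_max_left j k)
    have h2 := hb' (le_max_right j k)
    have h3 : a (max j k) ≤ b (max j k) := le_add_of_nonneg_right (by positivity)
    linarith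
  have hbdd : BddAbove (Set.range a) := ⟨b 0, by rintro _ ⟨j, rfl⟩; exact hab j 0⟩
  refine ⟨((T.state_isChild ω k).left i).trans (le_ciSup hbdd (k + 1)), ?_⟩
  exact lt_of_le_of_lt (ciSup_le fun j => hab j (k + 1)) (hb k)

lemma abs_point_sub_le (T : ChildTree m τ β γ t) (hγ : 0 < γ) (ω : ∀ k, Fin (T.N k)) (k : ℕ)
    (i : Fin m) :
    |T.point ω i - ((T.state ω k).2 i : ℝ) / (T.state ω k).1| ≤
      ((T.state ω k).1 : ℝ) ^ (-(1 + τ)) := by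
  obtain ⟨h1, h2⟩ := T.point_bounds hγ ω k i
  have h3 : ((T.state ω k).1 : ℝ) ^ (-γ) ≤ 1 :=
    Real.rpow_le_one_of_one_le_of_nonpos (T.state_pos ω k) (by linarith)
  have h4 : 0 ≤ (1 - ((T.state ω k).1 : ℝ) ^ (-γ)) * ((T.state ω k).1 : ℝ) ^ (-(1 + τ)) :=
    mul_nonneg (by linarith) (by positivity)
  rw [abs_le]
  constructor <;> linarith

lemma four_mul_le_rpow (T : ChildTree m τ β γ t) (hβ : 0 ≤ β) (hβτ : β < τ) {k : ℕ} {x : ℝ}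
    (hx : T.Q k ≤ x) : 16 ≤ x ^ (τ - β) := by
  have h1 : (T.Q k : ℝ) ^ (τ - β) ≤ x ^ (τ - β) :=
    Real.rpow_le_rpow (by positivity) hx (by linarith)
  have h2 : (4 : ℝ) ^ (1 : ℝ) ≤ 4 ^ (1 + β) :=
    Real.rpow_le_rpow_of_exponent_le (by norm_num) (by linarith)
  rw [Real.rpow_one] at h2
  linarith [T.Q_large k]

lemma exists_le_abs (T : ChildTree m τ β γ t) (hm : 1 ≤ m) (hγ : 0 < γ) (hβ : 0 ≤ β)
    (hβτ : β < τ) (ω : ∀ k, Fin (T.N k)) (k n : ℕ) (hn : (T.state ω k).1 ≤ n)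
    (hn' : n < (T.state ω (k + 1)).1) (c : ℝ) (hc1 : c ≤ 1)
    (hc : ((T.state ω k).1 : ℝ) ^ (-γ) ≤ 1 - c) (v : Fin m → ℤ) :
    ∃ i, c * (n : ℝ) ^ (-τ) ≤ |(n : ℝ) * T.point ω i - v i| := by
  obtain ⟨hQ, -, hg⟩ := T.state_spec ω k
  have hch := T.state_isChild ω k
  have hb := T.point_bounds hγ ω k
  have ha := T.abs_point_sub_le hγ ω k
  have ha' := T.abs_point_sub_le hγ ω (k + 1)
  have hq1 := T.state_pos ω k
  have h16 := T.four_mul_le_rpow hβ hβτ (k := k) (x := (T.state ω k).1) (by exact_mod_cast hQ.le)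
  set q := (T.state ω k).1
  set p := (T.state ω k).2
  set q' := (T.state ω (k + 1)).1
  set p' := (T.state ω (k + 1)).2
  have hq0 : (0 : ℝ) < q := by linarith
  have hnq : (q : ℝ) ≤ n := by exact_mod_cast hn
  have hn0 : (0 : ℝ) < n := by linarith
  have hnq' : (n : ℝ) < q' := by exact_mod_cast hn'
  have hnn : (n : ℝ) * (n : ℝ) ^ (-(1 + τ)) = (n : ℝ) ^ (-τ) := by
    rw [mul_comm, ← Real.rpow_add_one hn0.ne']; ring_nf
  have hnτ : 0 < (n : ℝ) ^ (-τ) := by positivity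
  have hcn : c * (n : ℝ) ^ (-τ) ≤ (n : ℝ) ^ (-τ) := by nlinarith
  have split : ∀ (y : Fin m → ℝ) (r : ℝ) (i : Fin m), |T.point ω i - y i| ≤ r →
      |(n : ℝ) * y i - v i| - n * r ≤ |(n : ℝ) * T.point ω i - v i| := by
    intro y r i h
    have h1 : |(n : ℝ) * (T.point ω i - y i)| ≤ n * r := by
      rw [abs_mul, abs_of_pos hn0]
      exact mul_le_mul_of_nonneg_left h hn0.le
    have h2 := abs_sub_abs_le_abs_sub ((n : ℝ) * y i - v i) (-((n : ℝ) * (T.point ω i - y i)))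
    rw [abs_neg] at h2
    have h3 : (n : ℝ) * y i - v i - -((n : ℝ) * (T.point ω i - y i)) =
      (n : ℝ) * T.point ω i - v i := by ring
    rw [h3] at h2
    linarith
  rcases le_or_gt ((q : ℝ) ^ (1 + τ - β) / 2) n with hlarge | hsmall
  · obtain ⟨i, hi⟩ := hch.far n hlarge hn' v
    refine ⟨i, ?_⟩
    have h1 := split (fun i => (p' i : ℝ) / q') _ i (ha' i)
    have h2 : (q' : ℝ) ^ (-(1 + τ)) ≤ (n : ℝ) ^ (-(1 + τ)) :=
      Real.rpow_le_rpow_of_nonpos hn0 hnq'.le (by linarith)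
    have h3 := mul_le_mul_of_nonneg_left h2 hn0.le
    linarith
  · rcases hg.eq_or_far hβ n v with heq | ⟨i, hi⟩
    · refine ⟨⟨0, hm⟩, ?_⟩
      set i : Fin m := ⟨0, hm⟩
      have h1 : (v i : ℝ) * q = n * p i := by exact_mod_cast heq i
      have h2 : (v i : ℝ) = n * ((p i : ℝ) / q) := by
        rw [← mul_div_assoc, eq_div_iff hq0.ne', h1]
      refine le_trans ?_ (le_abs_self _)
      rw [h2, ← mul_sub]
      have h3 : (n : ℝ) ^ (-(1 + τ)) ≤ (q : ℝ) ^ (-(1 + τ)) :=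
        Real.rpow_le_rpow_of_nonpos hq0 hnq (by linarith)
      have h4 : 0 ≤ 1 - (q : ℝ) ^ (-γ) := by
        have : (q : ℝ) ^ (-γ) ≤ 1 := Real.rpow_le_one_of_one_le_of_nonpos hq1 (by linarith)
        linarith
      calc c * (n : ℝ) ^ (-τ) ≤ (1 - (q : ℝ) ^ (-γ)) * (n : ℝ) ^ (-τ) := by
            gcongr; linarith
        _ = n * ((1 - (q : ℝ) ^ (-γ)) * (n : ℝ) ^ (-(1 + τ))) := by rw [← hnn]; ring
        _ ≤ n * ((1 - (q : ℝ) ^ (-γ)) * (q : ℝ) ^ (-(1 + τ))) := by gcongr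
        _ ≤ _ := by gcongr; linarith [(hb i).1]
    · refine ⟨i, ?_⟩
      have h1 := split (fun i => (p i : ℝ) / q) _ i (ha i)
      have h2 : (n : ℝ) * (q : ℝ) ^ (-(1 + τ)) ≤ (q : ℝ) ^ (-β) / 2 := by
        calc (n : ℝ) * (q : ℝ) ^ (-(1 + τ)) ≤ (q : ℝ) ^ (1 + τ - β) / 2 * (q : ℝ) ^ (-(1 + τ)) := by
              gcongr
          _ = (q : ℝ) ^ (1 + τ - β) * (q : ℝ) ^ (-(1 + τ)) / 2 := by ring
          _ = _ := by rw [← Real.rpow_add hq0]; ring_nf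
      have h3 : (n : ℝ) ^ (-τ) ≤ (q : ℝ) ^ (-τ) :=
        Real.rpow_le_rpow_of_nonpos hq0 hnq (by linarith)
      have h4 : (q : ℝ) ^ (-β) = (q : ℝ) ^ (τ - β) * (q : ℝ) ^ (-τ) := by
        rw [← Real.rpow_add hq0]; ring_nf
      have h5 : 0 < (q : ℝ) ^ (-τ) := by positivity
      have h6 : 16 * (q : ℝ) ^ (-τ) ≤ (q : ℝ) ^ (-β) := by
        rw [h4]; gcongr
      linarith

lemma point_mem_approxSet (T : ChildTree m τ β γ t) (hγ : 0 < γ) (hτ : 0 < τ)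
    (ω : ∀ k, Fin (T.N k)) : T.point ω ∈ approxSet m (fun q _ => (q : ℝ) ^ (-τ)) := by
  have hpb := T.point_bounds hγ ω
  have hε : ∀ k, ((T.state ω k).1 : ℝ) ^ (-γ) ≤ 1 := fun k =>
    Real.rpow_le_one_of_one_le_of_nonpos (T.state_pos ω k) (by linarith)
  have hpos : ∀ k, 0 ≤ (1 - ((T.state ω k).1 : ℝ) ^ (-γ)) * ((T.state ω k).1 : ℝ) ^ (-(1 + τ)) :=
    fun k => mul_nonneg (by linarith [hε k]) (by positivity)
  constructor
  · intro i
    obtain ⟨h1, h2⟩ := hpb 0 i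
    have h3 := hpos 0
    have hq1 := T.state_pos ω 0
    obtain ⟨-, -, hg⟩ := T.state_spec ω 0
    set q := (T.state ω 0).1
    set p := (T.state ω 0).2
    have hq0 : (0 : ℝ) < q := by linarith
    have h4 : (0 : ℝ) < p i := by exact_mod_cast hg.pos i
    have h5 : (0 : ℝ) < (p i : ℝ) / q := by positivity
    have h6 : (p i : ℝ) / q + 1 / q ≤ 1 := by
      rw [← add_div, div_le_one hq0]
      exact_mod_cast hg.lt i
    have h7 : (q : ℝ) ^ (-(1 + τ)) ≤ 1 / q := by
      rw [one_div, ← Real.rpow_neg_one]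
      exact Real.rpow_le_rpow_of_exponent_le hq1 (by linarith)
    exact ⟨by linarith, by linarith⟩
  · refine Set.infinite_of_injective_forall_mem (T.strictMono_state ω).injective fun k => ?_
    have hq1 := T.state_pos ω k
    refine ⟨(T.state_spec ω k).2.2.prime.pos, (T.state ω k).2, fun i => ?_⟩
    obtain ⟨h1, h2⟩ := hpb k i
    have h3 := hpos k
    set q := (T.state ω k).1
    set p := (T.state ω k).2
    have hq0 : (0 : ℝ) < q := by linarith
    have e1 : (q : ℝ) * T.point ω i - p i = q * (T.point ω i - (p i : ℝ) / q) := by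
      field_simp
    have e2 : (q : ℝ) ^ (-τ) = q * (q : ℝ) ^ (-(1 + τ)) := by
      rw [mul_comm, ← Real.rpow_add_one hq0.ne']; ring_nf
    beta_reduce
    rw [e1, e2, abs_mul, abs_of_pos hq0, abs_of_nonneg (by linarith)]
    exact mul_lt_mul_of_pos_left (by linarith) hq0

lemma point_mem_exactSet (T : ChildTree m τ β γ t) (hm : 1 ≤ m) (hγ : 0 < γ) (hβ : 0 ≤ β)
    (hβτ : β < τ) (ω : ∀ k, Fin (T.N k)) :
    T.point ω ∈ exactSet m (fun q _ => (q : ℝ) ^ (-τ)) := by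
  refine ⟨T.point_mem_approxSet hγ (by linarith) ω, fun h => ?_⟩
  simp only [Set.mem_iUnion] at h
  obtain ⟨c, hc, -, hinf⟩ := h
  have hmono := T.strictMono_state ω
  have hlim := ((tendsto_rpow_neg_atTop hγ).comp (tendsto_natCast_atTop_atTop (R := ℝ))).comp
    hmono.tendsto_atTop
  obtain ⟨K, hK⟩ := Filter.eventually_atTop.1
    (hlim.eventually (gt_mem_nhds (sub_pos.2 hc.2)))
  obtain ⟨n, ⟨hn0, v, hv⟩, hn⟩ := hinf.exists_gt (T.state ω K).1
  have hex : ∃ k, n < (T.state ω k).1 :=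
    ⟨n + 1, lt_of_lt_of_le (Nat.lt_succ_self n) (hmono.le_apply (x := n + 1))⟩
  classical
  obtain ⟨j, hj⟩ : ∃ j, Nat.find hex = j + 1 := by
    refine Nat.exists_eq_succ_of_ne_zero fun h0 => ?_
    have h1 := Nat.find_spec hex
    rw [h0] at h1
    have := hmono.monotone (Nat.zero_le K)
    omega
  have hj1 : n < (T.state ω (j + 1)).1 := hj ▸ Nat.find_spec hex
  have hj2 : (T.state ω j).1 ≤ n := not_lt.1 (Nat.find_min hex (by omega))
  have hKj : K ≤ j := by
    by_contra hlt
    have := hmono.monotone (show j + 1 ≤ K by omega)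
    omega
  have hε := hK j hKj
  simp only [Function.comp_def] at hε
  obtain ⟨i, hi⟩ := T.exists_le_abs hm hγ hβ hβτ ω j n hj2 hj1 c hc.2.le hε.le v
  exact absurd (hv i) (not_lt.2 hi)

end ChildTree

lemma mass_le_of_large {m : ℕ} {D P J N ρ R Q Q' d s : ℝ} (hD0 : 0 ≤ D) (hN : 0 < N)
    (hρ : 0 < ρ) (hQ : 1 ≤ Q) (hdm : d ≤ m) (hs : d * R ≤ s)
    (hD : D ≤ Q ^ (-s)) (hJ : J ≤ P * (13 * ρ * Q') ^ m)
    (hPN : P * ((4 * Q) ^ (-R) * Q' / 8) ^ m ≤ N) (hρQ : ρ ≤ Q ^ (-R)) :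
    D * (J / N) ≤ (104 * 4 ^ R) ^ m * ρ ^ d := by
  have hQ0 : 0 < Q := by linarith
  set x : ℝ := ρ * Q ^ R with hx
  have hx0 : 0 < x := by positivity
  have hx1 : x ≤ 1 := by
    have := mul_le_mul_of_nonneg_right hρQ (Real.rpow_nonneg hQ0.le R)
    rwa [← Real.rpow_add hQ0, neg_add_cancel, Real.rpow_zero] at this
  have e1 : 13 * ρ * Q' = ((4 * Q) ^ (-R) * Q' / 8) * (104 * 4 ^ R * x) := by
    rw [Real.mul_rpow (by norm_num) hQ0.le, Real.rpow_neg (by norm_num), Real.rpow_neg hQ0.le, hx]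
    field_simp
    ring
  have h1 : J ≤ N * (104 * 4 ^ R * x) ^ m := by
    rw [e1, mul_pow, ← mul_assoc] at hJ
    exact hJ.trans (by gcongr)
  have h2 : J / N ≤ (104 * 4 ^ R) ^ m * x ^ d := by
    rw [div_le_iff₀ hN]
    refine h1.trans ?_
    rw [mul_pow, mul_comm N]
    have : x ^ m ≤ x ^ d := by
      rw [← Real.rpow_natCast]
      exact Real.rpow_le_rpow_of_exponent_ge hx0 hx1 hdm
    gcongr
  have h3 : D ≤ Q ^ (-(R * d)) :=
    hD.trans (Real.rpow_le_rpow_of_exponent_le hQ (by linarith))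
  calc D * (J / N) ≤ D * ((104 * 4 ^ R) ^ m * x ^ d) := by gcongr
    _ ≤ Q ^ (-(R * d)) * ((104 * 4 ^ R) ^ m * x ^ d) := by gcongr
    _ = (104 * 4 ^ R) ^ m * ρ ^ d := by
        rw [hx, Real.mul_rpow hρ.le (by positivity), ← Real.rpow_mul hQ0.le, Real.rpow_neg hQ0.le]
        field_simp

lemma mass_le_of_small {m : ℕ} {D J N B ρ R Q d s β : ℝ} (hD0 : 0 ≤ D) (hD1 : D ≤ 1)
    (hN : Q ^ s ≤ N) (hρ : 0 < ρ) (hQ : 1 ≤ Q) (hd : 0 ≤ d) (hdm : d ≤ m) (hs : d * R ≤ s)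
    (hβ : m * (1 + β) - s ≤ m - d) (hB : 4 ≤ B) (hJ : J ≤ (B * (ρ * Q ^ (1 + β)) + 4) ^ m)
    (hρQ : Q ^ (-R) ≤ ρ) (hρQ' : ρ ≤ Q⁻¹) :
    D * (J / N) ≤ 2 * (2 * B) ^ m * ρ ^ d := by
  have hQ0 : 0 < Q := by linarith
  have hN0 : 0 < N := lt_of_lt_of_le (by positivity) hN
  set x : ℝ := ρ * Q ^ (1 + β) with hx
  have hx0 : 0 < x := by positivity
  have h1 : J ≤ (2 * B) ^ m * (x ^ m + 1) := by
    refine hJ.trans ?_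
    calc (B * x + 4) ^ m ≤ (B * (x + 1)) ^ m := by gcongr; linarith
      _ = B ^ m * (x + 1) ^ m := mul_pow _ _ _
      _ ≤ B ^ m * (2 ^ m * (x ^ m + 1)) := by
          gcongr
          refine (add_pow_le hx0.le zero_le_one m).trans ?_
          rw [one_pow]
          gcongr
          · norm_num
          · omega
      _ = _ := by rw [mul_pow]; ring
  have h2 : Q ^ (-s) ≤ ρ ^ d := by
    calc Q ^ (-s) ≤ Q ^ (-R * d) := Real.rpow_le_rpow_of_exponent_le hQ (by linarith)
      _ = (Q ^ (-R)) ^ d := Real.rpow_mul hQ0.le _ _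
      _ ≤ ρ ^ d := by gcongr
  have h3 : x ^ m * Q ^ (-s) ≤ ρ ^ d := by
    have e1 : x ^ m * Q ^ (-s) = ρ ^ d * (ρ ^ ((m : ℝ) - d) * Q ^ (m * (1 + β) - s)) := by
      rw [hx, mul_pow, ← Real.rpow_natCast, ← Real.rpow_natCast, ← Real.rpow_mul hQ0.le,
        mul_assoc, ← Real.rpow_add hQ0, ← mul_assoc (ρ ^ d), ← Real.rpow_add hρ]
      ring_nf
    have h4 : ρ ^ ((m : ℝ) - d) ≤ (Q⁻¹) ^ ((m : ℝ) - d) :=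
      Real.rpow_le_rpow hρ.le hρQ' (by linarith)
    have h5 : Q ^ (m * (1 + β) - s) ≤ Q ^ ((m : ℝ) - d) :=
      Real.rpow_le_rpow_of_exponent_le hQ hβ
    rw [e1]
    refine mul_le_of_le_one_right (by positivity) ?_
    calc _ ≤ (Q⁻¹) ^ ((m : ℝ) - d) * Q ^ ((m : ℝ) - d) := by gcongr
      _ = 1 := by
        rw [← Real.mul_rpow (by positivity) hQ0.le, inv_mul_cancel₀ hQ0.ne', Real.one_rpow]
  have h4 : N⁻¹ ≤ Q ^ (-s) := by
    rw [Real.rpow_neg hQ0.le]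
    exact inv_anti₀ (by positivity) hN
  have h5 : J / N ≤ 2 * (2 * B) ^ m * ρ ^ d := by
    rw [div_eq_mul_inv]
    calc J * N⁻¹ ≤ (2 * B) ^ m * (x ^ m + 1) * N⁻¹ := by gcongr
      _ ≤ (2 * B) ^ m * (x ^ m + 1) * Q ^ (-s) := by gcongr
      _ = (2 * B) ^ m * (x ^ m * Q ^ (-s) + Q ^ (-s)) := by ring
      _ ≤ (2 * B) ^ m * (ρ ^ d + ρ ^ d) := by gcongr
      _ = _ := by ring
  calc D * (J / N) ≤ D * (2 * (2 * B) ^ m * ρ ^ d) := by gcongr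
    _ ≤ 1 * (2 * (2 * B) ^ m * ρ ^ d) := by gcongr
    _ = _ := one_mul _

namespace ChildTree

variable {m : ℕ} {τ β γ t : ℝ}

lemma N_pos (T : ChildTree m τ β γ t) (k : ℕ) : 0 < T.N k := by
  have h1 : (0 : ℝ) < T.Q (k + 1) := by exact_mod_cast T.Q_pos (k + 1)
  have h2 : (0 : ℝ) < T.N k := lt_of_lt_of_le (by positivity) (T.N_ge k)
  exact_mod_cast h2

lemma four_mul_rpow_le (T : ChildTree m τ β γ t) (k : ℕ) :
    4 * (T.Q k : ℝ) ^ (-(1 + τ)) ≤ (4 * (T.Q k : ℝ)) ^ (-(1 + β)) := by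
  have h1 : (0 : ℝ) < T.Q k := by exact_mod_cast T.Q_pos k
  have h2 := T.Q_large k
  rw [Real.mul_rpow (by norm_num) h1.le, Real.rpow_neg (show (0 : ℝ) ≤ 4 by norm_num),
    ← div_eq_inv_mul, le_div_iff₀ (by positivity)]
  calc 4 * (T.Q k : ℝ) ^ (-(1 + τ)) * 4 ^ (1 + β)
      = 4 * 4 ^ (1 + β) * (T.Q k : ℝ) ^ (-(1 + τ)) := by ring
    _ ≤ (T.Q k : ℝ) ^ (τ - β) * (T.Q k : ℝ) ^ (-(1 + τ)) := by gcongr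
    _ = _ := by rw [← Real.rpow_add h1]; ring_nf

lemma abs_point_sub_le_Q (T : ChildTree m τ β γ t) (hγ : 0 < γ) (hτ : 0 < τ)
    (ω : ∀ k, Fin (T.N k)) (k : ℕ) (i : Fin m) :
    |T.point ω i - ((T.state ω k).2 i : ℝ) / (T.state ω k).1| ≤ (T.Q k : ℝ) ^ (-(1 + τ)) := by
  refine (T.abs_point_sub_le hγ ω k i).trans ?_
  exact Real.rpow_le_rpow_of_nonpos (by exact_mod_cast T.Q_pos k)
    (by exact_mod_cast (T.state_spec ω k).1.le) (by linarith)

lemma abs_state_sub_le (T : ChildTree m τ β γ t) (hγ : 0 < γ) (hτ : 0 < τ)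
    {ω ω' : ∀ k, Fin (T.N k)} {ρ : ℝ} (h : ∀ i, |T.point ω i - T.point ω' i| ≤ ρ) (k : ℕ)
    (i : Fin m) :
    |((T.state ω k).2 i : ℝ) / (T.state ω k).1 - ((T.state ω' k).2 i : ℝ) / (T.state ω' k).1| ≤
      ρ + 2 * (T.Q k : ℝ) ^ (-(1 + τ)) := by
  have h1 := abs_le.1 (T.abs_point_sub_le_Q hγ hτ ω k i)
  have h2 := abs_le.1 (T.abs_point_sub_le_Q hγ hτ ω' k i)
  have h3 := abs_le.1 (h i)
  rw [abs_le]
  constructor <;> linarith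

lemma eq_prefix_of_close (T : ChildTree m τ β γ t) (hγ : 0 < γ) (hβ : 0 ≤ β) (hβτ : β < τ)
    {ω ω' : ∀ k, Fin (T.N k)} {k : ℕ}
    (h : ∀ i, |T.point ω i - T.point ω' i| ≤ (T.Q k : ℝ) ^ (-(1 + τ))) {j : ℕ} (hj : j ≤ k) :
    (∀ l < j, ω l = ω' l) ∧ T.state ω j = T.state ω' j := by
  induction j with
  | zero => exact ⟨fun l hl => absurd hl (Nat.not_lt_zero l), rfl⟩
  | succ j ih =>
    obtain ⟨ih1, ih2⟩ := ih (by omega)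
    have hst : T.state ω (j + 1) = T.state ω' (j + 1) := by
      by_contra hne
      obtain ⟨h1, h2, h3⟩ := T.state_spec ω (j + 1)
      obtain ⟨h1', h2', h3'⟩ := T.state_spec ω' (j + 1)
      obtain ⟨i, hi⟩ := h3.separated h3' hβ (Q := 4 * (T.Q (j + 1) : ℝ)) (by exact_mod_cast h2)
        (by exact_mod_cast h2') hne
      have h4 := T.abs_state_sub_le hγ (by linarith) h (j + 1) i
      have h5 := T.four_mul_rpow_le (j + 1)
      have hQ : (0 : ℝ) < T.Q (j + 1) := by exact_mod_cast T.Q_pos (j + 1)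
      have h6 : (T.Q k : ℝ) ^ (-(1 + τ)) ≤ (T.Q (j + 1) : ℝ) ^ (-(1 + τ)) :=
        Real.rpow_le_rpow_of_nonpos hQ (by exact_mod_cast T.strictMono_Q.monotone hj)
          (by linarith)
      have h7 : 0 < (T.Q (j + 1) : ℝ) ^ (-(1 + τ)) := by positivity
      linarith
    refine ⟨fun l hl => ?_, hst⟩
    rcases Nat.lt_succ_iff_lt_or_eq.1 hl with hl | rfl
    · exact ih1 l hl
    · obtain ⟨h1, h2, h3⟩ := T.state_spec ω l
      refine T.next_injective l _ h1 h2 h3 ?_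
      have : T.next l (T.state ω l) (ω l) = T.next l (T.state ω' l) (ω' l) := hst
      rwa [← ih2] at this

lemma card_le_of_large (T : ChildTree m τ β γ t) (hτ : 0 < τ) {k : ℕ} {w : ℕ × (Fin m → ℤ)}
    (h1 : T.Q k < w.1) (h2 : w.1 ≤ 4 * T.Q k) (h3 : IsGood m β w.1 w.2) {ρ : ℝ}
    (hρ : (T.Q (k + 1) : ℝ)⁻¹ ≤ ρ) (J : Finset (Fin (T.N k)))
    (hJ : ∀ x ∈ J, ∀ y ∈ J, ∀ i, |((T.next k w x).2 i : ℝ) / (T.next k w x).1 -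
      ((T.next k w y).2 i : ℝ) / (T.next k w y).1| ≤ ρ + 2 * (T.Q (k + 1) : ℝ) ^ (-(1 + τ))) :
    (J.card : ℝ) ≤ (primesBetween (T.Q (k + 1))).card * (13 * ρ * T.Q (k + 1)) ^ m := by
  classical
  have hch := T.next_child k w h1 h2 h3
  have hinj := T.next_injective k w h1 h2 h3
  set Q := T.Q (k + 1)
  have hQ1 : (1 : ℝ) ≤ Q := by exact_mod_cast T.Q_pos (k + 1)
  have hQ0 : (0 : ℝ) < Q := by linarith
  have hρ0 : 0 < ρ := lt_of_lt_of_le (by positivity) hρ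
  have hQρ : 1 ≤ ρ * Q := by rwa [inv_le_iff_one_le_mul₀ hQ0] at hρ
  have hR : ρ + 2 * (Q : ℝ) ^ (-(1 + τ)) ≤ 3 * ρ := by
    have : (Q : ℝ) ^ (-(1 + τ)) ≤ (Q : ℝ)⁻¹ := by
      rw [← Real.rpow_neg_one]
      exact Real.rpow_le_rpow_of_exponent_le hQ1 (by linarith)
    linarith
  have hmaps : ∀ x ∈ J, (T.next k w x).1 ∈ primesBetween Q := fun x _ =>
    mem_primesBetween.2 ⟨⟨(hch x).1, (hch x).2.1⟩, (hch x).2.2.good.prime⟩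
  rw [Finset.card_eq_sum_card_fiberwise hmaps]
  push_cast
  rw [← nsmul_eq_mul]
  refine Finset.sum_le_card_nsmul _ _ _ fun q hq => ?_
  obtain ⟨⟨hq1, hq2⟩, hq3⟩ := mem_primesBetween.1 hq
  have hq0 : (0 : ℝ) < q := by exact_mod_cast hq3.pos
  set F := J.filter fun x => (T.next k w x).1 = q
  have hFinj : Set.InjOn (fun x => (T.next k w x).2) F := by
    intro x hx y hy hxy
    have hx := (Finset.mem_filter.1 hx).2
    have hy := (Finset.mem_filter.1 hy).2
    exact hinj (Prod.ext (hx.trans hy.symm) hxy)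
  rw [← Finset.card_image_of_injOn hFinj]
  refine (card_le_of_forall_abs_sub_le m _ (12 * ρ * Q) (by positivity) ?_).trans ?_
  · intro a ha b hb i
    obtain ⟨x, hx, rfl⟩ := Finset.mem_image.1 ha
    obtain ⟨y, hy, rfl⟩ := Finset.mem_image.1 hb
    obtain ⟨hx, hxq⟩ := Finset.mem_filter.1 hx
    obtain ⟨hy, hyq⟩ := Finset.mem_filter.1 hy
    have h := (hJ x hx y hy i).trans hR
    rw [hxq, hyq, ← sub_div, abs_div, abs_of_pos hq0, div_le_iff₀ hq0] at h
    refine h.trans ?_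
    have : (q : ℝ) ≤ 4 * Q := by exact_mod_cast hq2
    calc 3 * ρ * q ≤ 3 * ρ * (4 * Q) := by gcongr
      _ = _ := by ring
  · gcongr
    linarith

lemma card_le_of_small (T : ChildTree m τ β γ t) (hβ : 0 ≤ β) {k : ℕ}
    {w : ℕ × (Fin m → ℤ)}
    (h1 : T.Q k < w.1) (h2 : w.1 ≤ 4 * T.Q k) (h3 : IsGood m β w.1 w.2) {ρ : ℝ} (hρ : 0 ≤ ρ)
    (J : Finset (Fin (T.N k)))
    (hJ : ∀ x ∈ J, ∀ y ∈ J, ∀ i, |((T.next k w x).2 i : ℝ) / (T.next k w x).1 -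
      ((T.next k w y).2 i : ℝ) / (T.next k w y).1| ≤ ρ + 2 * (T.Q (k + 1) : ℝ) ^ (-(1 + τ))) :
    (J.card : ℝ) ≤ (2 * 4 ^ (1 + β) * (ρ * (T.Q (k + 1) : ℝ) ^ (1 + β)) + 4) ^ m := by
  rcases J.eq_empty_or_nonempty with rfl | ⟨x₀, hx₀⟩
  · simp only [Finset.card_empty, Nat.cast_zero]
    positivity
  have hch := T.next_child k w h1 h2 h3
  have hinj := T.next_injective k w h1 h2 h3
  have hfour := T.four_mul_rpow_le (k + 1)
  set Q := T.Q (k + 1)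
  have hQ0 : (0 : ℝ) < Q := by exact_mod_cast T.Q_pos (k + 1)
  refine (card_le_of_separated J
    (fun x i => ((T.next k w x).2 i : ℝ) / (T.next k w x).1)
    (fun i => ((T.next k w x₀).2 i : ℝ) / (T.next k w x₀).1)
    (ρ + 2 * (Q : ℝ) ^ (-(1 + τ))) ((4 * (Q : ℝ)) ^ (-(1 + β))) (by positivity) (by positivity)
    (fun x hx i => hJ x hx x₀ hx₀ i) fun x _ y _ hxy => ?_).trans ?_
  · exact (hch x).2.2.good.separated (hch y).2.2.good hβ (by exact_mod_cast (hch x).2.1)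
      (by exact_mod_cast (hch y).2.1) (fun h => hxy (hinj h))
  · have e1 : ((4 * (Q : ℝ)) ^ (-(1 + β))) * (4 ^ (1 + β) * (Q : ℝ) ^ (1 + β)) = 1 := by
      rw [← Real.mul_rpow (by norm_num) hQ0.le, ← Real.rpow_add (by positivity)]
      simp
    set η := (4 * (Q : ℝ)) ^ (-(1 + β)) with hη
    have hη0 : 0 < η := by positivity
    have h4 : 2 * (ρ + 2 * (Q : ℝ) ^ (-(1 + τ))) / η ≤
        2 * 4 ^ (1 + β) * (ρ * (Q : ℝ) ^ (1 + β)) + 1 := by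
      rw [div_le_iff₀ hη0]
      have : (2 * 4 ^ (1 + β) * (ρ * (Q : ℝ) ^ (1 + β)) + 1) * η =
          2 * ρ * (η * (4 ^ (1 + β) * (Q : ℝ) ^ (1 + β))) + η := by ring
      rw [this, e1]
      linarith
    exact pow_le_pow_left₀ (by positivity) (by linarith) m

lemma prod_inv_le (T : ChildTree m τ β γ t) (k : ℕ) :
    ∏ j ∈ Finset.range (k + 1), (T.N j : ℝ)⁻¹ ≤ (T.Q (k + 1) : ℝ) ^ (-((m : ℝ) + 1 - t)) := by
  have hQ : (0 : ℝ) < T.Q (k + 1) := by exact_mod_cast T.Q_pos (k + 1)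
  rw [Finset.prod_range_succ, Real.rpow_neg hQ.le]
  have h1 : ∏ j ∈ Finset.range k, (T.N j : ℝ)⁻¹ ≤ 1 :=
    Finset.prod_le_one (fun j _ => by positivity) fun j _ =>
      inv_le_one_of_one_le₀ (by exact_mod_cast T.N_pos j)
  have h2 := inv_anti₀ (by positivity) (T.N_ge k)
  calc _ ≤ 1 * (T.N k : ℝ)⁻¹ := by gcongr
    _ ≤ _ := by rwa [one_mul]

/-- The uniform probability measure on the branches of the tree. -/
def mass (T : ChildTree m τ β γ t) : Measure (∀ k, Fin (T.N k)) :=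
  Measure.infinitePi fun k => ProbabilityTheory.uniformOn (Set.univ : Set (Fin (T.N k)))

lemma isProbabilityMeasure_uniformOn_fin (T : ChildTree m τ β γ t) (k : ℕ) :
    IsProbabilityMeasure (ProbabilityTheory.uniformOn (Set.univ : Set (Fin (T.N k)))) :=
  ProbabilityTheory.isProbabilityMeasure_uniformOn Set.finite_univ ⟨⟨0, T.N_pos k⟩, trivial⟩

lemma mass_univ (T : ChildTree m τ β γ t) : T.mass Set.univ = 1 := by
  have := T.isProbabilityMeasure_uniformOn_fin
  rw [mass]
  exact measure_univ

lemma mass_le (T : ChildTree m τ β γ t) (A : Set (∀ k, Fin (T.N k))) (k : ℕ)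
    (hA : ∀ ω ∈ A, ∀ ω' ∈ A, ∀ j < k, ω j = ω' j) (J : Finset (Fin (T.N k)))
    (hJ : ∀ ω ∈ A, ω k ∈ J) :
    T.mass A ≤ ENNReal.ofReal ((∏ j ∈ Finset.range k, (T.N j : ℝ)⁻¹) * (J.card / T.N k)) := by
  have := T.isProbabilityMeasure_uniformOn_fin
  rcases A.eq_empty_or_nonempty with rfl | ⟨ω₀, hω₀⟩
  · simp
  let B : ∀ j, Set (Fin (T.N j)) := fun j => {x | ∃ ω ∈ A, ω j = x}
  have hsub : A ⊆ Set.pi (Finset.range (k + 1)) B := fun ω hω j _ => ⟨ω, hω, rfl⟩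
  refine (measure_mono hsub).trans ?_
  rw [mass, Measure.infinitePi_pi _ fun j _ => MeasurableSet.of_discrete, Finset.prod_range_succ,
    ENNReal.ofReal_mul (by positivity), ENNReal.ofReal_prod_of_nonneg (fun j _ => by positivity)]
  have hN : ∀ j, (0 : ℝ) < T.N j := fun j => by exact_mod_cast T.N_pos j
  have hu : ∀ j (s : Finset (Fin (T.N j))),
      ProbabilityTheory.uniformOn Set.univ (s : Set (Fin (T.N j))) =
      ENNReal.ofReal (s.card / T.N j) := by
    intro j s
    rw [ProbabilityTheory.uniformOn_univ, Measure.count_apply_finset, Fintype.card_fin,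
      ENNReal.ofReal_div_of_pos (hN j), ENNReal.ofReal_natCast, ENNReal.ofReal_natCast]
  gcongr with j hj
  · have h1 : B j ⊆ (({ω₀ j} : Finset (Fin (T.N j))) : Set (Fin (T.N j))) := by
      rintro _ ⟨ω, hω, rfl⟩
      simpa using hA ω hω ω₀ hω₀ j (Finset.mem_range.1 hj)
    refine (measure_mono h1).trans ?_
    rw [hu]
    simp
  · have h1 : B k ⊆ (J : Set (Fin (T.N k))) := by
      rintro _ ⟨ω, hω, rfl⟩
      exact hJ ω hω
    refine (measure_mono h1).trans ?_
    rw [hu]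

lemma exists_mass_le (T : ChildTree m τ β γ t) (hγ : 0 < γ) (hβ : 0 ≤ β) (hβτ : β < τ) {d : ℝ}
    (hd : 0 ≤ d) (hdm : d ≤ m) (hs : d * (1 + τ + γ) ≤ m + 1 - t)
    (hβd : m * (1 + β) - (m + 1 - t) ≤ m - d) :
    ∃ C : ℝ, 0 < C ∧ ∃ r : ℝ, 0 < r ∧ ∀ ρ : ℝ, 0 < ρ → ρ ≤ r → ∀ A : Set (∀ k, Fin (T.N k)),
      (∀ ω ∈ A, ∀ ω' ∈ A, ∀ i, |T.point ω i - T.point ω' i| ≤ ρ) →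
      T.mass A ≤ ENNReal.ofReal (C * ρ ^ d) := by
  classical
  have hQ1 : ∀ k, (1 : ℝ) ≤ T.Q k := fun k => by exact_mod_cast T.Q_pos k
  have hQ0 : ∀ k, (0 : ℝ) < T.Q k := fun k => by linarith [hQ1 k]
  set R := 1 + τ + γ with hR
  set C₁ : ℝ := (104 * 4 ^ R) ^ m
  set C₂ : ℝ := 2 * (2 * (2 * 4 ^ (1 + β))) ^ m
  have hC₁ : 0 < C₁ := by positivity
  have hC₂ : 0 < C₂ := by positivity
  refine ⟨C₁ + C₂, by positivity, (T.Q 1 : ℝ) ^ (-R), Real.rpow_pos_of_pos (hQ0 1) _, ?_⟩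
  intro ρ hρ hρr A hA
  have hlim : Filter.Tendsto (fun k => (T.Q k : ℝ) ^ (-R)) Filter.atTop (nhds 0) :=
    ((tendsto_rpow_neg_atTop (y := R) (by linarith)).comp
    (tendsto_natCast_atTop_atTop (R := ℝ))).comp T.strictMono_Q.tendsto_atTop
  have hex : ∃ k, (T.Q k : ℝ) ^ (-R) < ρ := (hlim.eventually (gt_mem_nhds hρ)).exists
  obtain ⟨k, hk⟩ : ∃ k, Nat.find hex = k + 2 := by
    have h0 : 1 < Nat.find hex := by
      rw [Nat.lt_find_iff]
      intro j hj
      rw [not_lt]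
      refine hρr.trans (Real.rpow_le_rpow_of_nonpos (hQ0 j) ?_ (by linarith))
      exact_mod_cast T.strictMono_Q.monotone hj
    exact ⟨Nat.find hex - 2, by omega⟩
  have hk1 : (T.Q (k + 2) : ℝ) ^ (-R) < ρ := hk ▸ Nat.find_spec hex
  have hk2 : ρ ≤ (T.Q (k + 1) : ℝ) ^ (-R) := not_lt.1 (Nat.find_min hex (by omega))
  have hclose : ∀ ω ∈ A, ∀ ω' ∈ A, ∀ i,
      |T.point ω i - T.point ω' i| ≤ (T.Q (k + 1) : ℝ) ^ (-(1 + τ)) := fun ω hω ω' hω' i =>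
    (hA ω hω ω' hω' i).trans (hk2.trans
      (Real.rpow_le_rpow_of_exponent_le (hQ1 _) (by linarith)))
  have hpre : ∀ ω ∈ A, ∀ ω' ∈ A, (∀ l < k + 1, ω l = ω' l) ∧
      T.state ω (k + 1) = T.state ω' (k + 1) := fun ω hω ω' hω' =>
    T.eq_prefix_of_close hγ hβ hβτ (hclose ω hω ω' hω') le_rfl
  rcases A.eq_empty_or_nonempty with rfl | ⟨ω₀, hω₀⟩
  · simp
  obtain ⟨g1, g2, g3⟩ := T.state_spec ω₀ (k + 1)
  set w := T.state ω₀ (k + 1) with hw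
  let J : Finset (Fin (T.N (k + 1))) := Finset.univ.filter fun x => ∃ ω ∈ A, ω (k + 1) = x
  have hstate : ∀ ω ∈ A, T.state ω (k + 2) = T.next (k + 1) w (ω (k + 1)) := fun ω hω => by
    rw [hw, ← (hpre ω hω ω₀ hω₀).2]; rfl
  have hJ : ∀ x ∈ J, ∀ y ∈ J, ∀ i, |((T.next (k + 1) w x).2 i : ℝ) / (T.next (k + 1) w x).1 -
      ((T.next (k + 1) w y).2 i : ℝ) / (T.next (k + 1) w y).1| ≤
        ρ + 2 * (T.Q (k + 1 + 1) : ℝ) ^ (-(1 + τ)) := by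
    intro x hx y hy i
    obtain ⟨ω, hω, rfl⟩ := (Finset.mem_filter.1 hx).2
    obtain ⟨ω', hω', rfl⟩ := (Finset.mem_filter.1 hy).2
    rw [← hstate ω hω, ← hstate ω' hω']
    exact T.abs_state_sub_le hγ (by linarith) (hA ω hω ω' hω') (k + 2) i
  refine (T.mass_le A (k + 1) (fun ω hω ω' hω' => (hpre ω hω ω' hω').1) J fun ω hω =>
    Finset.mem_filter.2 ⟨Finset.mem_univ _, ω, hω, rfl⟩).trans (ENNReal.ofReal_le_ofReal ?_)
  have hD := T.prod_inv_le k
  have hD0 : 0 ≤ ∏ j ∈ Finset.range (k + 1), (T.N j : ℝ)⁻¹ :=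
    Finset.prod_nonneg fun j _ => by positivity
  have hN0 : (0 : ℝ) < T.N (k + 1) := by exact_mod_cast T.N_pos (k + 1)
  have hρd : 0 < ρ ^ d := by positivity
  rcases le_or_gt ((T.Q (k + 1 + 1) : ℝ)⁻¹) ρ with hlarge | hsmall
  · have h1 := T.card_le_of_large (by linarith) g1 g2 g3 hlarge J hJ
    have h2 := mass_le_of_large hD0 hN0 hρ (hQ1 (k + 1)) hdm hs hD h1 (T.N_ge_card (k + 1)) hk2
    refine h2.trans ?_
    gcongr
    linarith
  · have h1 := T.card_le_of_small hβ g1 g2 g3 hρ.le J hJ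
    have h4 : (4 : ℝ) ^ (1 : ℝ) ≤ 4 ^ (1 + β) :=
      Real.rpow_le_rpow_of_exponent_le (by norm_num) (by linarith)
    rw [Real.rpow_one] at h4
    have hD1 : ∏ j ∈ Finset.range (k + 1), (T.N j : ℝ)⁻¹ ≤ 1 :=
      Finset.prod_le_one (fun j _ => by positivity) fun j _ =>
        inv_le_one_of_one_le₀ (by exact_mod_cast T.N_pos j)
    have h2 := mass_le_of_small hD0 hD1 (T.N_ge (k + 1)) hρ (hQ1 (k + 2)) hd hdm hs hβd
      (by linarith) h1 hk1.le hsmall.le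
    refine h2.trans ?_
    gcongr
    linarith

end ChildTree

/-- The mass distribution principle. -/
lemma le_dimH_of_mass {m : ℕ} {Ω : Type*} [MeasurableSpace Ω] (ν : Measure Ω)
    (hν : ν Set.univ ≠ 0) (f : Ω → Fin m → ℝ) (S : Set (Fin m → ℝ)) (hf : ∀ ω, f ω ∈ S)
    {d C r : ℝ} (hd : 0 < d) (hC : 0 < C) (hr : 0 < r)
    (h : ∀ ρ : ℝ, 0 < ρ → ρ ≤ r → ∀ A : Set Ω,
      (∀ ω ∈ A, ∀ ω' ∈ A, ∀ i, |f ω i - f ω' i| ≤ ρ) → ν A ≤ ENNReal.ofReal (C * ρ ^ d)) :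
    ENNReal.ofReal d ≤ dimH S := by
  set c : ENNReal := (ENNReal.ofReal C)⁻¹
  have hC0 : ENNReal.ofReal C ≠ 0 := by simpa using hC
  have hc0 : c ≠ 0 := ENNReal.inv_ne_zero.2 ENNReal.ofReal_ne_top
  let μ : OuterMeasure (Fin m → ℝ) := c • OuterMeasure.map f ν.toOuterMeasure
  have hμ : ∀ s, μ s = c * ν (f ⁻¹' s) := fun s => by
    simp only [μ, _root_.smul_apply, OuterMeasure.map_apply, Measure.coe_toOuterMeasure,
      smul_eq_mul]
  have hball : ∀ s : Set (Fin m → ℝ), ∀ ρ : ℝ, 0 < ρ → ρ ≤ r → Metric.ediam s ≤ ENNReal.ofReal ρ →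
      ν (f ⁻¹' s) ≤ ENNReal.ofReal (C * ρ ^ d) := by
    intro s ρ hρ hρr hs
    refine h ρ hρ hρr _ fun ω hω ω' hω' i => ?_
    have h1 : edist (f ω) (f ω') ≤ ENNReal.ofReal ρ :=
      (Metric.edist_le_ediam_of_mem (Set.mem_preimage.1 hω) (Set.mem_preimage.1 hω')).trans hs
    rw [edist_dist, ENNReal.ofReal_le_ofReal_iff hρ.le] at h1
    exact (Real.dist_eq _ _ ▸ dist_le_pi_dist (f ω) (f ω') i).trans h1
  have hle : μ ≤ OuterMeasure.mkMetric fun x : ENNReal => x ^ d := by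
    refine OuterMeasure.le_mkMetric _ μ (ENNReal.ofReal r) (by simpa using hr) fun s hs => ?_
    rw [hμ]
    rcases eq_or_ne (Metric.ediam s) 0 with h0 | h0
    · have hz : ν (f ⁻¹' s) = 0 := by
        have hlim : Filter.Tendsto (fun ρ : ℝ => ENNReal.ofReal (C * ρ ^ d)) (nhdsWithin 0 (Ioi 0))
            (nhds 0) := by
          have : Filter.Tendsto (fun ρ : ℝ => C * ρ ^ d) (nhds 0) (nhds (C * 0 ^ d)) :=
            ((Real.continuousAt_rpow_const 0 d (Or.inr hd.le)).tendsto).const_mul C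
          rw [Real.zero_rpow hd.ne', mul_zero] at this
          simpa using (ENNReal.tendsto_ofReal this).mono_left nhdsWithin_le_nhds
        refine le_antisymm (ge_of_tendsto hlim ?_) (zero_le)
        filter_upwards [Ioc_mem_nhdsGT hr] with ρ hρ
        exact hball s ρ hρ.1 hρ.2 (h0 ▸ zero_le)
      rw [hz, mul_zero]
      exact zero_le
    · have htop : Metric.ediam s ≠ ⊤ := ne_top_of_le_ne_top ENNReal.ofReal_ne_top hs
      have hpos := ENNReal.toReal_pos h0 htop
      have h1 := hball s _ hpos (ENNReal.toReal_le_of_le_ofReal hr.le hs)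
        (ENNReal.ofReal_toReal htop).ge
      rw [ENNReal.ofReal_mul hC.le, ← ENNReal.ofReal_rpow_of_pos hpos,
        ENNReal.ofReal_toReal htop] at h1
      calc c * ν (f ⁻¹' s) ≤ c * (ENNReal.ofReal C * Metric.ediam s ^ d) := by gcongr
        _ = Metric.ediam s ^ d := by
          rw [← mul_assoc, ENNReal.inv_mul_cancel hC0 ENNReal.ofReal_ne_top, one_mul]
  have hS := hle S
  rw [hμ, (eq_univ_of_forall hf : f ⁻¹' S = univ), OuterMeasure.coe_mkMetric] at hS
  refine le_dimH_of_hausdorffMeasure_ne_zero (d := d.toNNReal) fun h0 => ?_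
  rw [Real.coe_toNNReal d hd.le, Measure.hausdorffMeasure] at h0
  rw [h0] at hS
  exact mul_ne_zero hc0 hν (le_antisymm hS (zero_le))

lemma le_dimH_exactSet {m : ℕ} (hm : 1 ≤ m) {c d : ℝ} (hc : 1 / (m : ℝ) < c) (hd : 0 < d)
    (hdc : d < ((m : ℝ) + 1) / (1 + c)) :
    ENNReal.ofReal d ≤ dimH (exactSet m fun q _ => (q : ℝ) ^ (-c)) := by
  have hm0 : (0 : ℝ) < m := by exact_mod_cast hm
  have hc0 : 0 < c := lt_trans (by positivity) hc
  have hmc : 1 < c * m := by rwa [div_lt_iff₀ hm0] at hc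
  rw [lt_div_iff₀ (by linarith)] at hdc
  have hdm : d < m := by
    by_contra! hle
    nlinarith
  obtain ⟨t, ht, h1, h2, h3⟩ : ∃ t : ℝ, 0 < t ∧ t * (d + 1) ≤ m + 1 - d * (1 + c) ∧
      t * (m + 1) ≤ m - d ∧ 2 * t < c - 1 / m := by
    have hd1 : 0 < d + 1 := by linarith
    refine ⟨min ((m + 1 - d * (1 + c)) / (d + 1)) (min ((m - d) / (m + 1)) ((c - 1 / m) / 3)),
      ?_, ?_, ?_, ?_⟩
    · refine lt_min (div_pos (by linarith) hd1) (lt_min (div_pos (by linarith) (by linarith))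
        (div_pos (by linarith) (by norm_num)))
    · rw [← le_div_iff₀ hd1]
      exact min_le_left _ _
    · rw [← le_div_iff₀ (by linarith)]
      exact (min_le_right _ _).trans (min_le_left _ _)
    · have := (min_le_right ((m + 1 - d * (1 + c)) / (d + 1)) _).trans
        (min_le_right ((m - d) / (m + 1)) ((c - 1 / m) / 3))
      linarith
  have hβm : (1 / (m : ℝ) + t) * m = 1 + t * m := by field_simp
  have hinv : 0 < 1 / (m : ℝ) := by positivity
  obtain ⟨T⟩ := nonempty_childTree m hm c (1 / m + t) t t (by rw [hβm]; nlinarith) ht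
    (by linarith) ht
  obtain ⟨C, hC, r, hr, h⟩ := T.exists_mass_le ht (by positivity) (by linarith) hd.le hdm.le
    (by linarith) (by linarith)
  exact le_dimH_of_mass T.mass (by simp [T.mass_univ]) T.point _
    (T.point_mem_exactSet hm ht (by positivity) (by linarith)) hd hC hr h

lemma dimH_approxSet_le {m : ℕ} {c d : ℝ} (hc : 0 ≤ c) (hd : 0 < d)
    (hdc : ((m : ℝ) + 1) / (1 + c) < d) :
    dimH (approxSet m fun q _ => (q : ℝ) ^ (-c)) ≤ ENNReal.ofReal d := by
  rw [div_lt_iff₀ (by linarith)] at hdc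
  let rad : ℕ → ℝ := fun q => (q : ℝ) ^ (-(1 + c))
  let B : ∀ n : ℕ, (Σ k : ℕ, (Fin m → Fin (k + n + 2))) → Set (Fin m → ℝ) := fun n x =>
    Metric.closedBall (fun i => ((x.2 i : ℕ) : ℝ) / (x.1 + n + 1 : ℕ)) (rad (x.1 + n + 1))
  let g : ℕ → ENNReal := fun q => ENNReal.ofReal (2 ^ m * 2 ^ d * (q : ℝ) ^ (m - (1 + c) * d))
  have hdiam : ∀ n x, Metric.ediam (B n x) ≤ ENNReal.ofReal (2 * rad (x.1 + n + 1)) := by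
    intro n x
    rw [ENNReal.ofReal_mul (by norm_num), ENNReal.ofReal_ofNat]
    dsimp only [B]
    rw [← Metric.closedEBall_ofReal (Real.rpow_nonneg (Nat.cast_nonneg _) _)]
    exact Metric.ediam_closedEBall_le
  have hlim : Filter.Tendsto (fun n : ℕ => ENNReal.ofReal (2 * rad (n + 1))) Filter.atTop
      (nhds 0) := by
    have h1 : Filter.Tendsto (fun n : ℕ => 2 * rad (n + 1)) Filter.atTop (nhds (2 * 0)) :=
      (((tendsto_rpow_neg_atTop (y := 1 + c) (by linarith)).comp
        (tendsto_natCast_atTop_atTop (R := ℝ))).comp (Filter.tendsto_add_atTop_nat 1)).const_mul 2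
    simpa using ENNReal.tendsto_ofReal h1
  have hcover : ∀ n : ℕ, (approxSet m fun q _ => (q : ℝ) ^ (-c)) ⊆ ⋃ x, B n x := by
    rintro n x ⟨hx, hinf⟩
    obtain ⟨q, ⟨hq0, p, hp⟩, hq⟩ := hinf.exists_gt n
    obtain ⟨k, rfl⟩ : ∃ k, q = k + n + 1 := ⟨q - n - 1, by omega⟩
    set q : ℕ := k + n + 1
    have hq1 : (1 : ℝ) ≤ q := by exact_mod_cast hq0
    have hqc : (q : ℝ) ^ (-c) ≤ 1 := Real.rpow_le_one_of_one_le_of_nonpos hq1 (by linarith)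
    have hp0 : ∀ i, 0 ≤ p i ∧ p i ≤ q := by
      intro i
      have h1 := abs_lt.1 (hp i)
      have h2 := hx i
      have h3 : (0 : ℝ) ≤ q * x i := mul_nonneg (by linarith) h2.1
      have h4 : (q : ℝ) * x i ≤ q := mul_le_of_le_one_right (by linarith) h2.2
      have h5 : (-1 : ℝ) < p i := by linarith
      have h6 : (p i : ℝ) < q + 1 := by linarith
      have h5' : (-1 : ℤ) < p i := by exact_mod_cast h5
      have h6' : p i < (q : ℤ) + 1 := by exact_mod_cast h6
      omega
    refine mem_iUnion.2 ⟨⟨k, fun i => ⟨(p i).toNat, by have := hp0 i; omega⟩⟩, ?_⟩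
    have hq0' : (0 : ℝ) < q := by linarith
    refine (dist_pi_le_iff (Real.rpow_nonneg hq0'.le _)).2 fun i => ?_
    have h7 : (((p i).toNat : ℕ) : ℝ) = p i := by exact_mod_cast Int.toNat_of_nonneg (hp0 i).1
    simp only [h7]
    rw [Real.dist_eq, neg_add, Real.rpow_add hq0', Real.rpow_neg_one, inv_mul_eq_div,
      le_div_iff₀ hq0', ← abs_of_pos hq0', ← abs_mul, abs_of_pos hq0', sub_mul,
      div_mul_cancel₀ _ hq0'.ne', mul_comm]
    exact (hp i).le
  have hsum : ∀ n : ℕ, ∑' x, Metric.ediam (B n x) ^ d ≤ ∑' q, g q := by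
    intro n
    rw [ENNReal.tsum_sigma']
    refine le_trans (ENNReal.tsum_le_tsum fun k => ?_)
      (ENNReal.tsum_comp_le_tsum_of_injective (f := fun k : ℕ => k + n + 1)
        (fun a b hab => by simpa using hab) g)
    have hq0 : (0 : ℝ) < (k + n + 1 : ℕ) := by exact_mod_cast Nat.succ_pos _
    have hq1 : (1 : ℝ) ≤ (k + n + 1 : ℕ) := by exact_mod_cast Nat.succ_pos _
    have hr0 : 0 < rad (k + n + 1) := Real.rpow_pos_of_pos hq0 _
    calc ∑' p, Metric.ediam (B n ⟨k, p⟩) ^ d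
        ≤ ∑' _ : Fin m → Fin (k + n + 2), ENNReal.ofReal ((2 * rad (k + n + 1)) ^ d) := by
          refine ENNReal.tsum_le_tsum fun p => ?_
          rw [← ENNReal.ofReal_rpow_of_pos (by positivity)]
          exact ENNReal.rpow_le_rpow (hdiam n ⟨k, p⟩) hd.le
      _ = ENNReal.ofReal (((k + n + 2 : ℕ) : ℝ) ^ m * (2 * rad (k + n + 1)) ^ d) := by
          rw [tsum_fintype, Finset.sum_const, Finset.card_univ, Fintype.card_fun, Fintype.card_fin,
            Fintype.card_fin, nsmul_eq_mul, ENNReal.ofReal_mul (by positivity), ← Nat.cast_pow,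
            ENNReal.ofReal_natCast]
      _ ≤ g (k + n + 1) := by
          refine ENNReal.ofReal_le_ofReal ?_
          have h2 : ((k + n + 2 : ℕ) : ℝ) ≤ 2 * (k + n + 1 : ℕ) := by
            push_cast at hq1 ⊢
            linarith
          have h3 : rad (k + n + 1) ^ d = ((k + n + 1 : ℕ) : ℝ) ^ (-((1 + c) * d)) := by
            rw [← neg_mul, Real.rpow_mul hq0.le]
          rw [Real.mul_rpow (by norm_num) hr0.le, h3, sub_eq_add_neg, Real.rpow_add hq0,
            Real.rpow_natCast]
          calc _ ≤ (2 * ((k + n + 1 : ℕ) : ℝ)) ^ m *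
                (2 ^ d * ((k + n + 1 : ℕ) : ℝ) ^ (-((1 + c) * d))) := by gcongr
            _ = _ := by rw [mul_pow]; ring
  have hg : ∑' q, g q ≠ ⊤ :=
    ((Real.summable_nat_rpow.2 (by linarith)).mul_left _).tsum_ofReal_ne_top
  have hH := Measure.hausdorffMeasure_le_liminf_tsum d (approxSet m fun q _ => (q : ℝ) ^ (-c))
    (l := Filter.atTop) _ hlim B
    (Filter.Eventually.of_forall fun n x => (hdiam n x).trans (ENNReal.ofReal_le_ofReal
      (mul_le_mul_of_nonneg_left (Real.rpow_le_rpow_of_nonpos (by positivity)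
        (by push_cast; linarith [Nat.cast_nonneg (α := ℝ) x.1]) (by linarith)) (by norm_num))))
    (Filter.Eventually.of_forall hcover)
  have hle := hH.trans ((Filter.liminf_le_liminf (Filter.Eventually.of_forall hsum)).trans_eq
    (Filter.liminf_const _))
  refine dimH_le_of_hausdorffMeasure_ne_top (d := d.toNNReal) ?_
  rw [Real.coe_toNNReal d hd.le]
  exact ne_top_of_le_ne_top hg hle

/-- Bandi–De Saxcé: for constant weights `τ1 = ⋯ = τm = c > 1/m`,
`dim_H E_m(Ψ_τ) = dim_H A_m(Ψ_τ) = (m+1)/(1+c)`. -/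
theorem stmt15 (m : ℕ) (hm : 1 ≤ m) (c : ℝ) (hc : 1 / (m : ℝ) < c)
    (τ : Fin m → ℝ) (hτ : ∀ i, τ i = c) :
    dimH (exactSet m (psiTau m τ)) = ENNReal.ofReal (((m : ℝ) + 1) / (1 + c)) ∧
    dimH (approxSet m (psiTau m τ)) = ENNReal.ofReal (((m : ℝ) + 1) / (1 + c)) := by
  have hm0 : (0 : ℝ) < m := by exact_mod_cast hm
  have hc0 : 0 < c := lt_trans (by positivity) hc
  have hs : 0 < ((m : ℝ) + 1) / (1 + c) := by positivity
  have hψ : psiTau m τ = fun (q : ℕ) _ => (q : ℝ) ^ (-c) := by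
    funext q i
    rw [psiTau, hτ]
  rw [hψ]
  have hmono : dimH (exactSet m fun q _ => (q : ℝ) ^ (-c)) ≤
      dimH (approxSet m fun q _ => (q : ℝ) ^ (-c)) := dimH_mono sdiff_subset
  have hupper : dimH (approxSet m fun q _ => (q : ℝ) ^ (-c)) ≤
      ENNReal.ofReal (((m : ℝ) + 1) / (1 + c)) := by
    refine ge_of_tendsto ((ENNReal.continuous_ofReal.tendsto _).mono_left nhdsWithin_le_nhds) ?_
      (x := nhdsWithin (((m : ℝ) + 1) / (1 + c)) (Ioi (((m : ℝ) + 1) / (1 + c))))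
    filter_upwards [self_mem_nhdsWithin] with d hd
    exact dimH_approxSet_le hc0.le (hs.trans hd) hd
  have hlower : ENNReal.ofReal (((m : ℝ) + 1) / (1 + c)) ≤
      dimH (exactSet m fun q _ => (q : ℝ) ^ (-c)) := by
    refine le_of_tendsto ((ENNReal.continuous_ofReal.tendsto _).mono_left nhdsWithin_le_nhds) ?_
      (x := nhdsWithin (((m : ℝ) + 1) / (1 + c)) (Iio (((m : ℝ) + 1) / (1 + c))))
    filter_upwards [Ioo_mem_nhdsLT hs] with d hd
    exact le_dimH_exactSet hm hc hd.1 hd.2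
  exact ⟨le_antisymm (hmono.trans hupper) hlower, le_antisymm hupper (hlower.trans hmono)⟩
end
end

section
/- (Schmidt) Let m ≥ 1 and τ = (τ1, …, τm) ∈ ℝ_{≥0}^m with τ1 + ⋯ + τm = 1. Then dim_H B_m(Ψ_τ) = m. -/
open MeasureTheory Set

noncomputable section

/-- The matrix of the shear `(q, p) ↦ (q, p - q x)` acting on row vectors. -/
def shearMatrix {m : ℕ} (x : Fin m → ℝ) : Matrix (Fin (m + 1)) (Fin (m + 1)) ℝ :=
  Matrix.of (Fin.cons (Fin.cons 1 fun i => -x i) fun i => Fin.cons 0 (Pi.single i 1))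

lemma vecMul_shearMatrix_zero {m : ℕ} (x : Fin m → ℝ) (v : Fin (m + 1) → ℝ) :
    Matrix.vecMul v (shearMatrix x) 0 = v 0 := by
  simp [shearMatrix, Matrix.vecMul, dotProduct, Fin.sum_univ_succ]

lemma vecMul_shearMatrix_succ {m : ℕ} (x : Fin m → ℝ) (v : Fin (m + 1) → ℝ) (i : Fin m) :
    Matrix.vecMul v (shearMatrix x) i.succ = v i.succ - v 0 * x i := by
  simp [shearMatrix, Matrix.vecMul, dotProduct, Fin.sum_univ_succ, Pi.single_apply]
  ring

lemma det_shearMatrix {m : ℕ} (x : Fin m → ℝ) : (shearMatrix x).det = 1 := by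
  rw [Matrix.det_of_isUpperTriangular]
  · simp [Fin.prod_univ_succ, shearMatrix]
  · intro i j hij
    induction i using Fin.cases with
    | zero => simp at hij
    | succ i =>
      induction j using Fin.cases with
      | zero => simp [shearMatrix]
      | succ j =>
        have : j ≠ i := by rintro rfl; simp at hij
        simp [shearMatrix, this]

/-- The weighted Dirichlet theorem, with strict inequalities. -/
lemma exists_weighted_dirichlet {m : ℕ} (τ : Fin m → ℝ) (hτ : ∀ i, 0 ≤ τ i)
    (hσ : ∑ i, τ i = 1) (x : Fin m → ℝ) (Q : ℕ) (hQ : 0 < Q) :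
    ∃ q : ℕ, 0 < q ∧ q ≤ Q ∧ ∃ p : Fin m → ℤ,
      ∀ i, |(q : ℝ) * x i - p i| < (Q : ℝ) ^ (-τ i) := by
  have hQ' : (0 : ℝ) < Q := by exact_mod_cast hQ
  have hQ1 : (1 : ℝ) ≤ Q := by exact_mod_cast hQ
  set b : Fin (m + 1) → ℝ := Fin.cons ((Q : ℝ) + 1) fun i => (Q : ℝ) ^ (-τ i) with hb
  have hbpos : ∀ i, 0 < b i := by
    intro i
    induction i using Fin.cases with
    | zero => simp [hb]; positivity
    | succ i => simp [hb]; positivity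
  have hprod : ∏ i, b i = (Q + 1) / Q := by
    rw [Fin.prod_univ_succ]
    simp only [hb, Fin.cons_zero, Fin.cons_succ]
    rw [← Real.rpow_sum_of_pos hQ', Finset.sum_neg_distrib, hσ, Real.rpow_neg_one]
    rfl
  set f : (Fin (m + 1) → ℝ) →ₗ[ℝ] (Fin (m + 1) → ℝ) := Matrix.toLin' (shearMatrix x).transpose
  have hf : ∀ v, f v = Matrix.vecMul v (shearMatrix x) := fun v => by
    simp [f, Matrix.toLin'_apply, Matrix.mulVec_transpose]
  have hdet : LinearMap.det f = 1 := by
    simp [f, LinearMap.det_toLin', det_shearMatrix]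
  set s := f ⁻¹' (Set.univ.pi fun i => Ioo (-b i) (b i)) with hs
  have hsymm : ∀ v ∈ s, -v ∈ s := by
    intro v hv
    simp only [hs, mem_preimage, mem_univ_pi, mem_Ioo, map_neg, Pi.neg_apply] at hv ⊢
    intro i
    constructor <;> linarith [(hv i).1, (hv i).2]
  have hconv : Convex ℝ s :=
    (convex_pi fun i _ => convex_Ioo _ _).linear_preimage f
  have hvol : volume s = ENNReal.ofReal (2 ^ (m + 1) * ((Q + 1) / Q)) := by
    rw [hs, Measure.addHaar_preimage_linearMap _ (by rw [hdet]; exact one_ne_zero), hdet,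
      Real.volume_pi_Ioo, ← ENNReal.ofReal_prod_of_nonneg]
    · rw [← hprod]
      simp only [sub_neg_eq_add, ← two_mul, Finset.prod_mul_distrib]
      simp
    · intro i _
      linarith [hbpos i]
  have : Countable (Submodule.span ℤ
      (Set.range (Pi.basisFun ℝ (Fin (m + 1))))).toAddSubgroup :=
    inferInstanceAs (Countable (Submodule.span ℤ (Set.range (Pi.basisFun ℝ (Fin (m + 1))))))
  obtain ⟨⟨v, hv⟩, hv0, hvs⟩ := exists_ne_zero_mem_lattice_of_measure_mul_two_pow_lt_measure
    (μ := volume) (L := (Submodule.span ℤ (Set.range (Pi.basisFun ℝ (Fin (m + 1))))).toAddSubgroup)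
    (ZSpan.isAddFundamentalDomain (Pi.basisFun ℝ (Fin (m + 1))) volume) hsymm hconv (by
      rw [hvol, ZSpan.volume_fundamentalDomain]
      have : Matrix.of ⇑(Pi.basisFun ℝ (Fin (m + 1))) = 1 := by
        ext i j; simp [Matrix.one_apply, Pi.single_apply, eq_comm]
      rw [this]
      simp only [Matrix.det_one, abs_one, ENNReal.ofReal_one, one_mul, Module.finrank_fin_fun]
      rw [show (2 : ENNReal) ^ (m + 1) = ENNReal.ofReal (2 ^ (m + 1)) by
        rw [ENNReal.ofReal_pow (by norm_num)]; simp]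
      apply (ENNReal.ofReal_lt_ofReal_iff (by positivity)).2
      have : 1 < ((Q : ℝ) + 1) / Q := by rw [lt_div_iff₀ hQ']; linarith
      have h2 : (0 : ℝ) < 2 ^ (m + 1) := by positivity
      nlinarith)
  have hint : ∀ i, ∃ k : ℤ, (k : ℝ) = v i := by
    have := (Module.Basis.mem_span_iff_repr_mem ℤ (Pi.basisFun ℝ (Fin (m + 1))) v).1 hv
    simpa using this
  choose k hk using hint
  simp only [hs, mem_preimage, mem_univ_pi, hf] at hvs
  have h0 := hvs 0
  rw [vecMul_shearMatrix_zero, mem_Ioo, ← abs_lt, ← hk] at h0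
  have hsucc : ∀ i : Fin m, |(k i.succ : ℝ) - k 0 * x i| < (Q : ℝ) ^ (-τ i) := by
    intro i
    have := hvs i.succ
    rw [vecMul_shearMatrix_succ, mem_Ioo, ← abs_lt, ← hk, ← hk] at this
    simpa [hb] using this
  have hk0 : |k 0| ≤ Q := by
    have : (|k 0| : ℝ) < Q + 1 := by simpa [hb] using h0
    have : |k 0| < Q + 1 := by exact_mod_cast this
    omega
  have hk0' : k 0 ≠ 0 := by
    intro h
    apply hv0
    ext i
    change v i = 0
    rw [← hk]
    induction i using Fin.cases with
    | zero => simp [h]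
    | succ i =>
      have h1 := hsucc i
      have h2 : (Q : ℝ) ^ (-τ i) ≤ 1 :=
        Real.rpow_le_one_of_one_le_of_nonpos hQ1 (by linarith [hτ i])
      rw [h] at h1
      simp only [Int.cast_zero, zero_mul, sub_zero] at h1
      have h3 : |k i.succ| < 1 := by exact_mod_cast h1.trans_le h2
      simp [Int.abs_lt_one_iff.1 h3]
  refine ⟨(k 0).natAbs, Int.natAbs_pos.2 hk0',
    by rw [Int.abs_eq_natAbs] at hk0; omega, ?_⟩
  rcases le_total 0 (k 0) with h | h
  · refine ⟨fun i => k i.succ, fun i => ?_⟩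
    have : (((k 0).natAbs : ℕ) : ℝ) = k 0 := by
      rw [Nat.cast_natAbs, abs_of_nonneg h]
    rw [this, abs_sub_comm]
    exact hsucc i
  · refine ⟨fun i => -k i.succ, fun i => ?_⟩
    have : (((k 0).natAbs : ℕ) : ℝ) = -k 0 := by
      rw [Nat.cast_natAbs, abs_of_nonpos h]; push_cast; rfl
    rw [this]
    convert hsucc i using 2
    push_cast; ring

/-- Every point is approximable at the Dirichlet exponent, infinitely often. -/
lemma infinite_weighted_dirichlet {m : ℕ} (τ : Fin m → ℝ) (hτ : ∀ i, 0 ≤ τ i)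
    (hσ : ∑ i, τ i = 1) (x : Fin m → ℝ) :
    {q : ℕ | 0 < q ∧ ∃ p : Fin m → ℤ,
      ∀ i, |(q : ℝ) * x i - (p i : ℝ)| < (q : ℝ) ^ (-τ i)}.Infinite := by
  set S := {q : ℕ | 0 < q ∧ ∃ p : Fin m → ℤ,
      ∀ i, |(q : ℝ) * x i - (p i : ℝ)| < (q : ℝ) ^ (-τ i)} with hS
  intro hfin
  choose q hq0 hqQ p hp using fun Q : ℕ =>
    exists_weighted_dirichlet τ hτ hσ x (Q + 1) (Nat.succ_pos Q)
  have hqS : ∀ Q, q Q ∈ S := fun Q => ⟨hq0 Q, p Q, fun i => (hp Q i).trans_le <|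
    Real.rpow_le_rpow_of_nonpos (by exact_mod_cast hq0 Q) (by exact_mod_cast hqQ Q)
      (by linarith [hτ i])⟩
  have : Finite S := hfin
  obtain ⟨⟨q₀, hq₀⟩, hinf⟩ := Finite.exists_infinite_fiber fun Q : ℕ => (⟨q Q, hqS Q⟩ : S)
  have hfreq : ∃ᶠ Q in Filter.atTop, q Q = q₀ := by
    rw [Nat.frequently_atTop_iff_infinite]
    have := Set.infinite_coe_iff.1 hinf
    convert this using 1
    ext Q; simp
  have hq₀' : (0 : ℝ) < q₀ := by exact_mod_cast hq₀.1
  have hmul : ∀ k : ℕ, (k + 1) * q₀ ∈ S := by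
    intro k
    refine ⟨Nat.mul_pos k.succ_pos hq₀.1, ?_⟩
    suffices ∀ i, ∃ a : ℤ, |(((k + 1) * q₀ : ℕ) : ℝ) * x i - a| <
        (((k + 1) * q₀ : ℕ) : ℝ) ^ (-τ i) from Classical.skolem.1 this
    intro i
    rcases (hτ i).eq_or_lt with h | h
    · refine ⟨⌊(((k + 1) * q₀ : ℕ) : ℝ) * x i⌋, ?_⟩
      rw [← h, neg_zero, Real.rpow_zero, Int.self_sub_floor, Int.abs_fract]
      exact Int.fract_lt_one _
    · have hlim : Filter.Tendsto (fun Q : ℕ => ((k : ℝ) + 1) * (((Q + 1 : ℕ) : ℝ)) ^ (-τ i))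
          Filter.atTop (nhds (((k : ℝ) + 1) * 0)) :=
        (((tendsto_rpow_neg_atTop h).comp tendsto_natCast_atTop_atTop).comp
          (Filter.tendsto_add_atTop_nat 1)).const_mul _
      have hpos : (0 : ℝ) < (((k + 1) * q₀ : ℕ) : ℝ) ^ (-τ i) := by
        push_cast; positivity
      rw [mul_zero] at hlim
      obtain ⟨Q, hQ, hlt⟩ := (hfreq.and_eventually (hlim.eventually_lt_const hpos)).exists
      refine ⟨(k + 1) * p Q i, lt_of_le_of_lt ?_ hlt⟩
      have h1 := hp Q i
      rw [hQ] at h1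
      have : (((k + 1) * q₀ : ℕ) : ℝ) * x i - (((k : ℤ) + 1) * p Q i : ℤ) =
          ((k : ℝ) + 1) * (q₀ * x i - p Q i) := by push_cast; ring
      rw [this, abs_mul, abs_of_pos (by positivity : (0 : ℝ) < (k : ℝ) + 1)]
      gcongr
  refine Set.infinite_of_injective_forall_mem (f := fun k : ℕ => (k + 1) * q₀) ?_ hmul hfin
  intro k l hkl
  have := Nat.eq_of_mul_eq_mul_right hq₀.1 hkl
  omega

/-- The simplex lemma: integer vectors in a small sheared box lie in a hyperplane. -/
lemma exists_hyperplane_of_small_box {m : ℕ} (x : Fin m → ℝ) (b : Fin (m + 1) → ℝ)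
    (hb : ((m + 1).factorial : ℝ) * ∏ i, b i < 1) (S : Set (Fin (m + 1) → ℤ))
    (h0 : ∀ v ∈ S, |(v 0 : ℝ)| ≤ b 0)
    (hsucc : ∀ v ∈ S, ∀ i : Fin m, |(v i.succ : ℝ) - v 0 * x i| ≤ b i.succ) :
    ∃ a : Fin (m + 1) → ℝ, a ≠ 0 ∧ ∀ v ∈ S, ∑ i, a i * v i = 0 := by
  set S' : Set (Fin (m + 1) → ℝ) := (fun v i => (v i : ℝ)) '' S with hS'
  by_cases htop : Submodule.span ℝ S' = ⊤
  · exfalso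
    obtain ⟨t, htS, htspan, htli⟩ := exists_linearIndependent ℝ S'
    have hB : ⊤ ≤ Submodule.span ℝ (Set.range ((↑) : t → Fin (m + 1) → ℝ)) := by
      rw [Subtype.range_coe, htspan, htop]
    let B := Module.Basis.mk htli hB
    have e : t ≃ Fin (m + 1) := B.indexEquiv (Pi.basisFun ℝ _)
    have hmem : ∀ k, ∃ v ∈ S, (fun i => (v i : ℝ)) = (e.symm k : Fin (m + 1) → ℝ) :=
      fun k => htS (e.symm k).2
    choose v hvS hv using hmem
    let A : Matrix (Fin (m + 1)) (Fin (m + 1)) ℤ := Matrix.of v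
    have hli : LinearIndependent ℝ fun k => (fun i => (v k i : ℝ)) := by
      rw [show (fun k => fun i => (v k i : ℝ)) = fun k => ((e.symm k : t) : Fin (m + 1) → ℝ) from
        funext hv]
      exact htli.comp _ e.symm.injective
    have hne : (A.map (Int.castRingHom ℝ)).det ≠ 0 := by
      have h1 : IsUnit (A.map (Int.castRingHom ℝ)) := by
        rw [← Matrix.linearIndependent_rows_iff_isUnit]
        exact hli
      exact ((Matrix.isUnit_iff_isUnit_det _).1 h1).ne_zero
    have hdet : (A.map (Int.castRingHom ℝ)).det = (A.det : ℝ) := by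
      exact ((Int.castRingHom ℝ).map_det A).symm
    have hge : (1 : ℝ) ≤ |(A.map (Int.castRingHom ℝ)).det| := by
      rw [hdet] at hne ⊢
      have : A.det ≠ 0 := by exact_mod_cast hne
      exact_mod_cast Int.one_le_abs this
    have hle : |(A.map (Int.castRingHom ℝ) * shearMatrix x).det| ≤
        ((m + 1).factorial : ℝ) * ∏ i, b i := by
      rw [Matrix.det_apply]
      refine (Finset.abs_sum_le_sum_abs _ _).trans ?_
      have hterm : ∀ σ ∈ (Finset.univ : Finset (Equiv.Perm (Fin (m + 1)))),
          |Equiv.Perm.sign σ • ∏ i, (A.map (Int.castRingHom ℝ) * shearMatrix x) (σ i) i| ≤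
            ∏ i, b i := by
        intro σ _
        have : ∀ (u : ℤˣ) (y : ℝ), |u • y| = |y| := by
          intro u y
          rcases Int.units_eq_one_or u with rfl | rfl <;> simp
        rw [this, Finset.abs_prod]
        refine Finset.prod_le_prod (fun _ _ => abs_nonneg _) fun i _ => ?_
        rw [Matrix.mul_apply_eq_vecMul]
        induction i using Fin.cases with
        | zero => rw [vecMul_shearMatrix_zero]; exact h0 _ (hvS _)
        | succ i => rw [vecMul_shearMatrix_succ]; exact hsucc _ (hvS _) i
      refine (Finset.sum_le_card_nsmul _ _ _ hterm).trans ?_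
      simp [Finset.card_univ, Fintype.card_perm]
    rw [Matrix.det_mul, det_shearMatrix, mul_one] at hle
    linarith
  · obtain ⟨f, hf0, hf⟩ := Submodule.exists_le_ker_of_lt_top _ (lt_top_iff_ne_top.2 htop)
    refine ⟨fun i => f (Pi.single i 1), ?_, ?_⟩
    · intro h
      apply hf0
      refine (Pi.basisFun ℝ (Fin (m + 1))).ext fun i => ?_
      simpa using congrFun h i
    · intro v hv
      have h1 : f (fun i => (v i : ℝ)) = 0 :=
        hf (Submodule.subset_span ⟨v, hv, rfl⟩)
      rw [f.pi_apply_eq_sum_univ] at h1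
      rw [← h1]
      refine Finset.sum_congr rfl fun i _ => ?_
      rw [smul_eq_mul, mul_comm]
      congr 1
      refine congrArg f (funext fun j => ?_)
      simp [Pi.single_apply, eq_comm]

/-- A slab around a hyperplane contains at most half of the points of a large integer grid. -/
lemma two_mul_card_slab_le {m : ℕ} (N : Fin m → ℕ) (hN : ∀ i, 2 * (4 * m + 1) ≤ N i)
    (a₀ : ℝ) (a : Fin m → ℝ) (ha : a ≠ 0) (B : Finset (∀ i, Fin (N i)))
    (hB : ∀ j ∈ B, |a₀ + ∑ i, a i * ((j i : ℕ) : ℝ)| ≤ 2 * ∑ i, |a i|) :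
    2 * B.card ≤ ∏ i, N i := by
  obtain ⟨k₀, hk₀⟩ := Function.ne_iff.1 ha
  have : Nonempty (Fin m) := ⟨k₀⟩
  obtain ⟨k, hk⟩ := Finite.exists_max fun i => |a i|
  have hakpos : 0 < |a k| := (abs_pos.2 hk₀).trans_le (hk k₀)
  have hsum : ∑ i, |a i| ≤ m * |a k| := by
    refine (Finset.sum_le_card_nsmul _ _ _ fun i _ => hk i).trans ?_
    simp
  let r : (∀ i, Fin (N i)) → ∀ i : {i // i ≠ k}, Fin (N i) := fun j i => j i
  have hclose : ∀ j ∈ B, ∀ j' ∈ B, r j = r j' → (j' k : ℕ) ≤ (j k : ℕ) + 4 * m := by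
    intro j hj j' hj' hr
    have hdiff : (a₀ + ∑ i, a i * ((j' i : ℕ) : ℝ)) - (a₀ + ∑ i, a i * ((j i : ℕ) : ℝ)) =
        a k * (((j' k : ℕ) : ℝ) - ((j k : ℕ) : ℝ)) := by
      rw [add_sub_add_left_eq_sub, ← Finset.sum_sub_distrib, Finset.sum_eq_single k]
      · ring
      · intro i _ hik
        have : j i = j' i := congrFun hr ⟨i, hik⟩
        rw [this, sub_self]
      · simp
    have h1 : |a k| * (((j' k : ℕ) : ℝ) - ((j k : ℕ) : ℝ)) ≤ |a k| * (4 * m) := by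
      calc |a k| * (((j' k : ℕ) : ℝ) - ((j k : ℕ) : ℝ))
          ≤ |a k * (((j' k : ℕ) : ℝ) - ((j k : ℕ) : ℝ))| := by
            rw [abs_mul]; gcongr; exact le_abs_self _
        _ ≤ _ := by
            rw [← hdiff]
            refine (abs_sub _ _).trans ?_
            linarith [hB j hj, hB j' hj']
    have h2 := le_of_mul_le_mul_left h1 hakpos
    have h3 : ((j' k : ℕ) : ℝ) ≤ ((j k : ℕ) : ℝ) + 4 * m := by linarith
    exact_mod_cast h3
  have hfib : ∀ s ∈ (Finset.univ : Finset (∀ i : {i // i ≠ k}, Fin (N i))),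
      (B.filter fun j => r j = s).card ≤ 4 * m + 1 := by
    intro s _
    set F := B.filter fun j => r j = s with hF
    rcases F.eq_empty_or_nonempty with h | h
    · simp [h]
    obtain ⟨j₀, hj₀, hmin⟩ := F.exists_min_image (fun j => (j k : ℕ)) h
    have hcard : F.card ≤ (Finset.Icc (j₀ k : ℕ) ((j₀ k : ℕ) + 4 * m)).card := by
      refine Finset.card_le_card_of_injOn (fun j => (j k : ℕ)) ?_ ?_
      · intro j hj
        have hj' := Finset.mem_filter.1 (Finset.mem_coe.1 hj)
        have hj₀' := Finset.mem_filter.1 hj₀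
        simp only [Finset.coe_Icc, mem_Icc]
        exact ⟨hmin j hj, hclose j₀ hj₀'.1 j hj'.1 (hj₀'.2.trans hj'.2.symm)⟩
      · intro j hj j' hj' hjj
        have hj1 := Finset.mem_filter.1 (Finset.mem_coe.1 hj)
        have hj2 := Finset.mem_filter.1 (Finset.mem_coe.1 hj')
        funext i
        by_cases hik : i = k
        · subst hik; exact Fin.ext hjj
        · exact congrFun (hj1.2.trans hj2.2.symm) ⟨i, hik⟩
    refine hcard.trans ?_
    simp
    omega
  have h1 : B.card ≤ (4 * m + 1) *
      (Finset.univ : Finset (∀ i : {i // i ≠ k}, Fin (N i))).card :=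
    Finset.card_le_mul_card_image_of_maps_to (fun j _ => Finset.mem_univ (r j)) _ hfib
  have h2 : ∏ i, N i = N k * (Finset.univ : Finset (∀ i : {i // i ≠ k}, Fin (N i))).card := by
    have := Fintype.card_congr (Equiv.piSplitAt k fun i => Fin (N i))
    simpa [Finset.card_univ] using this
  rw [h2]
  calc 2 * B.card ≤ 2 * ((4 * m + 1) * _) := Nat.mul_le_mul_left 2 h1
    _ = (2 * (4 * m + 1)) * _ := (mul_assoc _ _ _).symm
    _ ≤ _ := Nat.mul_le_mul_right _ (hN k)

/-- The side length in direction `i` of a box of generation `n`. -/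
def sideLen {m : ℕ} (τ : Fin m → ℝ) (R : ℝ) (n : ℕ) (i : Fin m) : ℝ :=
  (R ^ n) ^ (-(1 + τ i))

/-- The corner of the child with index `j` of the box of generation `n` with corner `z`. -/
def childCorner {m : ℕ} (τ : Fin m → ℝ) (R : ℝ) {N : Fin m → ℕ} (n : ℕ) (z : Fin m → ℝ)
    (j : ∀ i, Fin (N i)) : Fin m → ℝ :=
  fun i => z i + (j i : ℕ) * sideLen τ R (n + 1) i

/-- The box with corner `z` of generation `n`. -/
def cornerBox {m : ℕ} (τ : Fin m → ℝ) (R : ℝ) (n : ℕ) (z : Fin m → ℝ) : Set (Fin m → ℝ) :=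
  {x | ∀ i, z i ≤ x i ∧ x i ≤ z i + sideLen τ R n i}

/-- The box of generation `n + 1` with corner `z` avoids the neighbourhoods of all rational points
whose denominator `q` satisfies `R ^ (n - 2) ≤ q < R ^ (n - 1)`. -/
def IsSafe {m : ℕ} (τ : Fin m → ℝ) (R : ℝ) (n : ℕ) (z : Fin m → ℝ) : Prop :=
  ∀ q : ℕ, R ^ n ≤ q * R ^ 2 → q * R ^ 2 < R ^ (n + 1) → ∀ p : Fin m → ℤ,
    ∀ x ∈ cornerBox τ R (n + 1) z, ∃ i, (R ^ 6)⁻¹ * (q : ℝ) ^ (-τ i) ≤ |(q : ℝ) * x i - p i|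

lemma sideLen_pos {m : ℕ} (τ : Fin m → ℝ) {R : ℝ} (hR : 0 < R) (n : ℕ) (i : Fin m) :
    0 < sideLen τ R n i := by
  unfold sideLen; positivity

lemma sideLen_succ {m : ℕ} (τ : Fin m → ℝ) {R : ℝ} (hR : 0 < R) (n : ℕ) (i : Fin m) :
    sideLen τ R (n + 1) i = sideLen τ R n i * R ^ (-(1 + τ i)) := by
  unfold sideLen
  rw [pow_succ, Real.mul_rpow (by positivity) hR.le]

lemma sideLen_eq {m : ℕ} (τ : Fin m → ℝ) {R : ℝ} (hR : 0 < R) (n : ℕ) (i : Fin m) :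
    sideLen τ R n i = (R ^ n)⁻¹ * (R ^ n) ^ (-τ i) := by
  unfold sideLen
  rw [neg_add, Real.rpow_add (by positivity), Real.rpow_neg_one]

lemma cornerBox_childCorner_subset {m : ℕ} (τ : Fin m → ℝ) {R : ℝ} (hR : 0 < R)
    {N : Fin m → ℕ} (hN : ∀ i, (N i : ℝ) ≤ R ^ (1 + τ i)) (n : ℕ) (z : Fin m → ℝ)
    (j : ∀ i, Fin (N i)) :
    cornerBox τ R (n + 1) (childCorner τ R n z j) ⊆ cornerBox τ R n z := by
  intro x hx i
  have hpos := sideLen_pos τ hR (n + 1) i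
  have h1 : z i + (j i : ℕ) * sideLen τ R (n + 1) i ≤ x i := (hx i).1
  have h2 : x i ≤ z i + (j i : ℕ) * sideLen τ R (n + 1) i + sideLen τ R (n + 1) i := (hx i).2
  have h3 : ((j i : ℕ) : ℝ) + 1 ≤ R ^ (1 + τ i) := by
    refine le_trans ?_ (hN i)
    exact_mod_cast (j i).2
  have h4 : R ^ (1 + τ i) * sideLen τ R (n + 1) i = sideLen τ R n i := by
    rw [sideLen_succ τ hR, mul_left_comm, ← Real.rpow_add hR]
    simp
  have h5 : (((j i : ℕ) : ℝ) + 1) * sideLen τ R (n + 1) i ≤ sideLen τ R n i := by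
    rw [← h4]; gcongr
  have h6 : 0 ≤ ((j i : ℕ) : ℝ) * sideLen τ R (n + 1) i := by positivity
  constructor <;> linarith

lemma rpow_neg_denominator_le {t R q : ℝ} (ht : 0 ≤ t) (ht1 : t ≤ 1) (hR : 1 ≤ R) (n : ℕ)
    (hq : R ^ n ≤ q * R ^ 2) : q ^ (-t) ≤ R ^ 2 * (R ^ n) ^ (-t) := by
  have hR0 : 0 < R := by linarith
  have h1 : R ^ n / R ^ 2 ≤ q := (div_le_iff₀ (by positivity)).2 hq
  calc q ^ (-t) ≤ (R ^ n / R ^ 2) ^ (-t) :=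
        Real.rpow_le_rpow_of_nonpos (by positivity) h1 (by linarith)
    _ = (R ^ 2) ^ t * (R ^ n) ^ (-t) := by
        rw [Real.div_rpow (by positivity) (by positivity), Real.rpow_neg (x := R ^ 2)
          (by positivity), div_inv_eq_mul, mul_comm]
    _ ≤ R ^ 2 * (R ^ n) ^ (-t) := by
        gcongr
        calc (R ^ 2) ^ t ≤ (R ^ 2) ^ (1 : ℝ) :=
              Real.rpow_le_rpow_of_exponent_le (one_le_pow₀ hR) ht1
          _ = R ^ 2 := Real.rpow_one _

/-- At most half of the children of a box fail to be safe. -/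
lemma two_mul_card_not_isSafe_le {m : ℕ} (τ : Fin m → ℝ) (hτ : ∀ i, 0 ≤ τ i)
    (hσ : ∑ i, τ i = 1) {R : ℝ} (hR : 1 ≤ R) (hRm : ((m + 1).factorial : ℝ) * 2 ^ m < R)
    {N : Fin m → ℕ} (hN : ∀ i, (N i : ℝ) ≤ R ^ (1 + τ i)) (hN' : ∀ i, 2 * (4 * m + 1) ≤ N i)
    (n : ℕ) (z : Fin m → ℝ) (B : Finset (∀ i, Fin (N i)))
    (hB : ∀ j ∈ B, ¬ IsSafe τ R n (childCorner τ R n z j)) :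
    2 * B.card ≤ ∏ i, N i := by
  rcases B.eq_empty_or_nonempty with rfl | ⟨j₀, hj₀⟩
  · simp
  have hR0 : 0 < R := by linarith
  have hτ1 : ∀ i, τ i ≤ 1 := fun i =>
    hσ ▸ Finset.single_le_sum (fun i _ => hτ i) (Finset.mem_univ i)
  set X : ℝ := R ^ n with hX
  have hXpos : 0 < X := by positivity
  have hbad : ∀ j ∈ B, ∃ q : ℕ, ∃ p : Fin m → ℤ, ∃ x ∈ cornerBox τ R (n + 1)
      (childCorner τ R n z j), R ^ n ≤ q * R ^ 2 ∧ q * R ^ 2 < R ^ (n + 1) ∧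
        ∀ i, |(q : ℝ) * x i - p i| < (R ^ 6)⁻¹ * (q : ℝ) ^ (-τ i) := by
    intro j hj
    have := hB j hj
    unfold IsSafe at this
    push Not at this
    obtain ⟨q, hq1, hq2, p, x, hx, h⟩ := this
    exact ⟨q, p, x, hx, hq1, hq2, h⟩
  set S : Set (Fin (m + 1) → ℤ) := {v | ∃ q : ℕ, ∃ p : Fin m → ℤ, v = Fin.cons (q : ℤ) p ∧
    ∃ x ∈ cornerBox τ R n z, R ^ n ≤ q * R ^ 2 ∧ q * R ^ 2 < R ^ (n + 1) ∧
        ∀ i, |(q : ℝ) * x i - p i| < (R ^ 6)⁻¹ * (q : ℝ) ^ (-τ i)} with hS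
  set b : Fin (m + 1) → ℝ := Fin.cons (X / R) fun i => 2 / R * X ^ (-τ i) with hb
  have hbprod : ((m + 1).factorial : ℝ) * ∏ i, b i < 1 := by
    rw [Fin.prod_univ_succ]
    simp only [hb, Fin.cons_zero, Fin.cons_succ]
    rw [Finset.prod_mul_distrib, ← Real.rpow_sum_of_pos hXpos, Finset.sum_neg_distrib, hσ,
      Real.rpow_neg_one, Finset.prod_const, Finset.card_univ, Fintype.card_fin, div_pow]
    have hRm1 : 1 ≤ R ^ m := one_le_pow₀ hR
    calc ((m + 1).factorial : ℝ) * (X / R * (2 ^ m / R ^ m * X⁻¹))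
        = (((m + 1).factorial : ℝ) * 2 ^ m / R) / R ^ m := by field_simp
      _ ≤ (((m + 1).factorial : ℝ) * 2 ^ m / R) := div_le_self (by positivity) hRm1
      _ < 1 := (div_lt_one hR0).2 hRm
  have hqle : ∀ q : ℕ, q * R ^ 2 < R ^ (n + 1) → (q : ℝ) ≤ X / R := by
    intro q hq
    rw [le_div_iff₀ hR0]
    refine le_of_mul_le_mul_right ?_ hR0
    have : q * R ^ 2 < X * R := by rwa [hX, ← pow_succ]
    nlinarith
  obtain ⟨a, ha0, ha⟩ := exists_hyperplane_of_small_box z b hbprod S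
    (by
      rintro v ⟨q, p, rfl, x, hx, hq1, hq2, h⟩
      simpa [hb] using hqle q hq2)
    (by
      rintro v ⟨q, p, rfl, x, hx, hq1, hq2, h⟩ i
      simp only [hb, Fin.cons_zero, Fin.cons_succ, Int.cast_natCast]
      have h1 := h i
      have h2 := rpow_neg_denominator_le (hτ i) (hτ1 i) hR n hq1
      have h3 : (q : ℝ) * |x i - z i| ≤ (X / R) * (X⁻¹ * X ^ (-τ i)) := by
        refine mul_le_mul (hqle q hq2) ?_ (abs_nonneg _) (by positivity)
        rw [abs_of_nonneg (by linarith [(hx i).1]), ← sideLen_eq τ hR0]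
        linarith [(hx i).2]
      have h4 : (R ^ 6)⁻¹ * (q : ℝ) ^ (-τ i) ≤ R⁻¹ * X ^ (-τ i) := by
        calc (R ^ 6)⁻¹ * (q : ℝ) ^ (-τ i) ≤ (R ^ 6)⁻¹ * (R ^ 2 * X ^ (-τ i)) := by gcongr
          _ = (R ^ 4)⁻¹ * X ^ (-τ i) := by field_simp
          _ ≤ R⁻¹ * X ^ (-τ i) := by
            gcongr
            exact le_self_pow₀ hR (by norm_num)
      have h5 : (X / R) * (X⁻¹ * X ^ (-τ i)) = R⁻¹ * X ^ (-τ i) := by field_simp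
      calc |(p i : ℝ) - q * z i| = |-(q * x i - p i) + q * (x i - z i)| := by
            congr 1; ring
        _ ≤ |(q : ℝ) * x i - p i| + q * |x i - z i| := by
            refine (abs_add_le _ _).trans ?_
            rw [abs_neg, abs_mul, Nat.abs_cast]
        _ ≤ R⁻¹ * X ^ (-τ i) + R⁻¹ * X ^ (-τ i) := by linarith
        _ = 2 / R * X ^ (-τ i) := by ring)
  have hvanish : ∀ (q : ℕ) (p : Fin m → ℤ), (Fin.cons (q : ℤ) p : Fin (m + 1) → ℤ) ∈ S →
      a 0 * q + ∑ i : Fin m, a i.succ * p i = 0 := by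
    intro q p h
    simpa [Fin.sum_univ_succ] using ha _ h
  have hmemS : ∀ j : ∀ i, Fin (N i), ∀ (q : ℕ) (p : Fin m → ℤ),
      ∀ x ∈ cornerBox τ R (n + 1) (childCorner τ R n z j), R ^ n ≤ q * R ^ 2 →
      q * R ^ 2 < R ^ (n + 1) →
      (∀ i, |(q : ℝ) * x i - p i| < (R ^ 6)⁻¹ * (q : ℝ) ^ (-τ i)) →
      (Fin.cons (q : ℤ) p : Fin (m + 1) → ℤ) ∈ S := fun j q p x hx h1 h2 h3 =>
    ⟨q, p, rfl, x, cornerBox_childCorner_subset τ hR0 hN n z j hx, h1, h2, h3⟩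
  have hqpos : ∀ q : ℕ, R ^ n ≤ q * R ^ 2 → (0 : ℝ) < q := by
    intro q hq
    by_contra hneg
    have : (q : ℝ) = 0 := le_antisymm (not_lt.1 hneg) (Nat.cast_nonneg q)
    rw [this, zero_mul] at hq
    linarith
  refine two_mul_card_slab_le N hN' (a 0 + ∑ i : Fin m, a i.succ * z i)
    (fun i => a i.succ * sideLen τ R (n + 1) i) ?_ B ?_
  · intro hzero
    have hsucc : ∀ i : Fin m, a i.succ = 0 := by
      intro i
      have := congrFun hzero i
      simpa [(sideLen_pos τ hR0 (n + 1) i).ne'] using this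
    obtain ⟨q, p, x, hx, h1, h2, h3⟩ := hbad j₀ hj₀
    have h4 := hvanish q p (hmemS j₀ q p x hx h1 h2 h3)
    simp only [hsucc, zero_mul, Finset.sum_const_zero, add_zero, mul_eq_zero,
      (hqpos q h1).ne', or_false] at h4
    apply ha0
    funext i
    induction i using Fin.cases with
    | zero => exact h4
    | succ i => exact hsucc i
  · intro j hj
    obtain ⟨q, p, x, hx, h1, h2, h3⟩ := hbad j hj
    have h4 := hvanish q p (hmemS j q p x hx h1 h2 h3)
    have hq0 := hqpos q h1
    have hy : a 0 + ∑ i : Fin m, a i.succ * (p i / q) = 0 := by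
      have : a 0 + ∑ i : Fin m, a i.succ * (p i / q) =
          (a 0 * q + ∑ i : Fin m, a i.succ * p i) / q := by
        rw [add_div, Finset.sum_div, mul_div_cancel_right₀ _ hq0.ne']
        simp only [mul_div_assoc]
      rw [this, h4, zero_div]
    have hdist : ∀ i, |childCorner τ R n z j i - p i / q| ≤ 2 * sideLen τ R (n + 1) i := by
      intro i
      have h5 := rpow_neg_denominator_le (hτ i) (hτ1 i) hR n h1
      have h6 : |x i - p i / q| ≤ sideLen τ R (n + 1) i := by
        have h7 : x i - p i / q = (q * x i - p i) / q := by field_simp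
        have h8 : (q : ℝ)⁻¹ ≤ R ^ 2 * X⁻¹ := by
          rw [inv_le_comm₀ hq0 (by positivity), mul_inv, inv_inv, inv_mul_eq_div,
            div_le_iff₀ (by positivity)]
          exact h1
        have h9 : (R ^ 2)⁻¹ ≤ R ^ (-(1 + τ i)) := by
          rw [← Real.rpow_natCast, ← Real.rpow_neg hR0.le]
          refine Real.rpow_le_rpow_of_exponent_le hR ?_
          push_cast
          linarith [hτ1 i]
        rw [h7, abs_div, abs_of_pos hq0, div_eq_mul_inv]
        calc |(q : ℝ) * x i - p i| * (q : ℝ)⁻¹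
            ≤ ((R ^ 6)⁻¹ * (R ^ 2 * X ^ (-τ i))) * (R ^ 2 * X⁻¹) := by
              gcongr
              exact (h3 i).le.trans (by gcongr)
          _ = (X⁻¹ * X ^ (-τ i)) * (R ^ 2)⁻¹ := by field_simp
          _ ≤ (X⁻¹ * X ^ (-τ i)) * R ^ (-(1 + τ i)) := by gcongr
          _ = sideLen τ R (n + 1) i := by
              rw [sideLen_succ τ hR0, sideLen_eq τ hR0]
      have h10 := hx i
      rw [abs_le] at h6 ⊢
      constructor <;> linarith [h6.1, h6.2, h10.1, h10.2]
    have heq : a 0 + ∑ i : Fin m, a i.succ * z i +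
        ∑ i : Fin m, a i.succ * sideLen τ R (n + 1) i * ((j i : ℕ) : ℝ) =
        ∑ i : Fin m, a i.succ * (childCorner τ R n z j i - p i / q) := by
      rw [← sub_zero (a 0 + _ + _), ← hy, add_assoc, add_sub_add_left_eq_sub,
        ← Finset.sum_add_distrib, ← Finset.sum_sub_distrib]
      refine Finset.sum_congr rfl fun i _ => ?_
      unfold childCorner
      ring
    rw [heq]
    refine (Finset.abs_sum_le_sum_abs _ _).trans ?_
    rw [Finset.mul_sum]
    refine Finset.sum_le_sum fun i _ => ?_
    rw [abs_mul, abs_mul, abs_of_pos (sideLen_pos τ hR0 (n + 1) i)]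
    nlinarith [hdist i, abs_nonneg (a i.succ)]

/-- The corner of the box of generation `n` coded by the word `ω`, the children of a box being
numbered by `e`. -/
def codeCorner {m M : ℕ} (τ : Fin m → ℝ) (R : ℝ) {N : Fin m → ℕ}
    (e : ℕ → (Fin m → ℝ) → Fin M → ∀ i, Fin (N i)) (ω : ℕ → Fin M) : ℕ → Fin m → ℝ
  | 0 => 0
  | n + 1 => childCorner τ R n (codeCorner τ R e ω n) (e n (codeCorner τ R e ω n) (ω n))

/-- The point of the limit set coded by the word `ω`. -/
def codePoint {m M : ℕ} (τ : Fin m → ℝ) (R : ℝ) {N : Fin m → ℕ}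
    (e : ℕ → (Fin m → ℝ) → Fin M → ∀ i, Fin (N i)) (ω : ℕ → Fin M) : Fin m → ℝ :=
  fun i => ⨆ n, codeCorner τ R e ω n i

section Coding

variable {m M : ℕ} {τ : Fin m → ℝ} {R : ℝ} {N : Fin m → ℕ}
  {e : ℕ → (Fin m → ℝ) → Fin M → ∀ i, Fin (N i)}

lemma codeCorner_congr {ω ω' : ℕ → Fin M} {n : ℕ} (h : ∀ k < n, ω k = ω' k) :
    codeCorner τ R e ω n = codeCorner τ R e ω' n := by
  induction n with
  | zero => rfl
  | succ n ih =>
    simp only [codeCorner]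
    rw [ih fun k hk => h k (by omega), h n (by omega)]

lemma isLocallyConstant_codeCorner (n : ℕ) :
    IsLocallyConstant fun ω : ℕ → Fin M => codeCorner τ R e ω n := by
  induction n with
  | zero => exact IsLocallyConstant.const _
  | succ n ih =>
    have h : IsLocallyConstant fun ω : ℕ → Fin M => ω n :=
      (IsLocallyConstant.iff_continuous _).2 (continuous_apply n)
    exact (ih.prodMk h).comp fun zk : (Fin m → ℝ) × Fin M =>
      childCorner τ R n zk.1 (e n zk.1 zk.2)

lemma measurable_codePoint : Measurable (codePoint (M := M) τ R e) := by
  refine measurable_pi_iff.2 fun i => Measurable.iSup fun n => ?_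
  have h : Continuous fun ω : ℕ → Fin M => codeCorner τ R e ω n :=
    (isLocallyConstant_codeCorner n).continuous
  exact ((continuous_apply i).comp h).measurable

lemma cornerBox_codeCorner_antitone (hR : 0 < R) (hN : ∀ i, (N i : ℝ) ≤ R ^ (1 + τ i))
    (ω : ℕ → Fin M) : Antitone fun n => cornerBox τ R n (codeCorner τ R e ω n) :=
  antitone_nat_of_succ_le fun n => cornerBox_childCorner_subset τ hR hN n _ _

lemma codeCorner_monotone (hR : 0 < R) (ω : ℕ → Fin M) (i : Fin m) :
    Monotone fun n => codeCorner τ R e ω n i := by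
  refine monotone_nat_of_le_succ fun n => ?_
  have := sideLen_pos τ hR (n + 1) i
  simp only [codeCorner, childCorner, le_add_iff_nonneg_right]
  positivity

lemma codePoint_mem_cornerBox (hR : 0 < R) (hN : ∀ i, (N i : ℝ) ≤ R ^ (1 + τ i))
    (ω : ℕ → Fin M) (n : ℕ) :
    codePoint τ R e ω ∈ cornerBox τ R n (codeCorner τ R e ω n) := by
  intro i
  have hle : ∀ k, codeCorner τ R e ω k i ≤ codeCorner τ R e ω n i + sideLen τ R n i := by
    intro k
    have hself : codeCorner τ R e ω (max k n) ∈
        cornerBox τ R (max k n) (codeCorner τ R e ω (max k n)) :=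
      fun i => ⟨le_rfl, by linarith [sideLen_pos τ hR (max k n) i]⟩
    have h1 := cornerBox_codeCorner_antitone hR hN ω (le_max_right k n) hself
    exact (codeCorner_monotone hR ω i (le_max_left k n)).trans (h1 i).2
  have hbdd : BddAbove (range fun n => codeCorner τ R e ω n i) :=
    ⟨_, by rintro _ ⟨k, rfl⟩; exact hle k⟩
  exact ⟨le_ciSup hbdd n, ciSup_le hle⟩

/-- The half-open box with corner `z` of generation `n`. -/
def halfOpenBox (τ : Fin m → ℝ) (R : ℝ) (n : ℕ) (z : Fin m → ℝ) : Set (Fin m → ℝ) :=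
  Set.univ.pi fun i => Ico (z i) (z i + sideLen τ R n i)

lemma eq_of_mem_halfOpenBox_childCorner (hR : 0 < R) {n : ℕ} {z x : Fin m → ℝ}
    {j j' : ∀ i, Fin (N i)} (h : x ∈ halfOpenBox τ R (n + 1) (childCorner τ R n z j))
    (h' : x ∈ halfOpenBox τ R (n + 1) (childCorner τ R n z j')) : j = j' := by
  have key : ∀ {j j' : ∀ i, Fin (N i)},
      x ∈ halfOpenBox τ R (n + 1) (childCorner τ R n z j) →
      x ∈ halfOpenBox τ R (n + 1) (childCorner τ R n z j') → ∀ i, (j i : ℕ) ≤ j' i := by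
    intro j j' h h' i
    have h1 := (h i (mem_univ i)).1
    have h2 := (h' i (mem_univ i)).2
    simp only [childCorner] at h1 h2
    have hpos := sideLen_pos τ hR (n + 1) i
    have h3 : ((j i : ℕ) : ℝ) * sideLen τ R (n + 1) i <
        (((j' i : ℕ) : ℝ) + 1) * sideLen τ R (n + 1) i := by linarith
    have h4 := lt_of_mul_lt_mul_right h3 hpos.le
    have h5 : (j i : ℕ) < (j' i : ℕ) + 1 := by exact_mod_cast h4
    omega
  funext i
  exact Fin.ext (le_antisymm (key h h' i) (key h' h i))

lemma halfOpenBox_childCorner_subset (hR : 0 < R) (hN : ∀ i, (N i : ℝ) ≤ R ^ (1 + τ i))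
    (n : ℕ) (z : Fin m → ℝ) (j : ∀ i, Fin (N i)) :
    halfOpenBox τ R (n + 1) (childCorner τ R n z j) ⊆ halfOpenBox τ R n z := by
  have hcorner : childCorner τ R n z j ∈ cornerBox τ R n z :=
    cornerBox_childCorner_subset τ hR hN n z j
      fun i => ⟨le_rfl, by linarith [sideLen_pos τ hR (n + 1) i]⟩
  have hupper : (fun i => childCorner τ R n z j i + sideLen τ R (n + 1) i) ∈ cornerBox τ R n z :=
    cornerBox_childCorner_subset τ hR hN n z j
      fun i => ⟨by linarith [sideLen_pos τ hR (n + 1) i], le_rfl⟩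
  exact pi_mono fun i _ => Ico_subset_Ico (hcorner i).1 (hupper i).2

lemma eq_of_mem_halfOpenBox_codeCorner (hR : 0 < R) (hN : ∀ i, (N i : ℝ) ≤ R ^ (1 + τ i))
    (he : ∀ n z, Function.Injective (e n z)) {ω ω' : ℕ → Fin M} {n : ℕ} {x : Fin m → ℝ}
    (h : x ∈ halfOpenBox τ R n (codeCorner τ R e ω n))
    (h' : x ∈ halfOpenBox τ R n (codeCorner τ R e ω' n)) : ∀ k < n, ω k = ω' k := by
  induction n with
  | zero => intro k hk; omega
  | succ n ih =>
    have hlt := ih (halfOpenBox_childCorner_subset hR hN n _ _ h)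
      (halfOpenBox_childCorner_subset hR hN n _ _ h')
    intro k hk
    rcases Nat.lt_succ_iff_lt_or_eq.1 hk with hk | rfl
    · exact hlt k hk
    · simp only [codeCorner] at h h'
      rw [← codeCorner_congr hlt] at h'
      exact he _ _ (eq_of_mem_halfOpenBox_childCorner hR h h')

lemma volume_halfOpenBox (hR : 0 < R) (hσ : ∑ i, τ i = 1) (n : ℕ) (z : Fin m → ℝ) :
    volume (halfOpenBox τ R n z) = ENNReal.ofReal ((((R ^ n) ^ (m + 1))⁻¹)) := by
  rw [halfOpenBox, Real.volume_pi_Ico, ← ENNReal.ofReal_prod_of_nonneg]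
  · congr 1
    simp only [add_sub_cancel_left, sideLen]
    rw [← Real.rpow_sum_of_pos (by positivity), Finset.sum_neg_distrib, Finset.sum_add_distrib, hσ,
      Real.rpow_neg (by positivity)]
    simp only [Finset.sum_const, Finset.card_univ, Fintype.card_fin, nsmul_eq_mul, mul_one]
    exact_mod_cast congrArg _ (Real.rpow_natCast (R ^ n) (m + 1))
  · intro i _
    linarith [sideLen_pos τ hR n i]

lemma sideLen_le (hR : 1 ≤ R) (hτ : ∀ i, 0 ≤ τ i) (n : ℕ) (i : Fin m) :
    sideLen τ R n i ≤ (R ^ n)⁻¹ := by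
  rw [sideLen, ← Real.rpow_neg_one]
  exact Real.rpow_le_rpow_of_exponent_le (one_le_pow₀ hR) (by linarith [hτ i])

/-- The uniform Bernoulli measure on infinite words. -/
def wordMeasure (M : ℕ) [NeZero M] : Measure (ℕ → Fin M) :=
  Measure.infinitePi fun _ : ℕ => (PMF.uniformOfFintype (Fin M)).toMeasure

instance (M : ℕ) [NeZero M] : IsProbabilityMeasure (wordMeasure M) := by
  unfold wordMeasure; infer_instance

lemma wordMeasure_cylinder [NeZero M] (n : ℕ) (ω₀ : ℕ → Fin M) :
    wordMeasure M {ω | ∀ k < n, ω k = ω₀ k} = ((M : ENNReal)⁻¹) ^ n := by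
  have : {ω : ℕ → Fin M | ∀ k < n, ω k = ω₀ k} =
      Set.pi (Finset.range n : Set ℕ) fun k => {ω₀ k} := by
    ext ω; simp [Set.pi]
  rw [this, wordMeasure, Measure.infinitePi_pi _ fun k _ => measurableSet_singleton _]
  simp

/-- The mass of a set of small diameter, in terms of the number of boxes that it can meet. -/
lemma wordMeasure_preimage_codePoint_le [NeZero M] (hR : 1 ≤ R) (hτ : ∀ i, 0 ≤ τ i)
    (hσ : ∑ i, τ i = 1) (hN : ∀ i, (N i : ℝ) ≤ R ^ (1 + τ i))
    (he : ∀ n z, Function.Injective (e n z)) (U : Set (Fin m → ℝ)) {r : ℝ} (hr : 0 ≤ r)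
    (hU : Metric.ediam U ≤ ENNReal.ofReal r) (n : ℕ) :
    wordMeasure M (codePoint τ R e ⁻¹' U) ≤
      ENNReal.ofReal ((R ^ (m + 1) / M) ^ n * (2 * (r + (R ^ n)⁻¹)) ^ m) := by
  classical
  have hR0 : 0 < R := by linarith
  have hM : (0 : ℝ) < M := by exact_mod_cast NeZero.pos M
  rcases U.eq_empty_or_nonempty with rfl | ⟨u, hu⟩
  · simp
  let ext : (Fin n → Fin M) → ℕ → Fin M := fun w k => if h : k < n then w ⟨k, h⟩ else 0
  have hext : ∀ (w : Fin n → Fin M) (ω : ℕ → Fin M), (∀ k : Fin n, ω k = w k) →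
      ∀ k < n, ω k = ext w k := by
    intro w ω h k hk
    simp only [ext, hk, dif_pos]
    exact h ⟨k, hk⟩
  let W : Finset (Fin n → Fin M) :=
    Finset.univ.filter fun w => ∃ ω, codePoint τ R e ω ∈ U ∧ ∀ k : Fin n, ω k = w k
  have hcover : codePoint τ R e ⁻¹' U ⊆ ⋃ w ∈ W, {ω | ∀ k < n, ω k = ext w k} := by
    intro ω hω
    simp only [mem_iUnion, exists_prop]
    refine ⟨fun k => ω k, ?_, hext _ _ fun k => rfl⟩
    simp only [W, Finset.mem_filter, Finset.mem_univ, true_and]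
    exact ⟨ω, hω, fun k => rfl⟩
  have hmass : wordMeasure M (codePoint τ R e ⁻¹' U) ≤ W.card * ((M : ENNReal)⁻¹) ^ n := by
    refine (measure_mono hcover).trans ((measure_biUnion_finset_le _ _).trans ?_)
    simp [wordMeasure_cylinder]
  let H : (Fin n → Fin M) → Set (Fin m → ℝ) := fun w =>
    halfOpenBox τ R n (codeCorner τ R e (ext w) n)
  have hdisj : (W : Set (Fin n → Fin M)).PairwiseDisjoint H := by
    intro w _ w' _ hne
    refine Set.disjoint_left.2 fun x hx hx' => hne ?_
    funext k
    have := eq_of_mem_halfOpenBox_codeCorner hR0 hN he hx hx' k k.2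
    simpa [ext] using this
  have hball : (⋃ w ∈ W, H w) ⊆ Metric.closedBall u (r + (R ^ n)⁻¹) := by
    intro x hx
    simp only [mem_iUnion, exists_prop] at hx
    obtain ⟨w, hw, hxw⟩ := hx
    simp only [W, Finset.mem_filter, Finset.mem_univ, true_and] at hw
    obtain ⟨ω, hωU, hω⟩ := hw
    have hmem := codePoint_mem_cornerBox (e := e) hR0 hN ω n
    rw [codeCorner_congr (hext w ω hω)] at hmem
    have h1 : dist x (codePoint τ R e ω) ≤ (R ^ n)⁻¹ := by
      refine (dist_pi_le_iff (by positivity)).2 fun i => ?_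
      rw [Real.dist_eq, abs_le]
      have h2 := hmem i
      have h3 := hxw i (mem_univ i)
      have h4 := sideLen_le hR hτ n i
      constructor <;> linarith [h2.1, h2.2, h3.1, h3.2]
    have h5 : dist (codePoint τ R e ω) u ≤ r := by
      rw [← ENNReal.ofReal_le_ofReal_iff hr, ← edist_dist]
      exact (Metric.edist_le_ediam_of_mem hωU hu).trans hU
    rw [Metric.mem_closedBall]
    linarith [dist_triangle x (codePoint τ R e ω) u]
  have hcard : (W.card : ENNReal) * ENNReal.ofReal (((R ^ n) ^ (m + 1))⁻¹) ≤
      ENNReal.ofReal ((2 * (r + (R ^ n)⁻¹)) ^ m) := by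
    have h1 := measure_mono (μ := volume) hball
    rw [measure_biUnion_finset hdisj fun w _ => MeasurableSet.univ_pi fun _ => measurableSet_Ico,
      Real.volume_pi_closedBall _ (by positivity)] at h1
    simpa [H, volume_halfOpenBox hR0 hσ] using h1
  have hcard' : (W.card : ℝ) * ((R ^ n) ^ (m + 1))⁻¹ ≤ (2 * (r + (R ^ n)⁻¹)) ^ m := by
    rwa [← ENNReal.ofReal_natCast, ← ENNReal.ofReal_mul (by positivity),
      ENNReal.ofReal_le_ofReal_iff (by positivity)] at hcard
  refine hmass.trans ?_
  rw [← ENNReal.ofReal_natCast, ← ENNReal.ofReal_natCast, ← ENNReal.ofReal_inv_of_pos hM,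
    ← ENNReal.ofReal_pow (by positivity), ← ENNReal.ofReal_mul (by positivity)]
  refine ENNReal.ofReal_le_ofReal ?_
  calc (W.card : ℝ) * (M : ℝ)⁻¹ ^ n
      = (R ^ (m + 1) / M) ^ n * (W.card * ((R ^ n) ^ (m + 1))⁻¹) := by
        rw [div_pow, ← pow_mul, ← pow_mul, mul_comm n, inv_pow]
        field_simp
    _ ≤ _ := by gcongr

/-- The Frostman bound for the image of the Bernoulli measure. -/
lemma wordMeasure_preimage_codePoint_le_rpow [NeZero M] (hR : 1 < R) (hτ : ∀ i, 0 ≤ τ i)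
    (hσ : ∑ i, τ i = 1) (hN : ∀ i, (N i : ℝ) ≤ R ^ (1 + τ i))
    (he : ∀ n z, Function.Injective (e n z)) {ε d : ℝ} (hd : 0 ≤ d) (hdε : d + ε ≤ m)
    (hM : R ^ (m + 1) / M ≤ R ^ ε) (U : Set (Fin m → ℝ)) {r : ℝ} (hr : 0 < r) (hr1 : r < 1)
    (hU : Metric.ediam U ≤ ENNReal.ofReal r) :
    wordMeasure M (codePoint τ R e ⁻¹' U) ≤
      ENNReal.ofReal (4 ^ m * R ^ d) * ENNReal.ofReal r ^ d := by
  have hR0 : 0 < R := by linarith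
  have hM0 : (0 : ℝ) < M := by exact_mod_cast NeZero.pos M
  obtain ⟨n, hn1, hn2⟩ := exists_nat_pow_near (one_le_inv_iff₀.2 ⟨hr, hr1.le⟩) hR
  refine (wordMeasure_preimage_codePoint_le hR.le hτ hσ hN he U hr.le hU n).trans ?_
  rw [ENNReal.ofReal_rpow_of_pos hr, ← ENNReal.ofReal_mul (by positivity)]
  refine ENNReal.ofReal_le_ofReal ?_
  have hX : 0 < R ^ n := by positivity
  have hrX : r ≤ (R ^ n)⁻¹ := (le_inv_comm₀ hX hr).1 hn1
  have hXr : (R ^ n)⁻¹ ≤ R * r := by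
    rw [inv_le_iff_one_le_mul₀ hX]
    rw [inv_lt_iff_one_lt_mul₀ hr, pow_succ] at hn2
    linarith
  calc (R ^ (m + 1) / M) ^ n * (2 * (r + (R ^ n)⁻¹)) ^ m
      ≤ (R ^ ε) ^ n * (4 * (R ^ n)⁻¹) ^ m := by
        refine mul_le_mul (pow_le_pow_left₀ (by positivity) hM n)
          (pow_le_pow_left₀ (by positivity) (by linarith) m) (by positivity) (by positivity)
    _ = 4 ^ m * (R ^ n) ^ (ε - m) := by
        rw [Real.rpow_sub hX, Real.rpow_natCast, mul_pow, inv_pow, ← Real.rpow_natCast (R ^ ε),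
          ← Real.rpow_mul hR0.le, mul_comm ε, Real.rpow_mul hR0.le, Real.rpow_natCast]
        ring
    _ ≤ 4 ^ m * (R ^ n) ^ (-d) := by
        gcongr
        · exact one_le_pow₀ hR.le
        · linarith
    _ = 4 ^ m * ((R ^ n)⁻¹) ^ d := by
        rw [Real.rpow_neg hX.le, Real.inv_rpow hX.le]
    _ ≤ 4 ^ m * (R * r) ^ d := by gcongr
    _ = 4 ^ m * R ^ d * r ^ d := by
        rw [Real.mul_rpow hR0.le hr.le, mul_assoc]

end Coding

/-- The mass distribution principle. -/
lemma le_dimH_of_frostman {X : Type*} [MetricSpace X] [MeasurableSpace X] [BorelSpace X]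
    {μ : Measure X} {K : Set X} (hK : μ K ≠ 0) {C : ENNReal} (hC0 : C ≠ 0) (hC : C ≠ ⊤)
    {d : NNReal}
    (h : ∀ (U : Set X) (r : ℝ), IsClosed U → 0 < r → r < 1 → Metric.ediam U ≤ ENNReal.ofReal r →
      μ U ≤ C * ENNReal.ofReal r ^ (d : ℝ)) : (d : ENNReal) ≤ dimH K := by
  have hle : C⁻¹ • μ ≤ μH[d] := by
    refine Measure.le_hausdorffMeasure _ _ (1 / 2) (by simp) fun s hs => ?_
    rw [Measure.smul_apply, smul_eq_mul, ENNReal.inv_mul_le_iff hC0 hC]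
    have hne : Metric.ediam s ≠ ⊤ := ne_top_of_le_ne_top (by simp) hs
    have hD : (Metric.ediam s).toReal ≤ 1 / 2 := by
      have := ENNReal.toReal_mono (by simp) hs
      simpa using this
    have hlim : Filter.Tendsto
        (fun r : ℝ => C * ENNReal.ofReal ((Metric.ediam s).toReal + r) ^ (d : ℝ))
        (nhdsWithin 0 (Ioi 0)) (nhds (C * Metric.ediam s ^ (d : ℝ))) := by
      refine ENNReal.Tendsto.const_mul ?_ (Or.inr hC)
      refine ((ENNReal.continuous_rpow_const).tendsto _).comp ?_
      have h1 : Filter.Tendsto (fun r : ℝ => ENNReal.ofReal ((Metric.ediam s).toReal + r))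
          (nhds 0) (nhds (ENNReal.ofReal ((Metric.ediam s).toReal + 0))) :=
        (ENNReal.continuous_ofReal.comp (continuous_const.add continuous_id)).tendsto 0
      rw [add_zero, ENNReal.ofReal_toReal hne] at h1
      exact h1.mono_left nhdsWithin_le_nhds
    refine ge_of_tendsto hlim ?_
    have hmem : Ioo (0 : ℝ) (1 / 2) ∈ nhdsWithin (0 : ℝ) (Ioi 0) :=
      Ioo_mem_nhdsGT (by norm_num)
    filter_upwards [hmem] with r hr
    have hnn : 0 ≤ (Metric.ediam s).toReal := ENNReal.toReal_nonneg
    refine (measure_mono subset_closure).trans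
      (h (closure s) _ isClosed_closure (by linarith [hr.1]) (by linarith [hr.2]) ?_)
    rw [Metric.ediam_closure, ← ENNReal.ofReal_toReal hne]
    exact ENNReal.ofReal_le_ofReal (by rw [ENNReal.toReal_ofReal hnn]; linarith [hr.1])
  refine le_dimH_of_hausdorffMeasure_ne_zero fun h0 => ?_
  have := hle K
  rw [h0, Measure.smul_apply, smul_eq_mul, nonpos_iff_eq_zero, mul_eq_zero] at this
  rcases this with h1 | h1
  · exact hC (ENNReal.inv_eq_zero.1 h1)
  · exact hK h1

/-- A lower bound for the dimension of a set that contains the limit points of all nested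
sequences of boxes in which every box has at least `M` admissible children. -/
lemma le_dimH_of_nested_boxes {m M : ℕ} (hM0 : M ≠ 0) {τ : Fin m → ℝ} {R : ℝ} {N : Fin m → ℕ}
    (hR : 1 < R) (hτ : ∀ i, 0 ≤ τ i) (hσ : ∑ i, τ i = 1)
    (hN : ∀ i, (N i : ℝ) ≤ R ^ (1 + τ i))
    (good : ℕ → (Fin m → ℝ) → Finset (∀ i, Fin (N i))) (hgood : ∀ n z, M ≤ (good n z).card)
    {d : NNReal} {ε : ℝ} (hdε : d + ε ≤ m) (hM : R ^ (m + 1) / M ≤ R ^ ε)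
    {K : Set (Fin m → ℝ)}
    (hK : ∀ (z : ℕ → Fin m → ℝ) (x : Fin m → ℝ), z 0 = 0 →
      (∀ n, ∃ j ∈ good n (z n), z (n + 1) = childCorner τ R n (z n) j) →
      (∀ n, x ∈ cornerBox τ R n (z n)) → x ∈ K) : (d : ENNReal) ≤ dimH K := by
  have : NeZero M := ⟨hM0⟩
  have hR0 : 0 < R := by linarith
  have hexists : ∀ n z, ∃ f : Fin M → ∀ i, Fin (N i), Function.Injective f ∧
      ∀ k, f k ∈ good n z := by
    intro n z
    obtain ⟨g⟩ : Nonempty (Fin M ↪ good n z) :=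
      Function.Embedding.nonempty_of_card_le (by simpa using hgood n z)
    exact ⟨fun k => g k, fun k l h => g.injective (Subtype.ext h), fun k => (g k).2⟩
  choose e he heg using hexists
  have hmem : ∀ ω, codePoint τ R e ω ∈ K := fun ω =>
    hK (codeCorner τ R e ω) _ rfl (fun n => ⟨_, heg n _ (ω n), rfl⟩)
      (codePoint_mem_cornerBox hR0 hN ω)
  refine le_dimH_of_frostman (μ := (wordMeasure M).map (codePoint τ R e))
    (C := ENNReal.ofReal (4 ^ m * R ^ (d : ℝ))) ?_ ?_ ENNReal.ofReal_ne_top ?_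
  · have h1 := Measure.le_map_apply (μ := wordMeasure M)
      (measurable_codePoint (τ := τ) (R := R) (e := e)).aemeasurable K
    rw [show codePoint τ R e ⁻¹' K = univ from eq_univ_of_forall hmem, measure_univ] at h1
    exact (zero_lt_one.trans_le h1).ne'
  · exact (ENNReal.ofReal_pos.2 (by positivity)).ne'
  · intro U r hU hr hr1 hUr
    rw [Measure.map_apply measurable_codePoint hU.measurableSet]
    exact wordMeasure_preimage_codePoint_le_rpow hR hτ hσ hN he d.2 hdε hM U hr hr1 hUr

/-- All parameters of the box construction can be chosen with small loss of dimension. -/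
lemma exists_box_ratio (m : ℕ) {ε : ℝ} (hε : 0 < ε) :
    ∃ R : ℝ, 1 < R ∧ ((m + 1).factorial : ℝ) * 2 ^ m < R ∧ 2 * (4 * m + 1) ≤ R ∧
      2 ^ (m + 1) ≤ R ^ ε := by
  have h := ((tendsto_rpow_atTop hε).eventually_ge_atTop ((2 : ℝ) ^ (m + 1)))
  obtain ⟨R, h1, h2, h3, h4⟩ := ((Filter.eventually_gt_atTop (1 : ℝ)).and
    ((Filter.eventually_gt_atTop (((m + 1).factorial : ℝ) * 2 ^ m)).and
      ((Filter.eventually_ge_atTop (2 * (4 * (m : ℝ) + 1))).and h))).exists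
  exact ⟨R, h1, h2, h3, h4⟩

/-- The limit points of sequences of safe boxes are badly approximable. -/
lemma mem_badSet_of_isSafe {m : ℕ} {τ : Fin m → ℝ} (hτ : ∀ i, 0 ≤ τ i) (hσ : ∑ i, τ i = 1)
    {R : ℝ} (hR : 1 < R) {z : ℕ → Fin m → ℝ} {x : Fin m → ℝ} (hz : z 0 = 0)
    (hsafe : ∀ n, IsSafe τ R n (z (n + 1))) (hx : ∀ n, x ∈ cornerBox τ R n (z n)) :
    x ∈ badSet m (psiTau m τ) := by
  have hR0 : 0 < R := by linarith
  refine ⟨⟨fun i => ?_, infinite_weighted_dirichlet τ hτ hσ x⟩, ?_⟩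
  · have h0 := hx 0 i
    simpa [hz, sideLen] using h0
  · intro hmem
    have hc : (R ^ 6)⁻¹ ∈ Ioo (0 : ℝ) 1 :=
      ⟨by positivity, inv_lt_one_of_one_lt₀ (one_lt_pow₀ hR (by norm_num))⟩
    obtain ⟨q, hq0, p, hp⟩ := (mem_iInter₂.1 hmem _ hc).2.nonempty
    have hq1 : (1 : ℝ) ≤ q := by exact_mod_cast hq0
    obtain ⟨n, hn1, hn2⟩ := exists_nat_pow_near
      (one_le_mul_of_one_le_of_one_le hq1 (one_le_pow₀ hR.le (n := 2))) hR
    obtain ⟨i, hi⟩ := hsafe n q hn1 hn2 p x (hx (n + 1))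
    exact absurd (hp i) (not_lt.2 hi)

lemma le_dimH_badSet {m : ℕ} {τ : Fin m → ℝ} (hτ : ∀ i, 0 ≤ τ i) (hσ : ∑ i, τ i = 1)
    {d : NNReal} (hd : (d : ℝ) < m) : (d : ENNReal) ≤ dimH (badSet m (psiTau m τ)) := by
  classical
  obtain ⟨R, hR, hRm, hRN, hRε⟩ := exists_box_ratio m (sub_pos.2 hd)
  have hR0 : 0 < R := by linarith
  have hRle : ∀ i, R ≤ R ^ (1 + τ i) := fun i =>
    Real.self_le_rpow_of_one_le hR.le (by linarith [hτ i])
  set N : Fin m → ℕ := fun i => ⌊R ^ (1 + τ i)⌋₊ with hNdef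
  have hN : ∀ i, (N i : ℝ) ≤ R ^ (1 + τ i) := fun i => Nat.floor_le (by positivity)
  have hN' : ∀ i, 2 * (4 * m + 1) ≤ N i := fun i =>
    Nat.le_floor (by push_cast; exact hRN.trans (hRle i))
  have hNhalf : ∀ i, R ^ (1 + τ i) ≤ 2 * N i := by
    intro i
    have h1 : R ^ (1 + τ i) < N i + 1 := Nat.lt_floor_add_one _
    have h2 : (1 : ℝ) ≤ N i := by exact_mod_cast (by have := hN' i; omega : 1 ≤ N i)
    linarith
  have hprodpos : 0 < ∏ i, N i := Finset.prod_pos fun i _ => by have := hN' i; omega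
  set M : ℕ := ∏ i, N i - (∏ i, N i) / 2 with hM
  have hM0 : 0 < M := by omega
  have hM2 : ∏ i, N i ≤ 2 * M := by omega
  have hprod : R ^ (m + 1) ≤ 2 ^ (m + 1) * M := by
    calc R ^ (m + 1) = ∏ i, R ^ (1 + τ i) := by
          rw [← Real.rpow_sum_of_pos hR0, Finset.sum_add_distrib, hσ, ← Real.rpow_natCast]
          simp
      _ ≤ ∏ i, (2 * (N i : ℝ)) :=
          Finset.prod_le_prod (fun i _ => by positivity) fun i _ => hNhalf i
      _ = 2 ^ m * ((∏ i, N i : ℕ) : ℝ) := by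
          rw [Finset.prod_mul_distrib]; simp
      _ ≤ 2 ^ m * ((2 * M : ℕ) : ℝ) := by gcongr
      _ = 2 ^ (m + 1) * M := by push_cast; ring
  refine le_dimH_of_nested_boxes hM0.ne' hR hτ hσ hN
    (fun n z => Finset.univ.filter fun j => IsSafe τ R n (childCorner τ R n z j)) ?_
    (ε := m - d) (by linarith) ?_ ?_
  · intro n z
    have h1 := two_mul_card_not_isSafe_le τ hτ hσ hR.le hRm hN hN' n z
      (Finset.univ.filter fun j => ¬ IsSafe τ R n (childCorner τ R n z j)) (by simp)
    have h2 := Finset.card_filter_add_card_filter_not (s := Finset.univ)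
      fun j : ∀ i, Fin (N i) => IsSafe τ R n (childCorner τ R n z j)
    have h3 : (Finset.univ : Finset (∀ i, Fin (N i))).card = ∏ i, N i := by
      simp [Finset.card_univ]
    omega
  · rw [div_le_iff₀ (by exact_mod_cast hM0)]
    exact hprod.trans (by gcongr)
  · intro z x hz hstep hx
    refine mem_badSet_of_isSafe hτ hσ hR hz (fun n => ?_) hx
    obtain ⟨j, hj, hjz⟩ := hstep n
    rw [hjz]
    exact (Finset.mem_filter.1 hj).2

/-- Schmidt: for `τ ∈ ℝ_{≥0}^m` with `τ1 + ⋯ + τm = 1`,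
`dim_H B_m(Ψ_τ) = m`. -/
theorem stmt16 (m : ℕ) (hm : 1 ≤ m) (τ : Fin m → ℝ) (hτ : ∀ i, 0 ≤ τ i)
    (hσ : ∑ i, τ i = 1) :
    dimH (badSet m (psiTau m τ)) = (m : ENNReal) := by
  refine le_antisymm ?_ ?_
  · exact (dimH_mono (subset_univ _)).trans (Real.dimH_univ_pi_fin m).le
  · refine ENNReal.le_of_forall_nnreal_lt fun d hd => le_dimH_badSet hτ hσ ?_
    exact_mod_cast hd
end
end
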